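/- Let (φ_{t,s})_{0≤s≤t<T} be an evolution family over parallel slit half-planes (D_t)_{t∈[0,T)}, with λ(t) the angular residue of φ_{t,0}. Then there exists an evolution family (φ̃_{t,s})_{0≤s≤t≤T} over parallel slit half-planes (D̃_t)_{t∈[0,T]} with D̃_t = D_t and φ̃_{t,s} = φ_{t,s} for all 0 ≤ s ≤ t < T, if and only if sup_{0≤t<T} λ(t) < ∞. Moreover, when it exists, such an extension is unique. -/

import Mathlib

open Complex Set Filter Topology Bornology MeasureTheory Metric

noncomputable section

/-- The upper half-plane `ℍ = {z : ℂ | 0 < Im z}`. -/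
def UHP : Set ℂ := {z : ℂ | 0 < z.im}

/-- The half-plane `ℍ_η = {z : ℂ | η < Im z}`. -/
def HP (η : ℝ) : Set ℂ := {z : ℂ | η < z.im}

/-- The sector `△_θ = {z : ℂ | θ < arg z < π - θ}`. -/
def Sector (θ : ℝ) : Set ℂ :=
  {z : ℂ | θ < Complex.arg z ∧ Complex.arg z < Real.pi - θ}

/-- A closed horizontal line segment of positive length contained in `ℍ`. -/
def IsHorizontalSlit (C : Set ℂ) : Prop :=
  ∃ y xl xr : ℝ, 0 < y ∧ xl < xr ∧
    C = {z : ℂ | z.im = y ∧ z.re ∈ Set.Icc xl xr}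

/-- A parallel slit half-plane with `N` slits: `ℍ` minus `N` pairwise disjoint
closed horizontal segments of positive length. -/
def IsParallelSlitHalfPlaneN (N : ℕ) (D : Set ℂ) : Prop :=
  ∃ C : Fin N → Set ℂ,
    (∀ j, IsHorizontalSlit (C j)) ∧
    (Pairwise fun i j => Disjoint (C i) (C j)) ∧
    D = UHP \ ⋃ j, C j

/-- A parallel slit half-plane (with some number of slits). -/
def IsParallelSlitHalfPlane (D : Set ℂ) : Prop :=
  ∃ N : ℕ, IsParallelSlitHalfPlaneN N D

/-- (H.1): hydrodynamic normalization at infinity. -/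
def SatisfiesH1 (D : Set ℂ) (f : ℂ → ℂ) : Prop :=
  ∃ η : ℝ, 0 ≤ η ∧ HP η ⊆ D ∧
    Tendsto (fun z => f z - z) (cobounded ℂ ⊓ 𝓟 (HP η)) (𝓝 0)

/-- (H.2): `f` has angular residue `c` at infinity, i.e. `z (f z - z) → -c`
as `z → ∞` within every sector `△_θ`. -/
def SatisfiesH2 (f : ℂ → ℂ) (c : ℂ) : Prop :=
  ∀ θ : ℝ, 0 < θ → θ < Real.pi / 2 →
    Tendsto (fun z => z * (f z - z)) (cobounded ℂ ⊓ 𝓟 (Sector θ)) (𝓝 (-c))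

/-- `F` is an ℍ-hull: relatively closed in `ℍ` with `ℍ \ F` a simply connected
domain. -/
def IsHHull (F : Set ℂ) : Prop :=
  F ⊆ UHP ∧ closure F ∩ UHP ⊆ F ∧
    IsConnected (UHP \ F) ∧ SimplyConnectedSpace ↥(UHP \ F)

/-- `η_D = min {Im w | w ∈ ℍ \ D}`. -/
def etaD (D : Set ℂ) : ℝ := sInf (Complex.im '' (UHP \ D))

/-- A (chordal) evolution family `φ t s : D s → D t` (for `s ≤ t` in `I`) over
parallel slit half-planes `D t`, where `lam t` is the angular residue of
`φ t 0` at infinity. -/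
structure IsEvolutionFamily (I : Set ℝ) (D : ℝ → Set ℂ)
    (φ : ℝ → ℝ → ℂ → ℂ) (lam : ℝ → ℂ) : Prop where
  slit : ∀ t ∈ I, IsParallelSlitHalfPlane (D t)
  mapsTo : ∀ s ∈ I, ∀ t ∈ I, s ≤ t → Set.MapsTo (φ t s) (D s) (D t)
  holo : ∀ s ∈ I, ∀ t ∈ I, s ≤ t → DifferentiableOn ℂ (φ t s) (D s)
  inj : ∀ s ∈ I, ∀ t ∈ I, s ≤ t → Set.InjOn (φ t s) (D s)
  h1 : ∀ s ∈ I, ∀ t ∈ I, s ≤ t → SatisfiesH1 (D s) (φ t s)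
  h2 : ∀ s ∈ I, ∀ t ∈ I, s ≤ t → ∃ c : ℂ, SatisfiesH2 (φ t s) c
  h3 : ∀ s ∈ I, ∀ t ∈ I, s ≤ t → IsHHull (D t \ φ t s '' D s)
  ef1 : ∀ t ∈ I, Set.EqOn (φ t t) id (D t)
  ef2 : ∀ s ∈ I, ∀ t ∈ I, ∀ u ∈ I, s ≤ t → t ≤ u →
    ∀ z ∈ D s, φ u s z = φ u t (φ t s z)
  lam_res : ∀ t ∈ I, SatisfiesH2 (φ t 0) (lam t)
  ef3 : ContinuousOn lam I

/-- A (chordal) Loewner chain `f t : D t → Dcod` over parallel slit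
half-planes `D t` with codomain `Dcod`, where `ell t` is the angular residue
of `f t` at infinity. -/
structure IsLoewnerChain (I : Set ℝ) (D : ℝ → Set ℂ) (Dcod : Set ℂ)
    (f : ℝ → ℂ → ℂ) (ell : ℝ → ℂ) : Prop where
  slit : ∀ t ∈ I, IsParallelSlitHalfPlane (D t)
  slitcod : IsParallelSlitHalfPlane Dcod
  mapsTo : ∀ t ∈ I, Set.MapsTo (f t) (D t) Dcod
  holo : ∀ t ∈ I, DifferentiableOn ℂ (f t) (D t)
  inj : ∀ t ∈ I, Set.InjOn (f t) (D t)
  h1 : ∀ t ∈ I, SatisfiesH1 (D t) (f t)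
  h2 : ∀ t ∈ I, SatisfiesH2 (f t) (ell t)
  h3 : ∀ t ∈ I, IsHHull (Dcod \ f t '' D t)
  lc1 : ∀ s ∈ I, ∀ t ∈ I, s ≤ t → f s '' D s ⊆ f t '' D t
  lc2 : ContinuousOn ell I

/-- `(Lip)_μ`: Lipschitz continuity of `t ↦ f t` w.r.t. the measure `μ`,
uniformly on compact subsets of `D`. -/
def SatisfiesLip (I : Set ℝ) (μ : Measure ℝ) (D : Set ℂ)
    (f : ℝ → ℂ → ℂ) : Prop :=
  ∀ K : Set ℂ, K ⊆ D → IsCompact K → ∃ L : ℝ,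
    ∀ s ∈ I, ∀ t ∈ I, s ≤ t → ∀ z ∈ K,
      ‖f t z - f s z‖ ≤ L * (μ (Set.Ioc s t)).toReal

/-- `(AC)_μ`: absolute continuity of `t ↦ f t` w.r.t. the measure `μ`,
uniformly on compact subsets of `D`. -/
def SatisfiesAC (I : Set ℝ) (μ : Measure ℝ) (D : Set ℂ)
    (f : ℝ → ℂ → ℂ) : Prop :=
  ∀ K : Set ℂ, K ⊆ D → IsCompact K →
    ∃ ν : Measure ℝ, ν ≪ μ ∧
      (∀ a ∈ I, ∀ b ∈ I, ν (Set.Icc a b) < ⊤) ∧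
      ∀ s ∈ I, ∀ t ∈ I, s ≤ t → ∀ z ∈ K,
        ‖f t z - f s z‖ ≤ (ν (Set.Ioc s t)).toReal

/-- The symmetric difference quotient
`(f (t+δ) z - f (t-δ) z) / μ((t-δ, t+δ))`. -/
def symmQuot (μ : Measure ℝ) (f : ℝ → ℂ → ℂ) (t δ : ℝ) (z : ℂ) : ℂ :=
  (f (t + δ) z - f (t - δ) z) / ((μ (Set.Ioo (t - δ) (t + δ))).toReal : ℂ)

/-- A cross-cut of a domain `G`. -/
def IsCrossCut (G C : Set ℂ) : Prop :=
  ∃ c : ℝ → ℂ, ContinuousOn c (Set.Icc 0 1) ∧ Set.InjOn c (Set.Icc 0 1) ∧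
    c 0 ∈ frontier G ∧ c 1 ∈ frontier G ∧ c '' Set.Ioo 0 1 ⊆ G ∧
    C = c '' Set.Icc 0 1

/-- `C` separates `S` from `∞` in `G`: `S` is disjoint from the unbounded
connected component of `G \ C`. -/
def SeparatesFromInfty (G C S : Set ℂ) : Prop :=
  ∀ z ∈ S ∩ (G \ C), Bornology.IsBounded (connectedComponentIn (G \ C) z)

/-- The local growth property of a family of hulls `(F t)_{t ∈ [0,T]}` in `D`. -/
def LocalGrowth (T : ℝ) (D : Set ℂ) (F : ℝ → Set ℂ) : Prop :=
  ∀ ε : ℝ, 0 < ε → ∃ δ ∈ Set.Ioo 0 T, ∀ t ∈ Set.Icc 0 (T - δ),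
    ∃ C : Set ℂ, IsCrossCut (D \ F t) C ∧ Metric.diam C < ε ∧
      SeparatesFromInfty (D \ F t) C (F (t + δ) \ F t)

/-- Carathéodory kernel of a sequence of domains w.r.t. the point `a`. -/
def kernelAt (a : ℂ) (G : ℕ → Set ℂ) : Set ℂ :=
  connectedComponentIn
    {z : ℂ | ∃ r > 0, ∃ N : ℕ, ∀ n ≥ N, Metric.ball z r ⊆ G n} a

/-- Left continuity in Carathéodory's sense of `(F t)` at `t₀`. -/
def CaratheodoryLeftContinuousAt (D : Set ℂ) (F : ℝ → Set ℂ)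
    (T t₀ : ℝ) : Prop :=
  ∀ a ∈ D \ F T, ∀ s : ℕ → ℝ,
    Monotone s → (∀ n, s n ∈ Set.Ico 0 t₀) → Tendsto s atTop (𝓝 t₀) →
      kernelAt a (fun n => D \ F (s n)) = D \ F t₀

/-- Parameters of a horizontal slit of positive length in the upper half-plane. -/
structure Slit where
  y : ℝ
  xl : ℝ
  xr : ℝ
  hy : 0 < y
  hx : xl < xr

namespace Slit

variable (S : Slit)

/-- The slit as a subset of the plane. -/
def carrier : Set ℂ := {z : ℂ | z.im = S.y ∧ z.re ∈ Set.Icc S.xl S.xr}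

/-- A quarter of the length of the slit. -/
def q : ℝ := (S.xr - S.xl) / 4

/-- The centre of the slit. -/
def ctr : ℂ := ⟨(S.xl + S.xr) / 2, S.y⟩

/-- The Joukowski map onto the complement of the slit. -/
def J (ζ : ℂ) : ℂ := S.ctr + S.q * (ζ + ζ⁻¹)

/-- The sum of the distances to the end points, normalised to be `1` on the slit. -/
def ecc (z : ℂ) : ℝ :=
  (‖z - (S.ctr - 2 * S.q)‖ + ‖z - (S.ctr + 2 * S.q)‖) / (4 * S.q)

/-- The modulus of the Joukowski coordinate. -/
def rho (z : ℂ) : ℝ := S.ecc z + Real.sqrt (S.ecc z ^ 2 - 1)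

lemma q_pos : 0 < S.q := by have := S.hx; unfold q; linarith

lemma ctr_re : S.ctr.re = (S.xl + S.xr) / 2 := rfl
lemma ctr_im : S.ctr.im = S.y := rfl

lemma continuous_rho : Continuous S.rho := by
  unfold rho ecc
  fun_prop

lemma one_le_ecc (z : ℂ) : 1 ≤ S.ecc z := by
  have hq := S.q_pos
  unfold ecc
  rw [le_div_iff₀ (by positivity)]
  have h := norm_sub_le (z - (S.ctr - 2 * S.q)) (z - (S.ctr + 2 * S.q))
  have h2 : ‖z - (S.ctr - 2 * S.q) - (z - (S.ctr + 2 * S.q))‖ = 4 * S.q := by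
    have : z - (S.ctr - 2 * S.q) - (z - (S.ctr + 2 * S.q)) = ((4 * S.q : ℝ) : ℂ) := by
      push_cast; ring
    rw [this, Complex.norm_real, Real.norm_of_nonneg (by positivity)]
  linarith

lemma ecc_le_rho (z : ℂ) : S.ecc z ≤ S.rho z := by
  unfold rho
  linarith [Real.sqrt_nonneg (S.ecc z ^ 2 - 1)]

lemma one_le_rho (z : ℂ) : 1 ≤ S.rho z := (S.one_le_ecc z).trans (S.ecc_le_rho z)

lemma norm_add_sq_aux (ζ : ℂ) (hζ : ζ ≠ 0) (s : ℝ) (hs : s ^ 2 = 1) :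
    ‖ζ + ζ⁻¹ + 2 * s‖ = ‖ζ + s‖ ^ 2 / ‖ζ‖ := by
  have hs' : (s : ℂ) ^ 2 = 1 := by exact_mod_cast hs
  have : ζ + ζ⁻¹ + 2 * s = (ζ + s) ^ 2 / ζ := by
    field_simp
    linear_combination -hs'
  rw [this, norm_div, norm_pow]

lemma ecc_J {ζ : ℂ} (hζ : ζ ≠ 0) : S.ecc (S.J ζ) = (‖ζ‖ + ‖ζ‖⁻¹) / 2 := by
  have hq := S.q_pos
  have hn : 0 < ‖ζ‖ := norm_pos_iff.2 hζ
  have h1 : ‖S.J ζ - (S.ctr - 2 * S.q)‖ = S.q * (‖ζ + (1 : ℝ)‖ ^ 2 / ‖ζ‖) := by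
    rw [← norm_add_sq_aux ζ hζ 1 (by norm_num)]
    have : S.J ζ - (S.ctr - 2 * S.q) = S.q * (ζ + ζ⁻¹ + 2 * (1 : ℝ)) := by
      unfold J; push_cast; ring
    rw [this, norm_mul, Complex.norm_real, Real.norm_of_nonneg hq.le]
  have h2 : ‖S.J ζ - (S.ctr + 2 * S.q)‖ = S.q * (‖ζ + (-1 : ℝ)‖ ^ 2 / ‖ζ‖) := by
    rw [← norm_add_sq_aux ζ hζ (-1) (by norm_num)]
    have : S.J ζ - (S.ctr + 2 * S.q) = S.q * (ζ + ζ⁻¹ + 2 * (-1 : ℝ)) := by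
      unfold J; push_cast; ring
    rw [this, norm_mul, Complex.norm_real, Real.norm_of_nonneg hq.le]
  have h3 := parallelogram_law_with_norm ℝ ζ 1
  simp only [norm_one] at h3
  unfold ecc
  rw [h1, h2]
  push_cast
  rw [← sub_eq_add_neg]
  field_simp
  nlinarith

lemma rho_J {ζ : ℂ} (hζ : 1 ≤ ‖ζ‖) : S.rho (S.J ζ) = ‖ζ‖ := by
  have h0 : 0 < ‖ζ‖ := by linarith
  have hne : ζ ≠ 0 := norm_pos_iff.1 h0
  unfold rho
  rw [S.ecc_J hne]
  have h1 : ‖ζ‖⁻¹ ≤ 1 := inv_le_one_of_one_le₀ hζ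
  have : ((‖ζ‖ + ‖ζ‖⁻¹) / 2) ^ 2 - 1 = ((‖ζ‖ - ‖ζ‖⁻¹) / 2) ^ 2 := by
    field_simp; ring
  rw [this, Real.sqrt_sq (by linarith)]
  ring

lemma exists_J (z : ℂ) : ∃ ζ : ℂ, 1 ≤ ‖ζ‖ ∧ S.J ζ = z := by
  have hq : (S.q : ℂ) ≠ 0 := by exact_mod_cast S.q_pos.ne'
  set w := (z - S.ctr) / S.q with hw
  obtain ⟨s, hs⟩ := IsAlgClosed.exists_pow_nat_eq (w ^ 2 - 4) (n := 2) (by norm_num)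
  set ζ := (w + s) / 2 with hζ
  have h1 : ζ * (w - ζ) = 1 := by rw [hζ]; linear_combination -hs / 4
  have hne : ζ ≠ 0 := by rintro h; rw [h] at h1; simp at h1
  have hinv : ζ⁻¹ = w - ζ := by field_simp; linear_combination -h1
  have hJ : ∀ ξ : ℂ, ξ + ξ⁻¹ = w → S.J ξ = z := by
    intro ξ h
    unfold J; rw [h, hw]; field_simp; ring
  by_cases h : 1 ≤ ‖ζ‖
  · exact ⟨ζ, h, hJ _ (by rw [hinv]; ring)⟩
  · refine ⟨ζ⁻¹, ?_, hJ _ (by rw [inv_inv, hinv]; ring)⟩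
    rw [norm_inv]
    exact (one_le_inv₀ (norm_pos_iff.2 hne)).2 (le_of_not_ge h)

lemma exists_J' (z : ℂ) : ∃ ζ : ℂ, ‖ζ‖ = S.rho z ∧ S.J ζ = z := by
  obtain ⟨ζ, h, rfl⟩ := S.exists_J z
  exact ⟨ζ, (S.rho_J h).symm, rfl⟩

lemma J_inj {ζ ξ : ℂ} (hζ : 1 < ‖ζ‖) (hξ : 1 ≤ ‖ξ‖) (h : S.J ζ = S.J ξ) : ζ = ξ := by
  have hq : (S.q : ℂ) ≠ 0 := by exact_mod_cast S.q_pos.ne'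
  have h1 : ζ ≠ 0 := norm_pos_iff.1 (by linarith)
  have h2 : ξ ≠ 0 := norm_pos_iff.1 (by linarith)
  unfold J at h
  have h3 : ζ + ζ⁻¹ = ξ + ξ⁻¹ := mul_left_cancel₀ hq (add_left_cancel h)
  have h4 : (ζ - ξ) * (ζ * ξ - 1) = 0 := by
    field_simp at h3
    linear_combination h3
  rcases mul_eq_zero.1 h4 with h5 | h5
  · exact sub_eq_zero.1 h5
  · exfalso
    have : ‖ζ * ξ‖ = 1 := by rw [sub_eq_zero.1 h5]; simp
    rw [norm_mul] at this
    nlinarith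

lemma J_im_sphere {ζ : ℂ} (hζ : ‖ζ‖ = 1) : S.J ζ = S.ctr + ((2 * S.q * ζ.re : ℝ) : ℂ) := by
  have : ζ⁻¹ = (starRingEnd ℂ) ζ := by
    rw [Complex.inv_def, Complex.normSq_eq_norm_sq, hζ]; simp
  unfold J
  rw [this, Complex.add_conj]; push_cast; ring

lemma rho_eq_one_iff (z : ℂ) : S.rho z = 1 ↔ z ∈ S.carrier := by
  have hq := S.q_pos
  have hq4 : S.q = (S.xr - S.xl) / 4 := rfl
  constructor
  · intro h
    obtain ⟨ζ, h1, rfl⟩ := S.exists_J' z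
    rw [h] at h1
    rw [S.J_im_sphere h1]
    have := Complex.abs_re_le_norm ζ
    rw [h1, abs_le] at this
    refine ⟨by simp [ctr_im], ?_⟩
    simp only [add_re, ofReal_re, ctr_re]
    constructor <;> nlinarith
  · rintro ⟨h1, h2, h3⟩
    have key : S.ecc z = 1 := by
      have e1 : z - (S.ctr - 2 * S.q) = ((z.re - S.xl : ℝ) : ℂ) := by
        apply Complex.ext <;> simp [ctr_re, ctr_im, h1, hq4]; ring
      have e2 : z - (S.ctr + 2 * S.q) = ((z.re - S.xr : ℝ) : ℂ) := by
        apply Complex.ext <;> simp [ctr_re, ctr_im, h1, hq4]; ring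
      unfold ecc
      rw [e1, e2, Complex.norm_real, Complex.norm_real, Real.norm_of_nonneg (by linarith),
        Real.norm_of_nonpos (by linarith), hq4, div_eq_one_iff_eq (by linarith)]
      ring
    unfold rho; rw [key]; simp

lemma one_lt_rho_iff (z : ℂ) : 1 < S.rho z ↔ z ∉ S.carrier := by
  rw [← S.rho_eq_one_iff]
  constructor
  · intro h; exact h.ne'
  · intro h; exact lt_of_le_of_ne (S.one_le_rho z) (Ne.symm h)

lemma isCompact_rho_le (R : ℝ) : IsCompact {z | S.rho z ≤ R} := by
  refine Metric.isCompact_of_isClosed_isBounded (isClosed_le S.continuous_rho continuous_const) ?_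
  have hq := S.q_pos
  refine (Metric.isBounded_closedBall (x := S.ctr - 2 * S.q) (r := R * (4 * S.q))).subset ?_
  intro z hz
  have h1 := (S.ecc_le_rho z).trans hz
  unfold ecc at h1
  rw [div_le_iff₀ (by positivity)] at h1
  rw [mem_closedBall, dist_eq_norm]
  linarith [norm_nonneg (z - (S.ctr + 2 * S.q))]

lemma isCompact_carrier : IsCompact S.carrier := by
  have : S.carrier = {z | S.rho z ≤ 1} := by
    ext z
    rw [← S.rho_eq_one_iff]
    exact ⟨fun h => h.le, fun h => le_antisymm h (S.one_le_rho z)⟩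
  rw [this]; exact S.isCompact_rho_le 1

lemma exists_rho_subset {V : Set ℂ} (hV : IsOpen V) (h : S.carrier ⊆ V) :
    ∃ R > 1, {z | S.rho z ≤ R} ⊆ V := by
  have hK : IsCompact ({z | S.rho z ≤ 2} \ V) := (S.isCompact_rho_le 2).diff hV
  rcases ({z | S.rho z ≤ 2} \ V).eq_empty_or_nonempty with he | hne
  · exact ⟨2, by norm_num, sdiff_eq_empty.1 he⟩
  · obtain ⟨z, hz, hmin⟩ := hK.exists_isMinOn hne S.continuous_rho.continuousOn
    have h1 : 1 < S.rho z := (S.one_lt_rho_iff z).2 fun hc => hz.2 (h hc)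
    have h2 : S.rho z ≤ 2 := hz.1
    refine ⟨(1 + S.rho z) / 2, by linarith, fun w hw => ?_⟩
    by_contra hwV
    have hw' : S.rho w ≤ (1 + S.rho z) / 2 := hw
    have : S.rho z ≤ S.rho w := hmin ⟨show S.rho w ≤ 2 by linarith, hwV⟩
    linarith

lemma hasDerivAt_J {ζ : ℂ} (hζ : ζ ≠ 0) : HasDerivAt S.J (S.q * (1 + -(ζ ^ 2)⁻¹)) ζ :=
  (((hasDerivAt_id ζ).add (hasDerivAt_inv hζ)).const_mul _).const_add _

lemma carrier_subset_UHP : S.carrier ⊆ UHP := by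
  rintro z ⟨h, -⟩
  change 0 < z.im
  rw [h]; exact S.hy

end Slit

/-- The open annulus centred at the origin. -/
def Ann (r R : ℝ) : Set ℂ := {ζ : ℂ | r < ‖ζ‖ ∧ ‖ζ‖ < R}

lemma isOpen_Ann (r R : ℝ) : IsOpen (Ann r R) :=
  (isOpen_lt continuous_const continuous_norm).inter (isOpen_lt continuous_norm continuous_const)

/-- The integral of the logarithmic derivative of `G - p` along a circle. -/
def wind (G : ℂ → ℂ) (r : ℝ) (p : ℂ) : ℂ := ∮ ζ in C(0, r), deriv G ζ / (G ζ - p)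

section Wind

variable {G : ℂ → ℂ} {R r : ℝ} {p : ℂ}

lemma mem_Ann_of_sphere {ζ : ℂ} (h1 : 1 < r) (h2 : r < R) (h : ζ ∈ sphere (0 : ℂ) r) :
    ζ ∈ Ann 1 R := by
  rw [mem_sphere_zero_iff_norm] at h
  exact ⟨by rw [h]; exact h1, by rw [h]; exact h2⟩

lemma diffAt_Ann (hG : DifferentiableOn ℂ G (Ann 1 R)) {ζ : ℂ} (hζ : ζ ∈ Ann 1 R) :
    DifferentiableAt ℂ G ζ := hG.differentiableAt ((isOpen_Ann 1 R).mem_nhds hζ)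

lemma wind_integrable (hG : DifferentiableOn ℂ G (Ann 1 R)) (h1 : 1 < r) (h2 : r < R)
    (hp : ∀ ζ ∈ sphere (0 : ℂ) r, G ζ ≠ p) :
    CircleIntegrable (fun ζ => deriv G ζ / (G ζ - p)) 0 r := by
  refine ContinuousOn.circleIntegrable (by linarith) ?_
  refine ContinuousOn.div ?_ ?_ fun ζ hζ => sub_ne_zero.2 (hp ζ hζ)
  · exact (hG.deriv (isOpen_Ann 1 R)).continuousOn.mono fun ζ hζ => mem_Ann_of_sphere h1 h2 hζ
  · exact (hG.continuousOn.mono fun ζ hζ => mem_Ann_of_sphere h1 h2 hζ).sub continuousOn_const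

lemma wind_eq_of_leash {G₁ G₂ : ℂ → ℂ} {p₁ p₂ : ℂ}
    (hG₁ : DifferentiableOn ℂ G₁ (Ann 1 R)) (hG₂ : DifferentiableOn ℂ G₂ (Ann 1 R))
    (h1 : 1 < r) (h2 : r < R)
    (h : ∀ ζ ∈ sphere (0 : ℂ) r, ‖(G₂ ζ - p₂) - (G₁ ζ - p₁)‖ < ‖G₁ ζ - p₁‖) :
    wind G₂ r p₂ = wind G₁ r p₁ := by
  have hn1 : ∀ ζ ∈ sphere (0 : ℂ) r, G₁ ζ - p₁ ≠ 0 := fun ζ hζ h0 => by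
    have := h ζ hζ; rw [h0, norm_zero] at this; exact absurd this (norm_nonneg _).not_gt
  have hn2 : ∀ ζ ∈ sphere (0 : ℂ) r, G₂ ζ - p₂ ≠ 0 := fun ζ hζ h0 => by
    have := h ζ hζ; rw [h0, zero_sub, norm_neg] at this; exact lt_irrefl _ this
  rw [← sub_eq_zero]
  unfold wind
  rw [← circleIntegral.integral_sub
    (wind_integrable hG₂ h1 h2 fun ζ hζ => sub_ne_zero.1 (hn2 ζ hζ))
    (wind_integrable hG₁ h1 h2 fun ζ hζ => sub_ne_zero.1 (hn1 ζ hζ))]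
  refine circleIntegral.integral_eq_zero_of_hasDerivWithinAt
    (f := fun ζ => Complex.log ((G₂ ζ - p₂) / (G₁ ζ - p₁))) (by linarith) fun ζ hζ => ?_
  have d1 := (diffAt_Ann hG₁ (mem_Ann_of_sphere h1 h2 hζ)).hasDerivAt
  have d2 := (diffAt_Ann hG₂ (mem_Ann_of_sphere h1 h2 hζ)).hasDerivAt
  have hs : (G₂ ζ - p₂) / (G₁ ζ - p₁) ∈ slitPlane := by
    have h3 : ‖(G₂ ζ - p₂) / (G₁ ζ - p₁) - 1‖ < 1 := by
      rw [div_sub_one (hn1 ζ hζ), norm_div, div_lt_one (norm_pos_iff.2 (hn1 ζ hζ))]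
      exact h ζ hζ
    have h4 := (Complex.abs_re_le_norm _).trans_lt h3
    rw [abs_lt] at h4
    left
    simp only [sub_re, one_re] at h4
    linarith [h4.1]
  have := ((d2.sub_const p₂).div (d1.sub_const p₁) (hn1 ζ hζ)).clog hs
  refine (this.congr_deriv ?_).hasDerivWithinAt
  have e1 := hn1 ζ hζ
  have e2 := hn2 ζ hζ
  rw [Pi.div_apply]
  field_simp

lemma wind_zero_of_half_plane (hG : DifferentiableOn ℂ G (Ann 1 R)) (h1 : 1 < r) (h2 : r < R)
    (u : ℂ) (h : ∀ ζ ∈ sphere (0 : ℂ) r, 0 < (u * (G ζ - p)).re) : wind G r p = 0 := by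
  refine circleIntegral.integral_eq_zero_of_hasDerivWithinAt
    (f := fun ζ => Complex.log (u * (G ζ - p))) (by linarith) fun ζ hζ => ?_
  have d1 := (diffAt_Ann hG (mem_Ann_of_sphere h1 h2 hζ)).hasDerivAt
  have := ((d1.sub_const p).const_mul u).clog (Or.inl (h ζ hζ))
  refine (this.congr_deriv ?_).hasDerivWithinAt
  have hu : u ≠ 0 := by rintro rfl; have := h ζ hζ; simp at this
  have hg : G ζ - p ≠ 0 := by intro h0; have := h ζ hζ; simp [h0] at this
  field_simp

lemma wind_zero_of_norm_lt (hG : DifferentiableOn ℂ G (Ann 1 R)) (h1 : 1 < r) (h2 : r < R)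
    (h : ∀ ζ ∈ sphere (0 : ℂ) r, ‖G ζ‖ < ‖p‖) : wind G r p = 0 := by
  refine wind_zero_of_half_plane hG h1 h2 (-(starRingEnd ℂ) p) fun ζ hζ => ?_
  have h3 := h ζ hζ
  have h4 : (-(starRingEnd ℂ) p * (G ζ - p)).re = ‖p‖ ^ 2 - ((starRingEnd ℂ) p * G ζ).re := by
    have : -(starRingEnd ℂ) p * (G ζ - p)
        = ((starRingEnd ℂ) p * p) - (starRingEnd ℂ) p * G ζ := by ring
    rw [this, sub_re, Complex.conj_mul', ← ofReal_pow, ofReal_re]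
  rw [h4]
  have h5 := Complex.re_le_norm ((starRingEnd ℂ) p * G ζ)
  rw [norm_mul, Complex.norm_conj] at h5
  have h6 := norm_nonneg (G ζ)
  nlinarith

lemma wind_zero_of_simplyConnected (hG : DifferentiableOn ℂ G (Ann 1 R)) (h1 : 1 < r)
    (h2 : r < R) {U : Set ℂ} (hU : IsSimplyConnected U) (hUo : IsOpen U) (hp : p ∉ U)
    (h : ∀ ζ ∈ sphere (0 : ℂ) r, G ζ ∈ U) : wind G r p = 0 := by
  obtain ⟨l, hl, hle⟩ := Complex.exists_continuousOn_eqOn_exp_comp hU hUo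
    (g := fun w => w - p) (by fun_prop) (by
      rintro ⟨w, hw, h0⟩
      exact hp (by rwa [sub_eq_zero.1 h0] at hw))
  have hd : ∀ w ∈ U, HasDerivAt l (w - p)⁻¹ w := by
    intro w hw
    have e : Complex.exp (l w) = w - p := hle hw
    have := HasDerivAt.of_local_left_inverse (f := fun z => Complex.exp z + p) (g := l) (a := w)
      (f' := Complex.exp (l w)) (hl.continuousAt (hUo.mem_nhds hw))
      ((Complex.hasDerivAt_exp (l w)).add_const p) (Complex.exp_ne_zero _) (by
        filter_upwards [hUo.mem_nhds hw] with v hv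
        have e : Complex.exp (l v) = v - p := hle hv
        simp [e])
    rwa [e] at this
  refine circleIntegral.integral_eq_zero_of_hasDerivWithinAt
    (f := fun ζ => l (G ζ)) (by linarith) fun ζ hζ => ?_
  have d1 := (diffAt_Ann hG (mem_Ann_of_sphere h1 h2 hζ)).hasDerivAt
  have := (hd _ (h ζ hζ)).comp ζ d1
  refine (this.congr_deriv ?_).hasDerivWithinAt
  rw [div_eq_mul_inv, mul_comm]

lemma circleIntegral_eq_of_Ann {g : ℂ → ℂ} {r₁ r₂ : ℝ} (h0 : 0 < r₁) (h1 : r₁ ≤ r₂)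
    (hg : ∀ ζ : ℂ, r₁ ≤ ‖ζ‖ → ‖ζ‖ ≤ r₂ → DifferentiableAt ℂ g ζ) :
    (∮ ζ in C(0, r₂), g ζ) = ∮ ζ in C(0, r₁), g ζ := by
  have := Complex.circleIntegral_sub_center_inv_smul_eq_of_differentiable_on_annulus_off_countable
    (c := 0) (f := fun ζ => ζ * g ζ) h0 h1 countable_empty (by
      intro ζ hζ
      simp only [Set.mem_sdiff, mem_closedBall_zero_iff, mem_ball_zero_iff, not_lt] at hζ
      exact (continuousAt_id.mul (hg ζ hζ.2 hζ.1).continuousAt).continuousWithinAt) (by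
      intro ζ hζ
      simp only [Set.mem_sdiff, mem_closedBall_zero_iff, mem_ball_zero_iff, not_le] at hζ
      exact differentiableAt_id.mul (hg ζ hζ.1.2.le hζ.1.1.le))
  have e : ∀ s : ℝ, 0 < s → (∮ ζ in C(0, s), g ζ) = ∮ ζ in C(0, s), (ζ - 0)⁻¹ • (ζ * g ζ) := by
    intro s hs
    refine circleIntegral.integral_congr hs.le fun ζ hζ => ?_
    have : ζ ≠ 0 := by rintro rfl; simp at hζ; linarith
    simp only [sub_zero, smul_eq_mul]
    field_simp
  rw [e _ h0, e _ (h0.trans_le h1)]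
  exact this

lemma wind_eq_of_radius (hG : DifferentiableOn ℂ G (Ann 1 R)) {r₁ r₂ : ℝ} (h1 : 1 < r₁)
    (h12 : r₁ ≤ r₂) (h2 : r₂ < R) (hp : ∀ ζ : ℂ, r₁ ≤ ‖ζ‖ → ‖ζ‖ ≤ r₂ → G ζ ≠ p) :
    wind G r₂ p = wind G r₁ p := by
  refine circleIntegral_eq_of_Ann (by linarith) h12 fun ζ ha hb => ?_
  have hζ : ζ ∈ Ann 1 R := ⟨by linarith, by linarith⟩
  exact (((hG.deriv (isOpen_Ann 1 R)).differentiableAt ((isOpen_Ann 1 R).mem_nhds hζ))).div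
    ((diffAt_Ann hG hζ).sub_const _) (sub_ne_zero.2 (hp ζ ha hb))

lemma wind_locally_const (hG : DifferentiableOn ℂ G (Ann 1 R)) (h1 : 1 < r) (h2 : r < R)
    (hp : ∀ ζ ∈ sphere (0 : ℂ) r, G ζ ≠ p) :
    ∀ᶠ p' in 𝓝 p, (∀ ζ ∈ sphere (0 : ℂ) r, G ζ ≠ p') ∧ wind G r p' = wind G r p := by
  have hK : IsCompact (G '' sphere (0 : ℂ) r) :=
    (isCompact_sphere 0 r).image_of_continuousOn
      (hG.continuousOn.mono fun ζ hζ => mem_Ann_of_sphere h1 h2 hζ)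
  have : p ∈ (G '' sphere (0 : ℂ) r)ᶜ := by rintro ⟨ζ, hζ, h⟩; exact hp ζ hζ h
  obtain ⟨ε, hε, hb⟩ := Metric.isOpen_iff.1 hK.isClosed.isOpen_compl p this
  filter_upwards [ball_mem_nhds p hε] with p' hp'
  refine ⟨fun ζ hζ h => hb hp' ⟨ζ, hζ, h⟩, ?_⟩
  refine wind_eq_of_leash hG hG h1 h2 fun ζ hζ => ?_
  have h3 : ε ≤ ‖G ζ - p‖ := by
    by_contra hlt
    exact hb (show G ζ ∈ ball p ε by rw [mem_ball, dist_eq_norm]; linarith) ⟨ζ, hζ, rfl⟩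
  have : G ζ - p' - (G ζ - p) = -(p' - p) := by ring
  rw [this, norm_neg, ← dist_eq_norm]
  exact (mem_ball.1 hp').trans_le h3

lemma wind_jump_of_deriv_ne (hG : DifferentiableOn ℂ G (Ann 1 R)) (hi : InjOn G (Ann 1 R))
    {r₁ r₂ : ℝ} (h1 : 1 < r₁) (h2 : r₂ < R) {ζ₀ : ℂ} (ha : r₁ < ‖ζ₀‖) (hb : ‖ζ₀‖ < r₂)
    (hd : deriv G ζ₀ ≠ 0) : wind G r₂ (G ζ₀) = wind G r₁ (G ζ₀) + 2 * Real.pi * I := by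
  set H := dslope G ζ₀ with hH
  have hm0 : ζ₀ ∈ Ann 1 R := ⟨by linarith, by linarith⟩
  have hHd : DifferentiableOn ℂ H (Ann 1 R) :=
    (Complex.differentiableOn_dslope ((isOpen_Ann 1 R).mem_nhds hm0)).2 hG
  have hH0 : ∀ ζ ∈ Ann 1 R, H ζ ≠ 0 := by
    intro ζ hζ
    by_cases he : ζ = ζ₀
    · rw [he, hH, dslope_same]; exact hd
    · rw [hH, dslope_of_ne _ he, slope_def_field]
      exact div_ne_zero (sub_ne_zero.2 fun h => he (hi hζ hm0 h)) (sub_ne_zero.2 he)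
  have hGH : ∀ ζ, G ζ - G ζ₀ = (ζ - ζ₀) * H ζ := fun ζ => by
    have := sub_smul_dslope G ζ₀ ζ
    rw [smul_eq_mul] at this
    exact this.symm
  have hdG : ∀ ζ ∈ Ann 1 R, deriv G ζ = H ζ + (ζ - ζ₀) * deriv H ζ := by
    intro ζ hζ
    have e : G = fun ζ => G ζ₀ + (ζ - ζ₀) * H ζ := by
      funext ζ; rw [← hGH]; ring
    have := (((hasDerivAt_id ζ).sub_const ζ₀).mul (diffAt_Ann hHd hζ).hasDerivAt).const_add (G ζ₀)
    have h3 : HasDerivAt G (1 * H ζ + (id ζ - ζ₀) * deriv H ζ) ζ := by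
      conv => enter [1]; rw [e]
      exact this
    rw [h3.deriv]; simp
  have hQ : ∀ ζ ∈ Ann 1 R, DifferentiableAt ℂ (fun ζ => deriv H ζ / H ζ) ζ := fun ζ hζ =>
    ((hHd.deriv (isOpen_Ann 1 R)).differentiableAt ((isOpen_Ann 1 R).mem_nhds hζ)).div
      (diffAt_Ann hHd hζ) (hH0 ζ hζ)
  have key : ∀ r, 1 < r → r < R → r ≠ ‖ζ₀‖ → wind G r (G ζ₀) =
      (∮ ζ in C(0, r), (ζ - ζ₀)⁻¹) + ∮ ζ in C(0, r), deriv H ζ / H ζ := by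
    intro r ha hb hne
    have hne' : ∀ ζ ∈ sphere (0 : ℂ) r, ζ - ζ₀ ≠ 0 := by
      intro ζ hζ h
      rw [mem_sphere_zero_iff_norm] at hζ
      exact hne (by rw [← sub_eq_zero.1 h, hζ])
    rw [← circleIntegral.integral_add]
    · refine circleIntegral.integral_congr (by linarith) fun ζ hζ => ?_
      have h3 := hH0 ζ (mem_Ann_of_sphere ha hb hζ)
      have h4 := hne' ζ hζ
      simp only [hGH, hdG ζ (mem_Ann_of_sphere ha hb hζ)]
      field_simp
    · refine ContinuousOn.circleIntegrable (by linarith) ?_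
      exact ContinuousOn.inv₀ (by fun_prop) hne'
    · refine ContinuousOn.circleIntegrable (by linarith) fun ζ hζ => ?_
      exact (hQ ζ (mem_Ann_of_sphere ha hb hζ)).continuousAt.continuousWithinAt
  rw [key r₂ (by linarith) h2 hb.ne', key r₁ h1 (by linarith) ha.ne,
    circleIntegral_eq_of_Ann (g := fun ζ => deriv H ζ / H ζ) (r₁ := r₁) (r₂ := r₂) (by linarith)
      (by linarith) fun ζ hx hy => hQ ζ ⟨by linarith, by linarith⟩,
    circleIntegral.integral_sub_inv_of_mem_ball (by simpa using hb)]
  have hz : (∮ ζ in C(0, r₁), (ζ - ζ₀)⁻¹) = 0 := by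
    refine Complex.circleIntegral_eq_zero_of_differentiable_on_off_countable (by linarith)
      countable_empty ?_ ?_
    · refine ContinuousOn.inv₀ (by fun_prop) fun ζ hζ h => ?_
      rw [mem_closedBall_zero_iff, sub_eq_zero.1 h] at hζ
      linarith
    · intro ζ hζ
      have h3 := hζ.1
      rw [mem_ball_zero_iff] at h3
      refine (differentiableAt_id.sub_const _).inv fun h => ?_
      have h4 : ζ = ζ₀ := sub_eq_zero.1 h
      rw [h4] at h3; linarith
  rw [hz]; ring

lemma wind_jump (hG : DifferentiableOn ℂ G (Ann 1 R)) (hi : InjOn G (Ann 1 R))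
    {r₁ r₂ : ℝ} (h1 : 1 < r₁) (h2 : r₂ < R) {ζ₀ : ℂ} (ha : r₁ < ‖ζ₀‖) (hb : ‖ζ₀‖ < r₂) :
    wind G r₂ (G ζ₀) = wind G r₁ (G ζ₀) + 2 * Real.pi * I := by
  have hm0 : ζ₀ ∈ Ann 1 R := ⟨by linarith, by linarith⟩
  have ne : ∀ r, 1 < r → r < R → r ≠ ‖ζ₀‖ → ∀ ζ ∈ sphere (0 : ℂ) r, G ζ ≠ G ζ₀ := by
    intro r ha hb hne ζ hζ h
    have := hi (mem_Ann_of_sphere ha hb hζ) hm0 h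
    rw [mem_sphere_zero_iff_norm, this] at hζ
    exact hne hζ.symm
  have hc : ContinuousAt G ζ₀ := (diffAt_Ann hG hm0).continuousAt
  have e1 := hc.eventually (wind_locally_const hG (by linarith) h2 (ne r₂ (by linarith) h2 hb.ne'))
  have e2 := hc.eventually (wind_locally_const hG h1 (by linarith) (ne r₁ h1 (by linarith) ha.ne))
  have e3 : ∀ᶠ ζ in 𝓝 ζ₀, ζ ∈ Ann r₁ r₂ := (isOpen_Ann _ _).mem_nhds ⟨ha, hb⟩
  have hfr : ∃ᶠ ζ in 𝓝 ζ₀, deriv G ζ ≠ 0 := by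
    intro hcon
    have hcon' : ∀ᶠ ζ in 𝓝 ζ₀, deriv G ζ = 0 := by simpa using hcon
    obtain ⟨ε, hε, hb⟩ := Metric.eventually_nhds_iff_ball.1
      (hcon'.and ((isOpen_Ann 1 R).mem_nhds hm0))
    have hx : ζ₀ + (ε / 2 : ℝ) ∈ ball ζ₀ ε := by
      rw [mem_ball, dist_eq_norm, add_sub_cancel_left, Complex.norm_real,
        Real.norm_of_nonneg (by positivity)]
      linarith
    have := (convex_ball ζ₀ ε).is_const_of_fderivWithin_eq_zero (𝕜 := ℂ) (f := G)
      (fun z hz => (diffAt_Ann hG (hb z hz).2).differentiableWithinAt) (fun z hz => by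
        rw [fderivWithin_of_isOpen isOpen_ball hz]
        ext; simp [(hb z hz).1]) (mem_ball_self hε) hx
    have h4 := hi hm0 (hb _ hx).2 this
    have : ((ε / 2 : ℝ) : ℂ) = 0 := by linear_combination -h4
    rw [ofReal_eq_zero] at this
    linarith
  obtain ⟨ζ, hd, ⟨-, w1⟩, ⟨-, w2⟩, ha', hb'⟩ := (hfr.and_eventually (e1.and (e2.and e3))).exists
  rw [← w1, ← w2]
  exact wind_jump_of_deriv_ne hG hi h1 h2 ha' hb' hd

end Wind

/-- The filter of approach to the unit circle from outside. -/
def Lf : Filter ℂ := comap norm (𝓝[>] (1 : ℝ))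

lemma eventually_Lf {P : ℂ → Prop} :
    (∀ᶠ ζ in Lf, P ζ) ↔ ∃ r > (1 : ℝ), ∀ ζ : ℂ, 1 < ‖ζ‖ → ‖ζ‖ < r → P ζ := by
  unfold Lf
  have hb := (nhdsGT_basis (1 : ℝ)).comap (norm : ℂ → ℝ)
  rw [hb.eventually_iff]
  constructor
  · rintro ⟨r, hr, h⟩
    exact ⟨r, hr, fun ζ h1 h2 => h ⟨h1, h2⟩⟩
  · rintro ⟨r, hr, h⟩
    exact ⟨r, hr, fun ζ hζ => h ζ hζ.1 hζ.2⟩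

lemma Ann_mem_Lf {R : ℝ} (hR : 1 < R) : Ann 1 R ∈ Lf :=
  eventually_Lf.2 ⟨R, hR, fun _ h1 h2 => ⟨h1, h2⟩⟩

instance : NeBot Lf := by
  rw [neBot_iff]
  intro h
  have : ∀ᶠ ζ in Lf, False := by rw [h]; exact eventually_bot
  obtain ⟨r, hr, h⟩ := eventually_Lf.1 this
  have e : ‖(((1 + r) / 2 : ℝ) : ℂ)‖ = (1 + r) / 2 := by
    rw [Complex.norm_real, Real.norm_of_nonneg (by linarith)]
  exact h (((1 + r) / 2 : ℝ) : ℂ) (by rw [e]; linarith) (by rw [e]; linarith)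

lemma max_Ann {F : ℂ → ℂ} {R r₁ r₀ C : ℝ} (hF : DifferentiableOn ℂ F (Ann 1 R)) (h1 : 1 < r₁)
    (h2 : r₀ < R) (ha : ∀ ζ : ℂ, ‖ζ‖ = r₁ → ‖F ζ‖ ≤ C) (hb : ∀ ζ : ℂ, ‖ζ‖ = r₀ → ‖F ζ‖ ≤ C)
    {ζ : ℂ} (h3 : r₁ ≤ ‖ζ‖) (h4 : ‖ζ‖ ≤ r₀) : ‖F ζ‖ ≤ C := by
  rcases h3.eq_or_lt with h3 | h3
  · exact ha ζ h3.symm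
  rcases h4.eq_or_lt with h4 | h4
  · exact hb ζ h4
  have hcl : closure (Ann r₁ r₀) ⊆ {ζ : ℂ | r₁ ≤ ‖ζ‖ ∧ ‖ζ‖ ≤ r₀} :=
    closure_minimal (fun ζ h => ⟨h.1.le, h.2.le⟩)
      ((isClosed_le continuous_const continuous_norm).inter
        (isClosed_le continuous_norm continuous_const))
  refine Complex.norm_le_of_forall_mem_frontier_norm_le (U := Ann r₁ r₀) ?_ ?_ ?_
    (subset_closure ⟨h3, h4⟩)
  · exact isBounded_closedBall.subset fun ζ h => mem_closedBall_zero_iff.2 h.2.le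
  · refine DifferentiableOn.diffContOnCl (hF.mono fun ζ hζ => ?_)
    have := hcl hζ
    exact ⟨h1.trans_le this.1, this.2.trans_lt h2⟩
  · intro ξ hξ
    have h5 := hcl hξ.1
    have h6 : ξ ∉ Ann r₁ r₀ := by
      have := hξ.2
      rwa [(isOpen_Ann r₁ r₀).interior_eq] at this
    rcases h5.1.eq_or_lt with h | h
    · exact ha ξ h.symm
    · rcases h5.2.eq_or_lt with h' | h'
      · exact hb ξ h'
      · exact absurd ⟨h, h'⟩ h6

section Annulus

variable {G : ℂ → ℂ} {R : ℝ} {y : ℝ}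

lemma continuous_circle (hG : DifferentiableOn ℂ G (Ann 1 R)) {r : ℝ} (h1 : 1 < r) (h2 : r < R) :
    Continuous fun θ : ℝ => G (circleMap 0 r θ) := by
  refine continuous_iff_continuousAt.2 fun θ => ?_
  have : circleMap 0 r θ ∈ Ann 1 R :=
    mem_Ann_of_sphere h1 h2 (circleMap_mem_sphere 0 (by linarith) θ)
  exact ContinuousAt.comp (f := fun θ : ℝ => circleMap 0 r θ) (diffAt_Ann hG this).continuousAt
    (continuous_circleMap 0 r).continuousAt

lemma mean_im (hG : DifferentiableOn ℂ G (Ann 1 R)) (hy : Tendsto (fun ζ => (G ζ).im) Lf (𝓝 y))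
    {r : ℝ} (h1 : 1 < r) (h2 : r < R) :
    ∫ θ in (0 : ℝ)..2 * Real.pi, (G (circleMap 0 r θ)).im = 2 * Real.pi * y := by
  have e : ∀ s, 1 < s → s < R → (∮ ζ in C(0, s), ζ⁻¹ * G ζ) =
      I * ∫ θ in (0 : ℝ)..2 * Real.pi, G (circleMap 0 s θ) := by
    intro s hs _
    rw [circleIntegral, ← intervalIntegral.integral_const_mul]
    congr 1
    funext θ
    have : circleMap 0 s θ ≠ 0 := circleMap_ne_center (by linarith)
    simp only [deriv_circleMap, smul_eq_mul]
    field_simp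
  have key : ∀ s, 1 < s → s ≤ r → ∫ θ in (0 : ℝ)..2 * Real.pi, (G (circleMap 0 s θ)).im =
      ∫ θ in (0 : ℝ)..2 * Real.pi, (G (circleMap 0 r θ)).im := by
    intro s hs hsr
    have h3 := circleIntegral_eq_of_Ann (g := fun ζ => ζ⁻¹ * G ζ) (r₁ := s) (r₂ := r)
      (by linarith) hsr fun ζ ha hb =>
        (differentiableAt_inv (norm_pos_iff.1 (by linarith))).mul
          (diffAt_Ann hG ⟨by linarith, by linarith⟩)
    rw [e r h1 h2, e s hs (by linarith)] at h3
    have h4 := mul_left_cancel₀ I_ne_zero h3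
    have im_int : ∀ t, 1 < t → t < R → ∫ θ in (0 : ℝ)..2 * Real.pi, (G (circleMap 0 t θ)).im =
        (∫ θ in (0 : ℝ)..2 * Real.pi, G (circleMap 0 t θ)).im := fun t ht ht' =>
      Complex.imCLM.intervalIntegral_comp_comm
        ((continuous_circle hG ht ht').intervalIntegrable 0 (2 * Real.pi))
    rw [im_int s hs (by linarith), im_int r h1 h2, h4]
  refine eq_of_forall_dist_le fun ε hε => ?_
  obtain ⟨s, hs, hb⟩ := eventually_Lf.1
    (Metric.tendsto_nhds.1 hy (ε / (2 * Real.pi)) (by positivity))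
  set t := min ((1 + s) / 2) r with ht
  have t1 : 1 < t := lt_min (by linarith) h1
  have t2 : t < s := (min_le_left _ _).trans_lt (by linarith)
  rw [← key t t1 (min_le_right _ _)]
  have h5 := intervalIntegral.norm_integral_le_of_norm_le_const (a := 0) (b := 2 * Real.pi)
    (f := fun θ => (G (circleMap 0 t θ)).im - y) (C := ε / (2 * Real.pi)) fun θ _ => by
      have h6 : ‖circleMap 0 t θ‖ = t := by
        simpa using (abs_of_pos (show 0 < t by linarith))
      have := hb (circleMap 0 t θ) (by rw [h6]; exact t1) (by rw [h6]; exact t2)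
      rw [Real.dist_eq] at this
      exact this.le
  have hci : IntervalIntegrable (fun θ => (G (circleMap 0 t θ)).im) volume 0 (2 * Real.pi) :=
    (Complex.continuous_im.comp (continuous_circle hG t1 ((min_le_right _ _).trans_lt
      h2))).intervalIntegrable 0 (2 * Real.pi)
  rw [intervalIntegral.integral_sub hci (by simp), intervalIntegral.integral_const] at h5
  have hpi := Real.pi_pos
  rw [sub_zero, smul_eq_mul, abs_of_pos (by positivity), div_mul_cancel₀ _ (by positivity)] at h5
  rw [Real.dist_eq]
  exact h5

lemma im_eq_of_le (hG : DifferentiableOn ℂ G (Ann 1 R))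
    (hy : Tendsto (fun ζ => (G ζ).im) Lf (𝓝 y)) (hle : ∀ ζ ∈ Ann 1 R, y ≤ (G ζ).im)
    {ζ : ℂ} (hζ : ζ ∈ Ann 1 R) : (G ζ).im = y := by
  have hm := mean_im hG hy hζ.1 hζ.2
  by_contra hne
  have hr : (0 : ℝ) ≤ ‖ζ‖ := norm_nonneg _
  have : ζ ∈ circleMap 0 ‖ζ‖ '' Ioc 0 (2 * Real.pi) := by
    rw [image_circleMap_Ioc]; simp
  obtain ⟨θ, hθ, he⟩ := this
  have hc : Continuous fun θ : ℝ => (G (circleMap 0 ‖ζ‖ θ)).im :=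
    Complex.continuous_im.comp (continuous_circle hG hζ.1 hζ.2)
  have hsub : ∫ θ in (0 : ℝ)..2 * Real.pi, ((G (circleMap 0 ‖ζ‖ θ)).im - y) = 0 := by
    rw [intervalIntegral.integral_sub (hc.intervalIntegrable _ _) (by simp), hm]
    simp
  have hpi := Real.pi_pos
  have hmem : ∀ θ, circleMap 0 ‖ζ‖ θ ∈ Ann 1 R := fun θ =>
    mem_Ann_of_sphere hζ.1 hζ.2 (circleMap_mem_sphere 0 hr θ)
  have := intervalIntegral.integral_pos (f := fun θ => (G (circleMap 0 ‖ζ‖ θ)).im - y)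
    (a := 0) (b := 2 * Real.pi) (by positivity) (by
      exact (hc.sub continuous_const).continuousOn)
    (fun θ _ => sub_nonneg.2 (hle _ (hmem θ)))
    ⟨θ, ⟨hθ.1.le, hθ.2⟩, by
      rw [he]
      exact sub_pos.2 (lt_of_le_of_ne (hle _ hζ) (Ne.symm hne))⟩
  exact this.ne' hsub

lemma abs_limit_le (hG : DifferentiableOn ℂ G (Ann 1 R))
    (hy : Tendsto (fun ζ => (G ζ).im) Lf (𝓝 y)) {r M : ℝ} (h1 : 1 < r) (h2 : r < R)
    (hM : ∀ ζ : ℂ, ‖ζ‖ = r → |(G ζ).im| ≤ M) : |y| ≤ M := by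
  have hm := mean_im hG hy h1 h2
  have h5 := intervalIntegral.norm_integral_le_of_norm_le_const (a := 0) (b := 2 * Real.pi)
    (f := fun θ => (G (circleMap 0 r θ)).im) (C := M) fun θ _ =>
      hM _ (by simpa using abs_of_pos (show 0 < r by linarith))
  have hpi := Real.pi_pos
  rw [hm, sub_zero, Real.norm_eq_abs, abs_mul, abs_of_pos (by positivity : 0 < 2 * Real.pi),
    mul_comm M] at h5
  exact le_of_mul_le_mul_left h5 (by positivity)

lemma im_sub_le_log (hG : DifferentiableOn ℂ G (Ann 1 R))
    (hy : Tendsto (fun ζ => (G ζ).im) Lf (𝓝 y)) {r₀ M : ℝ} (h1 : 1 < r₀) (h2 : r₀ < R)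
    (hM0 : 0 < M) (hM : ∀ ζ : ℂ, ‖ζ‖ = r₀ → (G ζ).im - y ≤ M) {ζ : ℂ} (h3 : 1 < ‖ζ‖)
    (h4 : ‖ζ‖ ≤ r₀) : (G ζ).im - y ≤ M * Real.log ‖ζ‖ / Real.log r₀ := by
  have hl : 0 < Real.log r₀ := Real.log_pos h1
  set κ := Real.log r₀ / M with hκ
  have hκ0 : 0 < κ := by positivity
  set F : ℂ → ℂ := fun ζ => Complex.exp (-I * κ * (G ζ - I * y)) * ζ⁻¹ with hF
  have hFd : DifferentiableOn ℂ F (Ann 1 R) := by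
    intro ξ hξ
    have : ξ ≠ 0 := norm_pos_iff.1 (by linarith [hξ.1])
    exact ((((hG ξ hξ).sub_const _).const_mul _).cexp).mul
      (differentiableAt_inv this).differentiableWithinAt
  have hFn : ∀ ξ, ‖F ξ‖ = Real.exp (κ * ((G ξ).im - y)) / ‖ξ‖ := by
    intro ξ
    rw [hF]
    simp only
    rw [norm_mul, Complex.norm_exp, norm_inv, div_eq_mul_inv]
    congr 2
    simp
  have hb : ∀ ξ : ℂ, ‖ξ‖ = r₀ → ‖F ξ‖ ≤ 1 := by
    intro ξ hξ
    rw [hFn, hξ, div_le_one (by linarith)]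
    calc Real.exp (κ * ((G ξ).im - y)) ≤ Real.exp (κ * M) := by
          gcongr; exact hM ξ hξ
      _ = r₀ := by rw [hκ, div_mul_cancel₀ _ hM0.ne', Real.exp_log (by linarith)]
  have hall : ∀ ε > (0 : ℝ), ‖F ζ‖ ≤ 1 + ε := by
    intro ε hε
    have ht : Tendsto (fun ξ => Real.exp (κ * ((G ξ).im - y))) Lf (𝓝 1) := by
      have h := ((hy.sub_const y).const_mul κ).rexp
      simpa using h
    obtain ⟨s, hs, hsb⟩ := eventually_Lf.1 (ht.eventually (gt_mem_nhds (show (1:ℝ) < 1 + ε by linarith)))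
    set t := min ((1 + s) / 2) ‖ζ‖ with ht
    have t1 : 1 < t := lt_min (by linarith) h3
    have t2 : t < s := (min_le_left _ _).trans_lt (by linarith)
    refine max_Ann hFd t1 h2 (fun ξ hξ => ?_) (fun ξ hξ => (hb ξ hξ).trans (by linarith))
      (min_le_right _ _) h4
    rw [hFn]
    exact (div_le_self (Real.exp_pos _).le (by rw [hξ]; exact t1.le)).trans
      (hsb ξ (by rw [hξ]; exact t1) (by rw [hξ]; exact t2)).le
  have h5 : ‖F ζ‖ ≤ 1 := le_of_forall_pos_le_add hall
  rw [hFn, div_le_one (by linarith)] at h5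
  have h6 : κ * ((G ζ).im - y) ≤ Real.log ‖ζ‖ := (Real.le_log_iff_exp_le (by linarith)).2 h5
  rw [hκ, div_mul_eq_mul_div, div_le_iff₀ hM0] at h6
  rw [le_div_iff₀ hl]
  linarith

lemma abs_im_sub_le_log (hG : DifferentiableOn ℂ G (Ann 1 R))
    (hy : Tendsto (fun ζ => (G ζ).im) Lf (𝓝 y)) {r₀ M : ℝ} (h1 : 1 < r₀) (h2 : r₀ < R)
    (hM0 : 0 < M) (hM : ∀ ζ : ℂ, ‖ζ‖ = r₀ → |(G ζ).im - y| ≤ M) {ζ : ℂ} (h3 : 1 < ‖ζ‖)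
    (h4 : ‖ζ‖ ≤ r₀) : |(G ζ).im - y| ≤ M * Real.log ‖ζ‖ / Real.log r₀ := by
  rw [abs_le]
  constructor
  · have := im_sub_le_log (G := fun ζ => -G ζ) (y := -y) hG.neg (by simpa using hy.neg) h1 h2 hM0
      (fun ζ hζ => by
        have := (abs_le.1 (hM ζ hζ)).1
        simp only [neg_im]; linarith) h3 h4
    simp only [neg_im] at this
    linarith
  · exact im_sub_le_log hG hy h1 h2 hM0 (fun ζ hζ => (abs_le.1 (hM ζ hζ)).2) h3 h4

lemma norm_deriv_le_of_im {h : ℂ → ℂ} {ζ : ℂ} {d B : ℝ} (hd : 0 < d) (hB : 0 < B)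
    (hh : DifferentiableOn ℂ h (ball ζ d)) (hb : ∀ ξ ∈ ball ζ d, (h ξ).im - (h ζ).im ≤ B) :
    ‖deriv h ζ‖ ≤ 4 * B / d := by
  have hsh : ∀ ξ ∈ sphere ζ (d / 2), ‖h ξ - h ζ‖ ≤ 2 * B := by
    intro ξ hξ
    have hk := Complex.borelCaratheodory_zero (f := fun u => -I * (h (u + ζ) - h ζ)) (R := d)
      (M := B) (z := ξ - ζ) hB (by
        refine ((hh.comp (by fun_prop) ?_).sub_const _).const_mul _
        intro u hu
        rw [mem_ball_zero_iff] at hu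
        simpa using hu) (by
        intro u hu
        have := hb (u + ζ) (by rw [mem_ball_zero_iff] at hu; simpa using hu)
        simpa using this) hd (by
        rw [mem_sphere, dist_eq_norm] at hξ
        rw [mem_ball_zero_iff, hξ]; linarith) (by simp)
    simp only [sub_add_cancel, norm_mul, norm_neg, norm_I, one_mul] at hk
    rw [mem_sphere, dist_eq_norm] at hξ
    rw [hξ] at hk
    refine hk.trans (le_of_eq ?_)
    have : d - d / 2 ≠ 0 := by intro h; linarith
    field_simp
    ring
  have hcl : closedBall ζ (d / 2) ⊆ ball ζ d := closedBall_subset_ball (by linarith)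
  have := Complex.norm_deriv_le_of_forall_mem_sphere_norm_le (f := fun ξ => h ξ - h ζ) (c := ζ)
    (R := d / 2) (by linarith) ((hh.sub_const _).mono
      (closure_ball_subset_closedBall.trans hcl)).diffContOnCl hsh
  rw [deriv_sub_const_fun] at this
  refine this.trans (le_of_eq ?_)
  field_simp; ring

lemma norm_le_of_im_limit {r₀ : ℝ} (h1 : 1 < r₀) : ∃ C : ℝ, 1 ≤ C ∧
    ∀ (G : ℂ → ℂ) (R y M : ℝ), r₀ < R → DifferentiableOn ℂ G (Ann 1 R) →
      Tendsto (fun ζ => (G ζ).im) Lf (𝓝 y) → 0 < M →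
      (∀ ζ : ℂ, (1 + r₀) / 2 ≤ ‖ζ‖ → ‖ζ‖ ≤ r₀ → ‖G ζ‖ ≤ M) →
      ∀ ζ : ℂ, 1 < ‖ζ‖ → ‖ζ‖ ≤ r₀ → ‖G ζ‖ ≤ C * M := by
  have hl : 0 < Real.log r₀ := Real.log_pos h1
  refine ⟨1 + 32 / Real.log r₀ * r₀, by
    have : 0 < 32 / Real.log r₀ * r₀ := by positivity
    linarith, fun G R y M hR hG hy hM hb ζ h3 h4 => ?_⟩
  set r₁ := (1 + r₀) / 2 with hr₁
  have hMle : M ≤ (1 + 32 / Real.log r₀ * r₀) * M := by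
    have : 0 < 32 / Real.log r₀ * r₀ := by positivity
    nlinarith
  rcases le_total r₁ ‖ζ‖ with h5 | h5
  · exact (hb ζ h5 h4).trans hMle
  have hyM : |y| ≤ M := abs_limit_le hG hy h1 hR fun ξ hξ =>
    (Complex.abs_im_le_norm _).trans (hb ξ (by rw [hξ]; linarith) hξ.le)
  have him : ∀ ξ : ℂ, 1 < ‖ξ‖ → ‖ξ‖ ≤ r₀ →
      |(G ξ).im - y| ≤ 2 * M * Real.log ‖ξ‖ / Real.log r₀ := fun ξ ha hb' =>
    abs_im_sub_le_log hG hy h1 hR (by positivity) (fun ξ hξ => by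
      have := (Complex.abs_im_le_norm (G ξ)).trans (hb ξ (by rw [hξ]; linarith) hξ.le)
      have h7 := abs_sub (G ξ).im y
      linarith) ha hb'
  have hder : ∀ ξ : ℂ, 1 < ‖ξ‖ → ‖ξ‖ ≤ r₁ → ‖deriv G ξ‖ ≤ 32 * M / Real.log r₀ := by
    intro ξ ha hb'
    set d := ‖ξ‖ - 1 with hd
    have hd0 : 0 < d := by linarith
    have hball : ∀ u ∈ ball ξ d, 1 < ‖u‖ ∧ ‖u‖ < ‖ξ‖ + d := by
      intro u hu
      rw [mem_ball, dist_eq_norm] at hu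
      have h6 := abs_le.1 ((abs_norm_sub_norm_le u ξ).trans hu.le)
      have h7 := norm_sub_norm_le ξ u
      rw [norm_sub_rev] at h7
      have h8 := norm_sub_norm_le u ξ
      constructor <;> linarith
    have hbd : ∀ u ∈ ball ξ d, |(G u).im - y| ≤ 4 * M * d / Real.log r₀ := by
      intro u hu
      have ⟨ha', hb''⟩ := hball u hu
      refine (him u ha' (by linarith)).trans ?_
      have := Real.log_le_sub_one_of_pos (show 0 < ‖u‖ by linarith)
      gcongr ?_ / _
      nlinarith
    have := norm_deriv_le_of_im (h := G) (ζ := ξ) hd0 (B := 8 * M * d / Real.log r₀)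
      (by positivity) (hG.mono fun u hu => ⟨(hball u hu).1, by linarith [(hball u hu).2]⟩)
      (fun u hu => by
        have e1 := abs_le.1 (hbd u hu)
        have e2 := abs_le.1 (hbd ξ (mem_ball_self hd0))
        have : 8 * M * d / Real.log r₀ = 4 * M * d / Real.log r₀ + 4 * M * d / Real.log r₀ := by
          ring
        linarith [e1.2, e2.1])
    refine this.trans (le_of_eq ?_)
    field_simp; ring
  set ζ₁ : ℂ := ((r₁ / ‖ζ‖ : ℝ) : ℂ) * ζ with hζ₁
  have hn0 : 0 < ‖ζ‖ := by linarith
  have hn1 : ‖ζ₁‖ = r₁ := by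
    rw [hζ₁, norm_mul, Complex.norm_real, Real.norm_of_nonneg (by positivity),
      div_mul_cancel₀ _ hn0.ne']
  have hseg : ∀ u ∈ segment ℝ ζ ζ₁, 1 < ‖u‖ ∧ ‖u‖ ≤ r₁ := by
    rintro u ⟨a, b, ha, hb', hab, rfl⟩
    have : a • ζ + b • ζ₁ = ((a + b * (r₁ / ‖ζ‖) : ℝ) : ℂ) * ζ := by
      rw [hζ₁]; simp only [real_smul]; push_cast; ring
    rw [this, norm_mul, Complex.norm_real, Real.norm_of_nonneg (by positivity), add_mul,
      mul_assoc, div_mul_cancel₀ _ hn0.ne']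
    have : b = 1 - a := by linarith
    subst this
    constructor <;> nlinarith
  have hmv := (convex_segment ζ ζ₁).norm_image_sub_le_of_norm_deriv_le (𝕜 := ℂ) (f := G)
    (C := 32 * M / Real.log r₀) (fun u hu => diffAt_Ann hG ⟨(hseg u hu).1, by
      linarith [(hseg u hu).2]⟩) (fun u hu => hder u (hseg u hu).1 (hseg u hu).2)
    (right_mem_segment ℝ ζ ζ₁) (left_mem_segment ℝ ζ ζ₁)
  have hdist : ‖ζ - ζ₁‖ ≤ r₀ := by
    have : ζ - ζ₁ = ((1 - r₁ / ‖ζ‖ : ℝ) : ℂ) * ζ := by rw [hζ₁]; push_cast; ring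
    rw [this, norm_mul, Complex.norm_real, Real.norm_of_nonpos (by
      rw [sub_nonpos, le_div_iff₀ hn0]; linarith), neg_mul, sub_mul, div_mul_cancel₀ _ hn0.ne']
    linarith
  have h8 := hb ζ₁ hn1.ge (by rw [hn1]; linarith)
  have h9 : ‖G ζ‖ ≤ ‖G ζ₁‖ + ‖G ζ - G ζ₁‖ := by
    have := norm_add_le (G ζ₁) (G ζ - G ζ₁)
    rwa [add_sub_cancel] at this
  have h10 : 32 * M / Real.log r₀ * ‖ζ - ζ₁‖ ≤ 32 * M / Real.log r₀ * r₀ := by gcongr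
  calc ‖G ζ‖ ≤ M + 32 * M / Real.log r₀ * r₀ := by linarith
    _ = _ := by ring

lemma eq_const_of_tendsto (hG : DifferentiableOn ℂ G (Ann 1 R)) {p : ℂ}
    (hp : Tendsto G Lf (𝓝 p)) {ζ : ℂ} (hζ : ζ ∈ Ann 1 R) : G ζ = p := by
  obtain ⟨r₀, h1, h2⟩ := exists_between hζ.2
  have hz1 := hζ.1
  have h0 : 0 < r₀ := by linarith
  have hK : IsCompact (G '' sphere (0 : ℂ) r₀) :=
    (isCompact_sphere 0 r₀).image_of_continuousOn
      (hG.continuousOn.mono fun ζ hζ => mem_Ann_of_sphere (by linarith) h2 hζ)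
  obtain ⟨K, hK⟩ := hK.isBounded.subset_closedBall p
  have hK' : ∀ ξ : ℂ, ‖ξ‖ = r₀ → ‖G ξ - p‖ ≤ K := fun ξ hξ => by
    have := hK ⟨ξ, mem_sphere_zero_iff_norm.2 hξ, rfl⟩
    rwa [mem_closedBall, dist_eq_norm] at this
  have hK0 : 0 ≤ K := by
    have := hK' (r₀ : ℂ) (by rw [Complex.norm_real, Real.norm_of_nonneg h0.le])
    exact (norm_nonneg _).trans this
  have key : ∀ m : ℕ, ‖G ζ - p‖ ≤ K * (‖ζ‖ / r₀) ^ m := by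
    intro m
    set F : ℂ → ℂ := fun ξ => (G ξ - p) * (ξ⁻¹) ^ m with hF
    have hFd : DifferentiableOn ℂ F (Ann 1 R) := by
      intro ξ hξ
      have : ξ ≠ 0 := norm_pos_iff.1 (by linarith [hξ.1])
      exact ((hG ξ hξ).sub_const _).mul
        ((differentiableAt_inv this).differentiableWithinAt.pow m)
    have hFn : ∀ ξ, ‖F ξ‖ = ‖G ξ - p‖ * (‖ξ‖⁻¹) ^ m := fun ξ => by
      rw [hF]; simp only; rw [norm_mul, norm_pow, norm_inv]
    have : ∀ ε > (0 : ℝ), ‖F ζ‖ ≤ K * (r₀⁻¹) ^ m + ε := by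
      intro ε hε
      obtain ⟨s, hs, hsb⟩ := eventually_Lf.1 (Metric.tendsto_nhds.1 hp ε hε)
      set t := min ((1 + s) / 2) ‖ζ‖ with ht
      have t1 : 1 < t := lt_min (by linarith) hz1
      have t2 : t < s := (min_le_left _ _).trans_lt (by linarith)
      refine max_Ann hFd t1 h2 (fun ξ hξ => ?_) (fun ξ hξ => ?_) (min_le_right _ _) h1.le
      · have h5 := hsb ξ (by rw [hξ]; exact t1) (by rw [hξ]; exact t2)
        rw [dist_eq_norm] at h5
        have h6 : (‖ξ‖⁻¹) ^ m ≤ 1 := pow_le_one₀ (by positivity)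
          (inv_le_one_of_one_le₀ (by rw [hξ]; exact t1.le))
        have h7 : 0 ≤ K * (r₀⁻¹) ^ m := by positivity
        rw [hFn]
        nlinarith [norm_nonneg (G ξ - p), mul_le_mul_of_nonneg_left h6 (norm_nonneg (G ξ - p))]
      · rw [hFn, hξ]
        have := mul_le_mul_of_nonneg_right (hK' ξ hξ) (show 0 ≤ (r₀⁻¹) ^ m by positivity)
        linarith
    have h5 := le_of_forall_pos_le_add this
    rw [hFn] at h5
    have hn : 0 < ‖ζ‖ := by linarith
    calc ‖G ζ - p‖ = ‖G ζ - p‖ * (‖ζ‖⁻¹) ^ m * ‖ζ‖ ^ m := by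
          rw [mul_assoc, ← mul_pow, inv_mul_cancel₀ hn.ne', one_pow, mul_one]
      _ ≤ K * (r₀⁻¹) ^ m * ‖ζ‖ ^ m := by gcongr
      _ = _ := by rw [div_eq_mul_inv, mul_pow]; ring
  have hlim : Tendsto (fun m : ℕ => K * (‖ζ‖ / r₀) ^ m) atTop (𝓝 (K * 0)) :=
    (tendsto_pow_atTop_nhds_zero_of_lt_one (by positivity) ((div_lt_one h0).2 h1)).const_mul K
  have := ge_of_tendsto' hlim key
  rw [mul_zero] at this
  exact sub_eq_zero.1 (norm_le_zero_iff.1 this)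

end Annulus

lemma Slit.differentiableOn_comp_J (S : Slit) {f : ℂ → ℂ} {Ω : Set ℂ} {R : ℝ} (hΩ : IsOpen Ω)
    (hf : DifferentiableOn ℂ f Ω) (hJ : ∀ ζ ∈ Ann 1 R, S.J ζ ∈ Ω) :
    DifferentiableOn ℂ (f ∘ S.J) (Ann 1 R) := fun ζ hζ =>
  ((hf.differentiableAt (hΩ.mem_nhds (hJ ζ hζ))).comp ζ (S.hasDerivAt_J
    (norm_pos_iff.1 (by linarith [hζ.1]))).differentiableAt).differentiableWithinAt

lemma Slit.index (S : Slit) {f : ℂ → ℂ} {Ω : Set ℂ} {R : ℝ} (hΩ : IsOpen Ω)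
    (hc : IsPreconnected Ω) (hf : DifferentiableOn ℂ f Ω) (hi : InjOn f Ω)
    (hJ : ∀ ζ ∈ Ann 1 R, S.J ζ ∈ Ω) (hd : Disjoint Ω S.carrier)
    {q₀ : ℂ} {r₀ : ℝ} (hq₀ : q₀ ∈ Ω) (hr₀ : 1 < r₀) (hr₀R : r₀ < R) (hr₀q : r₀ < S.rho q₀)
    (hw₀ : wind (f ∘ S.J) r₀ (f q₀) = 0) {q : ℂ} (hq : q ∈ Ω) {r : ℝ} (hr : 1 < r) (hrR : r < R) :
    (r < S.rho q → wind (f ∘ S.J) r (f q) = 0) ∧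
    (S.rho q < r → wind (f ∘ S.J) r (f q) = 2 * Real.pi * I) := by
  set G := f ∘ S.J with hGdef
  have hG : DifferentiableOn ℂ G (Ann 1 R) := S.differentiableOn_comp_J hΩ hf hJ
  have hGi : InjOn G (Ann 1 R) := fun ζ hζ ξ hξ h =>
    S.J_inj hζ.1 hξ.1.le (hi (hJ ζ hζ) (hJ ξ hξ) h)
  have hrho : ∀ q ∈ Ω, 1 < S.rho q := fun q hq =>
    (S.one_lt_rho_iff q).2 fun h => hd.le_bot ⟨hq, h⟩
  have hne : ∀ q ∈ Ω, ∀ ζ ∈ Ann 1 R, ‖ζ‖ ≠ S.rho q → G ζ ≠ f q := by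
    intro q hq ζ hζ h he
    have := hi (hJ ζ hζ) hq he
    rw [← this, S.rho_J hζ.1.le] at h
    exact h rfl
  have hindep : ∀ q ∈ Ω, ∀ r r', 1 < r → r ≤ r' → r' < R → r' < S.rho q →
      wind G r' (f q) = wind G r (f q) := fun q hq r r' h1 h2 h3 h4 =>
    wind_eq_of_radius hG h1 h2 h3 fun ζ ha hb =>
      hne q hq ζ ⟨by linarith, by linarith⟩ (by linarith)
  have hindep' : ∀ q ∈ Ω, ∀ r r', 1 < r → r < R → r < S.rho q → 1 < r' → r' < R → r' < S.rho q →
      wind G r' (f q) = wind G r (f q) := by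
    intro q hq r r' h1 h2 h3 h4 h5 h6
    rcases le_total r r' with h | h
    · exact hindep q hq r r' h1 h h5 h6
    · exact (hindep q hq r' r h4 h h2 h3).symm
  have hR : 1 < R := by linarith
  have hloc : ∀ q ∈ Ω, ∃ r, 1 < r ∧ r < R ∧ r < S.rho q ∧
      ∀ᶠ q' in 𝓝 q, r < S.rho q' ∧ wind G r (f q') = wind G r (f q) := by
    intro q hq
    obtain ⟨r, h1, h2⟩ := exists_between (lt_min hR (hrho q hq))
    have h3 := h2.trans_le (min_le_left _ _)
    have h4 := h2.trans_le (min_le_right _ _)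
    refine ⟨r, h1, h3, h4, ?_⟩
    have hcf : ContinuousAt f q := (hf.differentiableAt (hΩ.mem_nhds hq)).continuousAt
    filter_upwards [hcf.eventually (wind_locally_const hG h1 h3 fun ζ hζ =>
        hne q hq ζ (mem_Ann_of_sphere h1 h3 hζ) (by
          rw [mem_sphere_zero_iff_norm.1 hζ]; exact h4.ne)),
      S.continuous_rho.continuousAt.eventually (lt_mem_nhds h4)] with q' ha hb
    exact ⟨hb, ha.2⟩
  have hzero : ∀ q ∈ Ω, ∃ r, 1 < r ∧ r < R ∧ r < S.rho q ∧ wind G r (f q) = 0 := by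
    set Z : Set ℂ := {q | ∃ r, 1 < r ∧ r < R ∧ r < S.rho q ∧ wind G r (f q) = 0}
    have : Ω ⊆ Z := by
      refine hc.subset_of_closure_inter_subset (u := interior Z) isOpen_interior ?_ ?_ |>.trans
        interior_subset
      · refine ⟨q₀, hq₀, ?_⟩
        obtain ⟨r, h1, h2, h3, h4⟩ := hloc q₀ hq₀
        rw [mem_interior_iff_mem_nhds]
        have h0 := (hindep' q₀ hq₀ r₀ r hr₀ hr₀R hr₀q h1 h2 h3).trans hw₀
        filter_upwards [h4] with q' ⟨ha, hb⟩
        exact ⟨r, h1, h2, ha, hb.trans h0⟩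
      · rintro q ⟨hqc, hq⟩
        obtain ⟨r, h1, h2, h3, h4⟩ := hloc q hq
        obtain ⟨q', ⟨hqa, hqb⟩, hqi⟩ := mem_closure_iff_nhds.1 hqc _ (h4.and (hΩ.mem_nhds hq))
        obtain ⟨r', h1', h2', h3', h4'⟩ := interior_subset hqi
        have h0 : wind G r (f q) = 0 :=
          hqa.2.symm.trans ((hindep' q' hqb r' r h1' h2' h3' h1 h2 hqa.1).trans h4')
        rw [mem_interior_iff_mem_nhds]
        filter_upwards [h4] with q'' ⟨ha, hb⟩
        exact ⟨r, h1, h2, ha, hb.trans h0⟩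
    exact fun q hq => this hq
  obtain ⟨s, s1, s2, s3, s4⟩ := hzero q hq
  refine ⟨fun h => (hindep' q hq s r s1 s2 s3 hr hrR h).trans s4, fun h => ?_⟩
  obtain ⟨ζ, hζ, hJζ⟩ := S.exists_J' q
  have : wind G r (G ζ) = wind G s (G ζ) + 2 * Real.pi * I :=
    wind_jump hG hGi s1 hrR (by rw [hζ]; exact s3) (by rw [hζ]; exact h)
  rw [hGdef, Function.comp_apply, hJζ, ← hGdef, s4, zero_add] at this
  exact this

lemma isPreconnected_Ann {r R : ℝ} (hr : 0 ≤ r) : IsPreconnected (Ann r R) := by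
  have : Ann r R = (fun p : ℝ × ℝ => (p.1 : ℂ) * Complex.exp (p.2 * I)) '' (Ioo r R ×ˢ univ) := by
    ext ζ
    constructor
    · rintro ⟨h1, h2⟩
      exact ⟨(‖ζ‖, arg ζ), ⟨⟨h1, h2⟩, mem_univ _⟩, Complex.norm_mul_exp_arg_mul_I ζ⟩
    · rintro ⟨⟨s, θ⟩, ⟨⟨h1, h2⟩, -⟩, rfl⟩
      have : ‖(s : ℂ) * Complex.exp (θ * I)‖ = s := by
        rw [norm_mul, Complex.norm_exp_ofReal_mul_I, mul_one, Complex.norm_real,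
          Real.norm_of_nonneg (hr.trans h1.le)]
      exact ⟨by simp only [this]; exact h1, by simp only [this]; exact h2⟩
  rw [this]
  exact (isPreconnected_Ioo.prod isPreconnected_univ).image _ (by fun_prop)

section OpenMapping

variable {f : ℂ → ℂ} {Ω : Set ℂ}

lemma map_nhds_of_injOn (hΩ : IsOpen Ω) (hf : DifferentiableOn ℂ f Ω) (hi : InjOn f Ω) {q : ℂ}
    (hq : q ∈ Ω) : map f (𝓝 q) = 𝓝 (f q) := by
  refine le_antisymm (hf.differentiableAt (hΩ.mem_nhds hq)).continuousAt ?_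
  refine (((hf.analyticAt (hΩ.mem_nhds hq))).eventually_constant_or_nhds_le_map_nhds).resolve_left
    fun h => ?_
  obtain ⟨ε, hε, hb⟩ := Metric.eventually_nhds_iff_ball.1 (h.and (hΩ.mem_nhds hq))
  have hx : q + (ε / 2 : ℝ) ∈ ball q ε := by
    rw [mem_ball, dist_eq_norm, add_sub_cancel_left, Complex.norm_real,
      Real.norm_of_nonneg (by positivity)]
    linarith
  have h4 := hi (hb _ hx).2 hq (hb _ hx).1
  have : ((ε / 2 : ℝ) : ℂ) = 0 := by linear_combination h4
  rw [ofReal_eq_zero] at this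
  linarith

lemma isOpen_image_of_injOn (hΩ : IsOpen Ω) (hf : DifferentiableOn ℂ f Ω) (hi : InjOn f Ω)
    {V : Set ℂ} (hV : IsOpen V) (hVΩ : V ⊆ Ω) : IsOpen (f '' V) := by
  rw [isOpen_iff_mem_nhds]
  rintro _ ⟨q, hq, rfl⟩
  rw [← map_nhds_of_injOn hΩ hf hi (hVΩ hq)]
  exact image_mem_map (hV.mem_nhds hq)

end OpenMapping

namespace Slit

variable (S : Slit)

lemma J_image_Ann {a b : ℝ} (ha : 1 ≤ a) : S.J '' Ann a b = {z | a < S.rho z ∧ S.rho z < b} := by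
  ext z
  constructor
  · rintro ⟨ζ, ⟨h1, h2⟩, rfl⟩
    have e := S.rho_J (ζ := ζ) (by linarith)
    exact ⟨by rw [e]; exact h1, by rw [e]; exact h2⟩
  · rintro ⟨h1, h2⟩
    obtain ⟨ζ, e, rfl⟩ := S.exists_J' z
    exact ⟨ζ, ⟨by rw [e]; exact h1, by rw [e]; exact h2⟩, rfl⟩

lemma continuousOn_J : ContinuousOn S.J {ζ | ζ ≠ 0} := fun _ hζ =>
  (S.hasDerivAt_J hζ).continuousAt.continuousWithinAt

lemma isPreconnected_rho {a b : ℝ} (ha : 1 ≤ a) :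
    IsPreconnected {z | a < S.rho z ∧ S.rho z < b} := by
  rw [← S.J_image_Ann ha]
  refine (isPreconnected_Ann (by linarith)).image _ (S.continuousOn_J.mono fun ζ hζ => ?_)
  exact norm_pos_iff.1 (by linarith [hζ.1])

lemma eventually_rho_subset {V : Set ℂ} (hV : IsOpen V) (h : S.carrier ⊆ V) :
    ∀ᶠ R in 𝓝[>] (1 : ℝ), {z | S.rho z ≤ R} ⊆ V := by
  obtain ⟨R, hR, hs⟩ := S.exists_rho_subset hV h
  filter_upwards [Ioo_mem_nhdsGT hR] with r hr
  exact fun z hz => hs (le_trans hz hr.2.le)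

lemma eventually_lt_rho (K : ℝ) : ∃ K₀, ∀ z : ℂ, K₀ < ‖z‖ → K < S.rho z := by
  obtain ⟨K₀, h⟩ := (S.isCompact_rho_le K).isBounded.subset_closedBall 0
  refine ⟨K₀, fun z hz => ?_⟩
  by_contra hcon
  have := h (show S.rho z ≤ K from not_lt.1 hcon)
  rw [mem_closedBall_zero_iff] at this
  linarith

lemma map_J_Lf {D : Set ℂ} {R : ℝ} (hR : 1 < R) (hD : ∀ z, 1 < S.rho z → S.rho z < R → z ∈ D)
    (hd : Disjoint D S.carrier) : map S.J Lf = 𝓝ˢ S.carrier ⊓ 𝓟 D := by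
  ext s
  rw [mem_map]
  change (∀ᶠ ζ in Lf, S.J ζ ∈ s) ↔ _
  rw [eventually_Lf, mem_inf_principal]
  constructor
  · rintro ⟨r, hr, h⟩
    rw [mem_nhdsSet_iff_forall]
    intro z hz
    have : S.rho z < r := by rw [(S.rho_eq_one_iff z).2 hz]; exact hr
    filter_upwards [S.continuous_rho.continuousAt.eventually (gt_mem_nhds this)] with w hw hwD
    obtain ⟨ζ, e, rfl⟩ := S.exists_J' w
    refine h ζ ?_ (by rw [e]; exact hw)
    rw [e, S.one_lt_rho_iff]
    exact fun hc => hd.le_bot ⟨hwD, hc⟩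
  · intro h
    obtain ⟨V, hVo, hV, hVs⟩ := mem_nhdsSet_iff_exists.1 h
    obtain ⟨r, hr, hrV⟩ := S.exists_rho_subset hVo hV
    refine ⟨min r R, lt_min hr hR, fun ζ h1 h2 => ?_⟩
    have e := S.rho_J h1.le
    refine hVs (hrV ?_) (hD _ (by rw [e]; exact h1) (by rw [e]; exact h2.trans_le (min_le_right _ _)))
    change S.rho _ ≤ r
    rw [e]; exact (h2.trans_le (min_le_left _ _)).le

lemma isPreconnected_diff {U : Set ℂ} (hU : IsOpen U) (hc : IsPreconnected U) {R : ℝ}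
    (hR : 1 < R) (h : ∀ z, S.rho z ≤ R → z ∈ U) : IsPreconnected (U \ S.carrier) := by
  have key : ∀ u v : Set ℂ, IsOpen u → IsOpen v → U \ S.carrier ⊆ u ∪ v →
      (U \ S.carrier) ∩ (u ∩ v) = ∅ → {z | 1 < S.rho z ∧ S.rho z < R} ⊆ u →
      U \ S.carrier ⊆ u ∨ U \ S.carrier ⊆ v := by
    intro u v hu hv huv hdis hA
    have ho : IsOpen (U \ S.carrier) := hU.sdiff S.isCompact_carrier.isClosed
    have := (isPreconnected_iff_subset_of_disjoint.1 hc)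
      ((u ∩ (U \ S.carrier)) ∪ {z | S.rho z < R}) (v ∩ (U \ S.carrier))
      ((hu.inter ho).union (isOpen_lt S.continuous_rho continuous_const)) (hv.inter ho) (by
        intro z hz
        by_cases hzc : z ∈ S.carrier
        · left; right
          change S.rho z < R
          rw [(S.rho_eq_one_iff z).2 hzc]; exact hR
        · rcases huv ⟨hz, hzc⟩ with h | h
          · left; left; exact ⟨h, hz, hzc⟩
          · right; exact ⟨h, hz, hzc⟩) (by
        rw [eq_empty_iff_forall_notMem] at hdis ⊢
        rintro z ⟨hz, h1 | h1, h2⟩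
        · exact hdis z ⟨h1.2, h1.1, h2.1⟩
        · exact hdis z ⟨h2.2, hA ⟨(S.one_lt_rho_iff z).2 h2.2.2, h1⟩, h2.1⟩)
    rcases this with h1 | h1
    · left
      intro z hz
      rcases h1 hz.1 with h2 | h2
      · exact h2.1
      · exact hA ⟨(S.one_lt_rho_iff z).2 hz.2, h2⟩
    · right
      intro z hz
      exact (h1 hz.1).1
  rw [isPreconnected_iff_subset_of_disjoint]
  intro u v hu hv huv hdis
  have hAs : {z | 1 < S.rho z ∧ S.rho z < R} ⊆ U \ S.carrier := fun z hz =>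
    ⟨h z hz.2.le, (S.one_lt_rho_iff z).1 hz.1⟩
  rcases (isPreconnected_iff_subset_of_disjoint.1 (S.isPreconnected_rho (b := R) le_rfl)) u v hu hv
    (hAs.trans huv) (by
      rw [eq_empty_iff_forall_notMem] at hdis ⊢
      exact fun z hz => hdis z ⟨hAs hz.1, hz.2⟩) with h1 | h1
  · exact key u v hu hv huv hdis h1
  · exact (key v u hv hu (by rwa [union_comm]) (by rwa [inter_comm v u]) h1).symm

end Slit

lemma isOpen_UHP : IsOpen UHP := isOpen_lt continuous_const Complex.continuous_im

lemma convex_UHP : Convex ℝ UHP := convex_halfSpace_im_gt 0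

/-- A parallel slit half-plane together with pairwise disjoint collars around the slits. -/
structure SD where
  N : ℕ
  S : Fin N → Slit
  R : ℝ
  hR : 1 < R
  sub : ∀ j z, (S j).rho z ≤ R → 0 < z.im
  disj : ∀ i j z, (S i).rho z ≤ R → (S j).rho z ≤ R → i = j

namespace SD

variable (Δ : SD)

/-- The underlying domain. -/
def dom : Set ℂ := UHP \ ⋃ j, (Δ.S j).carrier

variable {Δ}

lemma isOpen_dom : IsOpen Δ.dom :=
  isOpen_UHP.sdiff (isClosed_iUnion_of_finite fun j => (Δ.S j).isCompact_carrier.isClosed)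

lemma mem_dom_of_rho {j : Fin Δ.N} {z : ℂ} (h1 : 1 < (Δ.S j).rho z) (h2 : (Δ.S j).rho z ≤ Δ.R) :
    z ∈ Δ.dom := by
  refine ⟨Δ.sub j z h2, fun h => ?_⟩
  obtain ⟨i, hi⟩ := mem_iUnion.1 h
  have e := ((Δ.S i).rho_eq_one_iff z).2 hi
  have := Δ.disj i j z (by rw [e]; exact Δ.hR.le) h2
  subst this
  exact h1.ne' e

lemma J_mem_dom {j : Fin Δ.N} {ζ : ℂ} (h : ζ ∈ Ann 1 Δ.R) : (Δ.S j).J ζ ∈ Δ.dom := by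
  have e := (Δ.S j).rho_J h.1.le
  exact mem_dom_of_rho (j := j) (by rw [e]; exact h.1) (by rw [e]; exact h.2.le)

lemma disjoint_carrier (j : Fin Δ.N) : Disjoint Δ.dom (Δ.S j).carrier := by
  rw [Set.disjoint_left]
  exact fun z hz hc => hz.2 (mem_iUnion.2 ⟨j, hc⟩)

lemma mem_dom_or {z : ℂ} (hz : 0 < z.im) : z ∈ Δ.dom ∨ ∃ j, z ∈ (Δ.S j).carrier := by
  by_cases h : z ∈ ⋃ j, (Δ.S j).carrier
  · exact Or.inr (mem_iUnion.1 h)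
  · exact Or.inl ⟨hz, h⟩

lemma UHP_diff_dom : UHP \ Δ.dom = ⋃ j, (Δ.S j).carrier := by
  unfold dom
  rw [sdiff_sdiff_right_self]
  exact inter_eq_right.2 (iUnion_subset fun j => (Δ.S j).carrier_subset_UHP)

lemma isPreconnected_dom : IsPreconnected Δ.dom := by
  have key : ∀ F : Finset (Fin Δ.N), IsPreconnected (UHP \ ⋃ j ∈ F, (Δ.S j).carrier) := by
    intro F
    induction F using Finset.induction_on with
    | empty => simpa using convex_UHP.isPreconnected
    | insert a F ha ih =>
      rw [Finset.set_biUnion_insert, union_comm, ← sdiff_sdiff]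
      refine (Δ.S a).isPreconnected_diff ?_ ih Δ.hR fun z hz => ⟨Δ.sub a z hz, fun h => ?_⟩
      · exact isOpen_UHP.sdiff ((F.finite_toSet).isClosed_biUnion
          fun j _ => (Δ.S j).isCompact_carrier.isClosed)
      · obtain ⟨i, hi, hc⟩ := mem_iUnion₂.1 h
        have e := ((Δ.S i).rho_eq_one_iff z).2 hc
        exact ha (Δ.disj i a z (by rw [e]; exact Δ.hR.le) hz ▸ hi)
  have := key Finset.univ
  simp only [Finset.mem_univ, iUnion_true] at this
  exact this

end SD

lemma Slit.eventually_collar {N : ℕ} (S : Fin N → Slit)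
    (hd : Pairwise fun i j => Disjoint (S i).carrier (S j).carrier) :
    ∀ᶠ R in 𝓝[>] (1 : ℝ), (∀ j z, (S j).rho z ≤ R → 0 < z.im) ∧
      ∀ i j z, (S i).rho z ≤ R → (S j).rho z ≤ R → i = j := by
  refine (eventually_all.2 fun j => ?_).and (eventually_all.2 fun i => eventually_all.2 fun j => ?_)
  · filter_upwards [(S j).eventually_rho_subset isOpen_UHP (S j).carrier_subset_UHP] with R h z hz
    exact h hz
  · by_cases hij : i = j
    · exact Eventually.of_forall fun R z _ _ => hij
    · obtain ⟨r, hr, h⟩ := (S i).exists_rho_subset (S j).isCompact_carrier.isClosed.isOpen_compl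
        (hd hij).subset_compl_right
      have ho : IsOpen {z | (S i).rho z ≤ r}ᶜ :=
        ((S i).isCompact_rho_le r).isClosed.isOpen_compl
      filter_upwards [(S j).eventually_rho_subset ho (fun z hz hzr => h hzr hz),
        Ioo_mem_nhdsGT hr] with R hRj hRr z h1 h2
      exact absurd (show (S i).rho z ≤ r from h1.trans hRr.2.le) (hRj h2)

lemma IsParallelSlitHalfPlane.exists_SD {D : Set ℂ} (h : IsParallelSlitHalfPlane D) :
    ∃ Δ : SD, Δ.dom = D := by
  obtain ⟨N, C, hC, hd, rfl⟩ := h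
  choose y xl xr hy hx he using hC
  let S : Fin N → Slit := fun j => ⟨y j, xl j, xr j, hy j, hx j⟩
  have hS : ∀ j, (S j).carrier = C j := fun j => (he j).symm
  obtain ⟨R, ⟨h1, h2⟩, h3⟩ := ((Slit.eventually_collar S (by
    intro i j hij; rw [hS, hS]; exact hd hij)).and self_mem_nhdsWithin).exists
  refine ⟨⟨N, S, R, h3, h1, h2⟩, ?_⟩
  change UHP \ ⋃ j, (S j).carrier = _
  simp only [hS]

/-- Neighbourhoods of the slits of a parallel slit half-plane, seen from inside. -/
def slitFilter (D : Set ℂ) : Filter ℂ := 𝓝ˢ (UHP \ D) ⊓ 𝓟 D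

lemma SD.slitFilter_eq (Δ : SD) : slitFilter Δ.dom = ⨆ j, map (Δ.S j).J Lf := by
  unfold slitFilter
  rw [SD.UHP_diff_dom, nhdsSet_iUnion, ← iSup_inf_principal]
  congr 1
  funext j
  exact ((Δ.S j).map_J_Lf Δ.hR (fun z h1 h2 => SD.mem_dom_of_rho h1 h2.le)
    (SD.disjoint_carrier j)).symm

/-- The cluster set of a map along the slits of its domain. -/
def slitCluster (D : Set ℂ) (f : ℂ → ℂ) : Set ℂ := {w | MapClusterPt w (slitFilter D) f}

lemma SD.mem_slitCluster {Δ : SD} {f : ℂ → ℂ} {w : ℂ} :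
    w ∈ slitCluster Δ.dom f ↔ ∃ j, MapClusterPt w Lf (f ∘ (Δ.S j).J) := by
  change MapClusterPt w (slitFilter Δ.dom) f ↔ _
  simp only [mapClusterPt_iff_frequently]
  rw [Δ.slitFilter_eq]
  simp only [frequently_iSup, frequently_map]
  constructor
  · intro h
    by_contra! hcon
    choose s hs hf using hcon
    obtain ⟨j, hj⟩ := h (⋂ j, s j) (iInter_mem.2 hs)
    obtain ⟨ζ, h1, h2⟩ := (hj.and_eventually (hf j)).exists
    exact h2 (mem_iInter.1 h1 j)
  · rintro ⟨j, hj⟩ s hs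
    exact ⟨j, hj s hs⟩

/-- A univalent function on a domain containing a punctured collar of the slit `S`. -/
structure IsChart (S : Slit) (f : ℂ → ℂ) (Ω : Set ℂ) (R : ℝ) : Prop where
  hR : 1 < R
  isOpen : IsOpen Ω
  conn : IsPreconnected Ω
  holo : DifferentiableOn ℂ f Ω
  inj : InjOn f Ω
  J_mem : ∀ ζ ∈ Ann 1 R, S.J ζ ∈ Ω
  disj : Disjoint Ω S.carrier
  far : ∀ K : ℝ, ∃ q ∈ Ω, K < ‖q‖ ∧ K < ‖f q‖

/-- The cluster set along a slit. -/
def Slit.cl (S : Slit) (f : ℂ → ℂ) : Set ℂ := {w | MapClusterPt w Lf (f ∘ S.J)}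

lemma Slit.isClosed_cl (S : Slit) (f : ℂ → ℂ) : IsClosed (S.cl f) := isClosed_setOfPred_clusterPt

namespace IsChart

variable {S : Slit} {f : ℂ → ℂ} {Ω : Set ℂ} {R : ℝ} (h : IsChart S f Ω R)

include h

lemma holo_comp : DifferentiableOn ℂ (f ∘ S.J) (Ann 1 R) :=
  S.differentiableOn_comp_J h.isOpen h.holo h.J_mem

lemma exists_bound_sphere {r : ℝ} (h1 : 1 < r) (h2 : r < R) :
    ∃ M : ℝ, ∀ ζ : ℂ, ‖ζ‖ = r → ‖f (S.J ζ)‖ ≤ M := by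
  obtain ⟨M, hM⟩ := (isCompact_sphere (0 : ℂ) r).exists_bound_of_continuousOn
    (h.holo_comp.continuousOn.mono fun ζ hζ => mem_Ann_of_sphere h1 h2 hζ)
  exact ⟨M, fun ζ hζ => hM ζ (mem_sphere_zero_iff_norm.2 hζ)⟩

lemma index {q : ℂ} (hq : q ∈ Ω) {r : ℝ} (h1 : 1 < r) (h2 : r < R) :
    (r < S.rho q → wind (f ∘ S.J) r (f q) = 0) ∧
    (S.rho q < r → wind (f ∘ S.J) r (f q) = 2 * Real.pi * I) := by
  obtain ⟨M, hM⟩ := h.exists_bound_sphere h1 h2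
  obtain ⟨K, hK⟩ := S.eventually_lt_rho r
  obtain ⟨q₀, hq₀, ha, hb⟩ := h.far (max M K)
  refine S.index h.isOpen h.conn h.holo h.inj h.J_mem h.disj hq₀ h1 h2
    (hK _ ((le_max_right _ _).trans_lt ha)) ?_ hq h1 h2
  refine wind_zero_of_norm_lt h.holo_comp h1 h2 fun ζ hζ => ?_
  exact (hM ζ (mem_sphere_zero_iff_norm.1 hζ)).trans_lt ((le_max_left _ _).trans_lt hb)

lemma exists_norm_le {q : ℂ} (hq : q ∈ Ω) {r : ℝ} (h1 : 1 < r) (h2 : r < R)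
    (hqr : S.rho q < r) : ∃ ζ : ℂ, ‖ζ‖ = r ∧ ‖f q‖ ≤ ‖f (S.J ζ)‖ := by
  by_contra! hcon
  have e1 := (h.index hq h1 h2).2 hqr
  rw [wind_zero_of_norm_lt h.holo_comp h1 h2
    fun ζ hζ => hcon ζ (mem_sphere_zero_iff_norm.1 hζ)] at e1
  exact Complex.two_pi_I_ne_zero e1.symm

lemma exists_bound {r : ℝ} (h1 : 1 < r) (h2 : r < R) :
    ∃ M : ℝ, ∀ ζ : ℂ, 1 < ‖ζ‖ → ‖ζ‖ < r → ‖f (S.J ζ)‖ ≤ M := by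
  obtain ⟨M, hM⟩ := h.exists_bound_sphere h1 h2
  refine ⟨M, fun ζ ha hb => ?_⟩
  have e := S.rho_J ha.le
  obtain ⟨ξ, hξ, hle⟩ := h.exists_norm_le (h.J_mem ζ ⟨ha, hb.trans h2⟩) h1 h2 (by rw [e]; exact hb)
  exact hle.trans (hM ξ hξ)

lemma exists_eventually_bound : ∃ M : ℝ, ∀ᶠ ζ in Lf, ‖f (S.J ζ)‖ ≤ M := by
  obtain ⟨r, h1, h2⟩ := exists_between h.hR
  obtain ⟨M, hM⟩ := h.exists_bound h1 h2
  exact ⟨M, eventually_Lf.2 ⟨r, h1, hM⟩⟩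

lemma exists_mem_cl_of_frequently {A : Set ℂ} (hA : IsClosed A)
    (hf : ∃ᶠ ζ in Lf, f (S.J ζ) ∈ A) : ∃ w ∈ A, w ∈ S.cl f := by
  obtain ⟨M, hM⟩ := h.exists_eventually_bound
  have hK : IsCompact (A ∩ closedBall 0 M) := (isCompact_closedBall 0 M).inter_left hA
  obtain ⟨w, hw, hc⟩ := hK.exists_mapClusterPt_of_frequently (f := f ∘ S.J) (l := Lf)
    ((hf.and_eventually hM).mono fun ζ hζ => ⟨hζ.1, mem_closedBall_zero_iff.2 hζ.2⟩)
  exact ⟨w, hw.1, hc⟩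

lemma eventually_mem_of_cl_subset {V : Set ℂ} (hV : IsOpen V) (hs : S.cl f ⊆ V) :
    ∀ᶠ ζ in Lf, f (S.J ζ) ∈ V := by
  by_contra hcon
  obtain ⟨w, hw, hc⟩ := h.exists_mem_cl_of_frequently hV.isClosed_compl
    ((not_eventually.1 hcon).mono fun ζ hζ => hζ)
  exact hw (hs hc)

lemma nonempty_cl : (S.cl f).Nonempty := by
  obtain ⟨w, -, hw⟩ := h.exists_mem_cl_of_frequently isClosed_univ
    (Eventually.frequently (Eventually.of_forall fun _ => mem_univ _))
  exact ⟨w, hw⟩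

lemma notMem_image_of_mem_cl {w : ℂ} (hw : w ∈ S.cl f) : w ∉ f '' Ω := by
  rintro ⟨q, hq, rfl⟩
  have hq1 : 1 < S.rho q := (S.one_lt_rho_iff q).2 fun hc => h.disj.le_bot ⟨hq, hc⟩
  obtain ⟨s, hs1, hs2⟩ := exists_between hq1
  have hV : IsOpen (Ω ∩ {z | s < S.rho z}) :=
    h.isOpen.inter (isOpen_lt continuous_const S.continuous_rho)
  have hn : f '' (Ω ∩ {z | s < S.rho z}) ∈ 𝓝 (f q) :=
    (isOpen_image_of_injOn h.isOpen h.holo h.inj hV inter_subset_left).mem_nhds ⟨q, ⟨hq, hs2⟩, rfl⟩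
  have hfr := (mapClusterPt_iff_frequently.1 hw) _ hn
  have hev : ∀ᶠ ζ in Lf, ζ ∈ Ann 1 (min s R) := Ann_mem_Lf (lt_min hs1 h.hR)
  obtain ⟨ζ, ⟨z, ⟨hz, hsz⟩, hzζ⟩, h1, h2⟩ := (hfr.and_eventually hev).exists
  have : z = S.J ζ := h.inj hz (h.J_mem ζ ⟨h1, h2.trans_le (min_le_right _ _)⟩) hzζ
  change s < S.rho z at hsz
  rw [this, S.rho_J h1.le] at hsz
  exact absurd (h2.trans_le (min_le_left _ _)) hsz.not_gt

lemma sphere_ne_of_mem_cl {w : ℂ} (hw : w ∈ S.cl f) {r : ℝ} (h1 : 1 < r) (h2 : r < R) :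
    ∀ ζ ∈ sphere (0 : ℂ) r, (f ∘ S.J) ζ ≠ w := fun ζ hζ e =>
  h.notMem_image_of_mem_cl hw ⟨_, h.J_mem ζ (mem_Ann_of_sphere h1 h2 hζ), e⟩

lemma wind_of_mem_cl {w : ℂ} (hw : w ∈ S.cl f) {r : ℝ} (h1 : 1 < r) (h2 : r < R) :
    wind (f ∘ S.J) r w = 2 * Real.pi * I := by
  have hl := wind_locally_const h.holo_comp h1 h2 (h.sphere_ne_of_mem_cl hw h1 h2)
  have hfr := (mapClusterPt_iff_frequently.1 hw) _ hl
  have hev : ∀ᶠ ζ in Lf, ζ ∈ Ann 1 r := Ann_mem_Lf h1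
  obtain ⟨ζ, ⟨-, e⟩, ha, hb⟩ := (hfr.and_eventually hev).exists
  rw [← e]
  exact (h.index (h.J_mem ζ ⟨ha, hb.trans h2⟩) h1 h2).2 (by rw [S.rho_J ha.le]; exact hb)

lemma isCompact_cl : IsCompact (S.cl f) := by
  obtain ⟨M, hM⟩ := h.exists_eventually_bound
  refine (isCompact_closedBall (0 : ℂ) M).of_isClosed_subset (S.isClosed_cl f) fun w hw => ?_
  by_contra hcon
  have := (mapClusterPt_iff_frequently.1 hw) _ (isClosed_closedBall.isOpen_compl.mem_nhds hcon)
  obtain ⟨ζ, h1, h2⟩ := (this.and_eventually hM).exists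
  exact h1 (mem_closedBall_zero_iff.2 h2)

lemma wind_eq_zero_of_convex (hc : Convex ℝ (S.cl f)) {w : ℂ} (hw : w ∉ S.cl f) (hwf : w ∉ f '' Ω)
    {r : ℝ} (h1 : 1 < r) (h2 : r < R) : wind (f ∘ S.J) r w = 0 := by
  obtain ⟨L, u, hL1, hL2⟩ := geometric_hahn_banach_point_closed hc (S.isClosed_cl f) hw
  have hV : IsOpen {z : ℂ | u < L z} := isOpen_lt continuous_const L.continuous
  have hev := h.eventually_mem_of_cl_subset hV hL2
  rw [eventually_Lf] at hev
  obtain ⟨s, hs1, hs⟩ := hev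
  obtain ⟨r', hr1, hr2⟩ := exists_between (lt_min hs1 h1)
  have hrs := hr2.trans_le (min_le_left _ _)
  have hrr := hr2.trans_le (min_le_right _ _)
  rw [wind_eq_of_radius h.holo_comp hr1 hrr.le h2 fun ζ ha hb e =>
    hwf ⟨_, h.J_mem ζ ⟨hr1.trans_le ha, hb.trans_lt h2⟩, e⟩]
  have hLr : ∀ z : ℂ, L z = (((L 1 : ℂ) - L I * I) * z).re := by
    intro z
    have : z = z.re • (1 : ℂ) + z.im • I := by
      apply Complex.ext <;> simp
    conv_lhs => rw [this]
    rw [map_add, map_smul, map_smul]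
    simp
    ring
  refine wind_zero_of_half_plane h.holo_comp hr1 (hrr.trans h2) ((L 1 : ℂ) - L I * I) fun ζ hζ => ?_
  rw [← hLr, map_sub]
  rw [mem_sphere_zero_iff_norm] at hζ
  have : u < L (f (S.J ζ)) := hs ζ (by rw [hζ]; exact hr1) (by rw [hζ]; exact hrs)
  change 0 < L (f (S.J ζ)) - L w
  linarith

/-- The image of a collar, filled in by the cluster set, is open. -/
lemma isOpen_fill (hc : Convex ℝ (S.cl f)) {r : ℝ} (h1 : 1 < r) (h2 : r < R) :
    IsOpen (f '' {z ∈ Ω | S.rho z < r} ∪ S.cl f) := by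
  rw [isOpen_iff_mem_nhds]
  rintro w (hw | hw)
  · refine mem_of_superset (IsOpen.mem_nhds ?_ hw) subset_union_left
    exact isOpen_image_of_injOn h.isOpen h.holo h.inj
      (h.isOpen.inter (isOpen_lt S.continuous_rho continuous_const)) inter_subset_left
  · filter_upwards [wind_locally_const h.holo_comp h1 h2 (h.sphere_ne_of_mem_cl hw h1 h2)]
      with p ⟨hp, e⟩
    rw [h.wind_of_mem_cl hw h1 h2] at e
    by_cases hcl : p ∈ S.cl f
    · exact Or.inr hcl
    · by_cases hpf : p ∈ f '' Ω
      · obtain ⟨q, hq, rfl⟩ := hpf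
        refine Or.inl ⟨q, ⟨hq, ?_⟩, rfl⟩
        by_contra hcon
        rcases (not_lt.1 hcon).lt_or_eq with hlt | heq
        · rw [(h.index hq h1 h2).1 hlt] at e
          exact Complex.two_pi_I_ne_zero e.symm
        · obtain ⟨ζ, hζ, hJ⟩ := S.exists_J' q
          exact hp ζ (mem_sphere_zero_iff_norm.2 (by rw [hζ, heq])) (by simp [hJ])
      · rw [h.wind_eq_zero_of_convex hc hcl hpf h1 h2] at e
        exact (Complex.two_pi_I_ne_zero e.symm).elim

end IsChart

section SchwarzPick

variable {h : ℂ → ℂ} {c z : ℂ} {ρ : ℝ}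

lemma schwarz_pick_ball_of_pos (hh : DifferentiableOn ℂ h (ball c ρ))
    (h0 : ∀ z ∈ ball c ρ, 0 ≤ (h z).im) (hc : 0 < (h c).im) (hz : z ∈ ball c ρ) :
    ‖h z - h c‖ * ρ ≤ ‖z - c‖ * ‖h z - (starRingEnd ℂ) (h c)‖ := by
  have hρ : 0 < ρ := pos_of_mem_ball hz
  have hne : ∀ w ∈ ball c ρ, h w - (starRingEnd ℂ) (h c) ≠ 0 := by
    intro w hw e
    have := congrArg Complex.im e
    have := h0 w hw
    simp at *
    linarith
  have hle : ∀ w ∈ ball c ρ, ‖h w - h c‖ ≤ ‖h w - (starRingEnd ℂ) (h c)‖ := by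
    intro w hw
    rw [Complex.norm_def, Complex.norm_def]
    apply Real.sqrt_le_sqrt
    simp only [normSq_apply, sub_re, sub_im, conj_re, conj_im]
    nlinarith [h0 w hw]
  have hg : DifferentiableOn ℂ (fun w => (h w - h c) / (h w - (starRingEnd ℂ) (h c))) (ball c ρ) :=
    (hh.sub_const _).div (hh.sub_const _) hne
  have hm : MapsTo (fun w => (h w - h c) / (h w - (starRingEnd ℂ) (h c))) (ball c ρ)
      (closedBall ((fun w => (h w - h c) / (h w - (starRingEnd ℂ) (h c))) c) 1) := by
    intro w hw
    rw [mem_closedBall, dist_eq_norm]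
    simp only [sub_self, zero_div, sub_zero, norm_div]
    exact div_le_one_of_le₀ (hle w hw) (norm_nonneg _)
  have := Complex.dist_le_div_mul_dist_of_mapsTo_ball hg hm hz
  rw [dist_eq_norm, dist_eq_norm] at this
  simp only [sub_self, zero_div, sub_zero, norm_div] at this
  rw [div_le_iff₀ (norm_pos_iff.2 (hne z hz))] at this
  calc ‖h z - h c‖ * ρ ≤ (1 / ρ * ‖z - c‖ * ‖h z - (starRingEnd ℂ) (h c)‖) * ρ := by gcongr
    _ = _ := by field_simp

/-- The Schwarz–Pick inequality from a disc into the closed upper half-plane. -/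
lemma schwarz_pick_ball (hh : DifferentiableOn ℂ h (ball c ρ))
    (h0 : ∀ z ∈ ball c ρ, 0 ≤ (h z).im) (hz : z ∈ ball c ρ) :
    ‖h z - h c‖ * ρ ≤ ‖z - c‖ * ‖h z - (starRingEnd ℂ) (h c)‖ := by
  have hρ : 0 < ρ := pos_of_mem_ball hz
  have key : ∀ ε : ℝ, 0 < ε → ‖h z - h c‖ * ρ ≤
      ‖z - c‖ * ‖h z - (starRingEnd ℂ) (h c) + 2 * ε * I‖ := by
    intro ε hε
    have h2 := schwarz_pick_ball_of_pos (h := fun w => h w + ε * I) (hh.add_const _)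
      (fun w hw => by have := h0 w hw; simp; linarith)
      (by have := h0 c (mem_ball_self hρ); simp; linarith) hz
    convert h2 using 3
    · simp
    · simp
      ring
  have hc : Tendsto (fun ε : ℝ => ‖z - c‖ * ‖h z - (starRingEnd ℂ) (h c) + 2 * ε * I‖) (𝓝[>] 0)
      (𝓝 (‖z - c‖ * ‖h z - (starRingEnd ℂ) (h c) + 2 * (0 : ℝ) * I‖)) := by
    apply Tendsto.mono_left _ nhdsWithin_le_nhds
    exact Continuous.tendsto (by fun_prop) 0
  have := ge_of_tendsto hc (eventually_mem_nhdsWithin.mono key)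
  simpa using this

lemma norm_sub_le_ball (hh : DifferentiableOn ℂ h (ball c ρ))
    (h0 : ∀ z ∈ ball c ρ, 0 ≤ (h z).im) (hz : z ∈ ball c ρ) :
    ‖h z - h c‖ * (ρ - ‖z - c‖) ≤ 2 * ‖z - c‖ * (h c).im := by
  have h1 := schwarz_pick_ball hh h0 hz
  have h2 : ‖h z - (starRingEnd ℂ) (h c)‖ ≤ ‖h z - h c‖ + 2 * (h c).im := by
    have e : h z - (starRingEnd ℂ) (h c) = (h z - h c) + (2 * (h c).im : ℝ) * I := by
      apply Complex.ext <;> simp; ring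
    rw [e]
    refine (norm_add_le _ _).trans ?_
    rw [norm_mul, norm_I, mul_one, Complex.norm_real, Real.norm_of_nonneg]
    have := h0 c (mem_ball_self (pos_of_mem_ball hz))
    linarith
  nlinarith [norm_nonneg (z - c), mul_le_mul_of_nonneg_left h2 (norm_nonneg (z - c))]

lemma im_lower_ball {q : ℝ} (hh : DifferentiableOn ℂ h (ball c ρ))
    (h0 : ∀ z ∈ ball c ρ, 0 ≤ (h z).im) (hz : z ∈ ball c ρ) (hq : q ≤ 1) (hzq : ‖z - c‖ ≤ q * ρ) :
    (1 - q ^ 2) / 16 * (h c).im ≤ (h z).im := by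
  have hρ : 0 < ρ := pos_of_mem_ball hz
  have hq0 : 0 ≤ q := by
    by_contra! hcon
    nlinarith [norm_nonneg (z - c)]
  have h1 := schwarz_pick_ball hh h0 hz
  have h2 : ‖h z - h c‖ ≤ q * ‖h z - (starRingEnd ℂ) (h c)‖ := by
    refine le_of_mul_le_mul_right (h1.trans ?_) hρ
    calc _ ≤ (q * ρ) * ‖h z - (starRingEnd ℂ) (h c)‖ := by gcongr
      _ = _ := by ring
  have h3 : ‖h z - h c‖ ^ 2 ≤ q ^ 2 * ‖h z - (starRingEnd ℂ) (h c)‖ ^ 2 := by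
    rw [← mul_pow]; gcongr
  rw [Complex.sq_norm, Complex.sq_norm] at h3
  simp only [normSq_apply, sub_re, sub_im, conj_re, conj_im] at h3
  have ha := h0 z hz
  have hb := h0 c (mem_ball_self hρ)
  set α := (h z).im
  set β := (h c).im
  have hq2 : q ^ 2 ≤ 1 := pow_le_one₀ hq0 hq
  have h4 : (1 - q ^ 2) * (α - β) ^ 2 ≤ 4 * α * β := by
    nlinarith [mul_nonneg (sub_nonneg.2 hq2) (mul_self_nonneg ((h z).re - (h c).re)),
      mul_nonneg (sub_nonneg.2 hq2) (mul_nonneg ha hb)]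
  by_contra! hcon
  have hβ : 0 < β := by
    rcases hb.lt_or_eq with h | h
    · exact h
    · rw [← h] at hcon; simp at hcon; linarith
  have h5 : α < β / 16 := hcon.trans_le (by nlinarith [sq_nonneg q])
  have h6 : (1 - q ^ 2) * (β ^ 2 / 4) ≤ (1 - q ^ 2) * (α - β) ^ 2 := by
    apply mul_le_mul_of_nonneg_left _ (sub_nonneg.2 hq2)
    nlinarith
  nlinarith

lemma eqOn_const_of_im_eq_zero {D : Set ℂ} (hD : IsOpen D) (hc : IsPreconnected D)
    (hh : DifferentiableOn ℂ h D) (h0 : ∀ z ∈ D, 0 ≤ (h z).im) {p : ℂ} (hp : p ∈ D)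
    (hp0 : (h p).im = 0) : EqOn h (fun _ => h p) D := by
  refine (hh.analyticOnNhd hD).eqOn_of_preconnected_of_eventuallyEq
    (fun _ _ => analyticAt_const) hc hp ?_
  obtain ⟨ρ, hρ, hb⟩ := Metric.isOpen_iff.1 hD p hp
  filter_upwards [ball_mem_nhds p hρ] with z hz
  have := norm_sub_le_ball (hh.mono hb) (fun w hw => h0 w (hb hw)) hz
  rw [hp0, mul_zero] at this
  have h2 : 0 < ρ - ‖z - p‖ := by
    rw [mem_ball, dist_eq_norm] at hz; linarith
  have h3 : ‖h z - h p‖ ≤ 0 := by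
    by_contra! hcon
    nlinarith
  exact sub_eq_zero.1 (norm_le_zero_iff.1 h3)

end SchwarzPick

lemma eventually_cobounded_inf {s : Set ℂ} {P : ℂ → Prop} :
    (∀ᶠ z in cobounded ℂ ⊓ 𝓟 s, P z) ↔ ∃ K : ℝ, ∀ z ∈ s, K < ‖z‖ → P z := by
  rw [eventually_inf_principal, (hasBasis_cobounded_norm (E := ℂ)).eventually_iff]
  constructor
  · rintro ⟨K, -, h⟩
    exact ⟨K, fun z hz hK => h hK.le hz⟩
  · rintro ⟨K, h⟩
    refine ⟨K + 1, trivial, fun z hK hz => h z hz ?_⟩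
    have : K + 1 ≤ ‖z‖ := hK
    linarith

lemma SatisfiesH1.exists_bound {D : Set ℂ} {f : ℂ → ℂ} (h : SatisfiesH1 D f) :
    ∃ η : ℝ, 0 ≤ η ∧ HP η ⊆ D ∧ ∀ ε > (0 : ℝ), ∃ K : ℝ, ∀ z : ℂ, η < z.im → K < ‖z‖ →
      ‖f z - z‖ < ε := by
  obtain ⟨η, h0, hs, ht⟩ := h
  refine ⟨η, h0, hs, fun ε hε => ?_⟩
  obtain ⟨K, hK⟩ := eventually_cobounded_inf.1 (ht.eventually (ball_mem_nhds 0 hε))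
  exact ⟨K, fun z h1 h2 => mem_ball_zero_iff.1 (hK z h1 h2)⟩

lemma exists_high (η K : ℝ) : ∃ z : ℂ, η < z.im ∧ K < ‖z‖ := by
  refine ⟨((|η| + |K| + 1 : ℝ) : ℂ) * I, ?_, ?_⟩
  · simp only [mul_im, ofReal_re, I_im, ofReal_im, I_re]
    linarith [le_abs_self η, abs_nonneg K]
  · rw [norm_mul, norm_I, mul_one, Complex.norm_real, Real.norm_of_nonneg (by positivity)]
    linarith [le_abs_self K, abs_nonneg η]

lemma SatisfiesH1.far {D : Set ℂ} {f : ℂ → ℂ} (h : SatisfiesH1 D f) (K : ℝ) :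
    ∃ q ∈ D, K < ‖q‖ ∧ K < ‖f q‖ := by
  obtain ⟨η, h0, hs, ht⟩ := h.exists_bound
  obtain ⟨K', hK'⟩ := ht 1 one_pos
  obtain ⟨z, h1, h2⟩ := exists_high η (max (K + 1) K')
  have h3 := hK' z h1 ((le_max_right _ _).trans_lt h2)
  have h4 := (le_max_left (K + 1) K').trans_lt h2
  refine ⟨z, hs h1, by linarith, ?_⟩
  have := norm_sub_norm_le z (f z)
  rw [norm_sub_rev] at this
  linarith

/-- Univalent functions on a parallel slit half-plane, normalized at infinity, whose imaginary
part extends by constants to the slits. -/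
structure Reg (Δ : SD) (f : ℂ → ℂ) : Prop where
  holo : DifferentiableOn ℂ f Δ.dom
  inj : InjOn f Δ.dom
  pos : ∀ z ∈ Δ.dom, 0 < (f z).im
  h1 : SatisfiesH1 Δ.dom f
  lim : ∀ j, ∃ y : ℝ, Tendsto (fun ζ => (f ((Δ.S j).J ζ)).im) Lf (𝓝 y)

lemma SD.isChart {Δ : SD} {f : ℂ → ℂ} (hf : DifferentiableOn ℂ f Δ.dom) (hi : InjOn f Δ.dom)
    (h1 : SatisfiesH1 Δ.dom f) (j : Fin Δ.N) : IsChart (Δ.S j) f Δ.dom Δ.R where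
  hR := Δ.hR
  isOpen := Δ.isOpen_dom
  conn := Δ.isPreconnected_dom
  holo := hf
  inj := hi
  J_mem := fun _ hζ => SD.J_mem_dom hζ
  disj := SD.disjoint_carrier j
  far := h1.far

lemma Reg.isChart {Δ : SD} {f : ℂ → ℂ} (h : Reg Δ f) (j : Fin Δ.N) :
    IsChart (Δ.S j) f Δ.dom Δ.R := SD.isChart h.holo h.inj h.h1 j

lemma slitCluster_eq_iUnion (Δ : SD) (f : ℂ → ℂ) :
    slitCluster Δ.dom f = ⋃ j, (Δ.S j).cl f := by
  ext w
  rw [SD.mem_slitCluster, mem_iUnion]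
  rfl

lemma SD.exists_slit_bound (Δ : SD) : ∃ B : ℝ, ∀ j, ∀ z ∈ (Δ.S j).carrier, ‖z‖ ≤ B := by
  have : IsCompact (⋃ j, (Δ.S j).carrier) := isCompact_iUnion fun j => (Δ.S j).isCompact_carrier
  obtain ⟨B, hB⟩ := this.isBounded.subset_closedBall 0
  exact ⟨B, fun j z hz => mem_closedBall_zero_iff.1 (hB (mem_iUnion.2 ⟨j, hz⟩))⟩

lemma SD.tendsto_J_im (Δ : SD) (j : Fin Δ.N) :
    Tendsto (fun ζ => ((Δ.S j).J ζ).im) Lf (𝓝 (Δ.S j).y) := by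
  have h1 : Tendsto (Δ.S j).J Lf (𝓝ˢ (Δ.S j).carrier) := by
    have := (Δ.S j).map_J_Lf Δ.hR (fun z h1 h2 => SD.mem_dom_of_rho h1 h2.le)
      (SD.disjoint_carrier j)
    exact this.le.trans inf_le_left
  have h2 : Tendsto Complex.im (𝓝ˢ (Δ.S j).carrier) (𝓝 (Δ.S j).y) := by
    rw [tendsto_def]
    intro s hs
    rw [mem_nhdsSet_iff_forall]
    intro v hv
    exact Complex.continuous_im.continuousAt (by rw [hv.1]; exact hs)
  exact h2.comp h1

lemma SD.tendsto_slit {Δ : SD} {g : ℂ → ℝ} {j : Fin Δ.N} {y : ℝ}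
    (hg : Tendsto (fun ζ => g ((Δ.S j).J ζ)) Lf (𝓝 y)) :
    Tendsto g (𝓝ˢ (Δ.S j).carrier ⊓ 𝓟 Δ.dom) (𝓝 y) := by
  rw [← (Δ.S j).map_J_Lf Δ.hR (fun z h1 h2 => SD.mem_dom_of_rho h1 h2.le) (SD.disjoint_carrier j)]
  exact tendsto_map'_iff.2 hg

/-- A minimum principle: a holomorphic function with non-negative imaginary part, attaining the
value zero at a limit point inside the half-plane, has vanishing imaginary part. -/
lemma SD.im_eq_zero_of_seq {Δ : SD} {k : ℂ → ℂ} (hk : DifferentiableOn ℂ k Δ.dom)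
    (h0 : ∀ z ∈ Δ.dom, 0 ≤ (k z).im)
    (hl : ∀ j, ∃ y : ℝ, Tendsto (fun ζ => (k ((Δ.S j).J ζ)).im) Lf (𝓝 y))
    {u : ℕ → ℂ} (hu : ∀ n, u n ∈ Δ.dom) {z : ℂ} (hz : 0 < z.im) (huz : Tendsto u atTop (𝓝 z))
    (hku : Tendsto (fun n => (k (u n)).im) atTop (𝓝 0)) : ∀ w ∈ Δ.dom, (k w).im = 0 := by
  have key : ∃ p ∈ Δ.dom, (k p).im = 0 := by
    rcases Δ.mem_dom_or hz with hd | ⟨j, hj⟩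
    · refine ⟨z, hd, tendsto_nhds_unique ?_ hku⟩
      exact (Complex.continuous_im.continuousAt.comp
        (hk.differentiableAt (Δ.isOpen_dom.mem_nhds hd)).continuousAt).tendsto.comp huz
    · obtain ⟨y, hy⟩ := hl j
      have h2 : Tendsto u atTop (𝓝ˢ (Δ.S j).carrier ⊓ 𝓟 Δ.dom) :=
        tendsto_inf.2 ⟨huz.mono_right (nhds_le_nhdsSet hj),
          tendsto_principal.2 (Eventually.of_forall hu)⟩
      have h3 := (SD.tendsto_slit (g := fun z => (k z).im) hy).comp h2
      have hy0 : y = 0 := tendsto_nhds_unique h3 hku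
      obtain ⟨r, hr1, hr2⟩ := exists_between Δ.hR
      have hζ : (r : ℂ) ∈ Ann 1 Δ.R := by
        have : ‖(r : ℂ)‖ = r := by
          rw [Complex.norm_real, Real.norm_of_nonneg (by linarith)]
        exact ⟨by rw [this]; exact hr1, by rw [this]; exact hr2⟩
      refine ⟨_, J_mem_dom (j := j) hζ, ?_⟩
      rw [← hy0]
      refine im_eq_of_le ((Δ.S j).differentiableOn_comp_J Δ.isOpen_dom hk fun ζ hζ => J_mem_dom hζ)
        hy (fun ζ hζ => ?_) hζ
      rw [hy0]
      exact h0 _ (J_mem_dom hζ)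
  obtain ⟨p, hp, hp0⟩ := key
  intro w hw
  rw [eqOn_const_of_im_eq_zero Δ.isOpen_dom Δ.isPreconnected_dom hk h0 hp hp0 hw]
  exact hp0

namespace Reg

variable {Δ : SD} {f : ℂ → ℂ} (h : Reg Δ f)

include h

lemma im_le {z : ℂ} (hz : z ∈ Δ.dom) : z.im ≤ (f z).im := by
  obtain ⟨η, hη0, hηD, hη⟩ := h.h1.exists_bound
  set A : Set ℝ := (fun z : ℂ => z.im - (f z).im) '' Δ.dom with hA
  have hbdd : BddAbove A := by
    obtain ⟨K, hK⟩ := hη 1 one_pos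
    refine ⟨max 1 (max K (η + 1)), ?_⟩
    rintro _ ⟨z, hz, rfl⟩
    have hp := h.pos z hz
    change z.im - (f z).im ≤ _
    by_cases h1 : η < z.im
    · by_cases h2 : K < ‖z‖
      · refine le_max_of_le_left ?_
        have h3 := (Complex.abs_im_le_norm (f z - z)).trans (hK z h1 h2).le
        rw [sub_im, abs_le] at h3
        linarith
      · refine le_max_of_le_right (le_max_of_le_left ?_)
        have := (le_abs_self _).trans (Complex.abs_im_le_norm z)
        linarith
    · refine le_max_of_le_right (le_max_of_le_right ?_)
      linarith
  by_contra! hcon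
  set m : ℝ := sSup A with hm
  have hmpos : 0 < m := (sub_pos.2 hcon).trans_le (le_csSup hbdd ⟨z, hz, rfl⟩)
  have hle : ∀ w ∈ Δ.dom, w.im - (f w).im ≤ m := fun w hw => le_csSup hbdd ⟨w, hw, rfl⟩
  set k : ℂ → ℂ := fun w => f w - w + m * I with hkdef
  have hkim : ∀ w, (k w).im = (f w).im - w.im + m := fun w => by simp [hkdef]
  have hk : DifferentiableOn ℂ k Δ.dom := (h.holo.sub differentiableOn_id).add_const _
  have hk0 : ∀ w ∈ Δ.dom, 0 ≤ (k w).im := fun w hw => by rw [hkim]; linarith [hle w hw]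
  obtain ⟨B, hB⟩ := Δ.exists_slit_bound
  obtain ⟨K, hK⟩ := hη (m / 2) (by linarith)
  have hfar : ∀ w : ℂ, η < w.im → K < ‖w‖ → m / 2 ≤ (k w).im := by
    intro w hw1 hw2
    have h3 := (Complex.abs_im_le_norm (f w - w)).trans (hK w hw1 hw2).le
    rw [sub_im, abs_le] at h3
    rw [hkim]; linarith
  set Y : ℝ := η + m + 1 with hY
  have hYpos : 0 < Y := by linarith
  set q : ℝ := (Y - m / 2) / Y with hqdef
  have hq1 : q < 1 := by rw [hqdef, div_lt_one hYpos]; linarith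
  have hq0 : 0 ≤ q := div_nonneg (by linarith) hYpos.le
  have hband : ∀ w : ℂ, m / 2 ≤ w.im → w.im ≤ Y → max (B + 2 * Y) K < |w.re| →
      (1 - q ^ 2) / 16 * (m / 2) ≤ (k w).im := by
    intro w hw1 hw2 hw3
    set c : ℂ := ⟨w.re, Y⟩ with hc
    have hcn : |w.re| ≤ ‖c‖ := Complex.abs_re_le_norm c
    have hwc : ‖w - c‖ = Y - w.im := by
      have : w - c = ((w.im - Y : ℝ) : ℂ) * I := by apply Complex.ext <;> simp [hc]
      rw [this, norm_mul, norm_I, mul_one, Complex.norm_real, Real.norm_eq_abs, abs_of_nonpos]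
      · ring
      · linarith
    have hball : ball c Y ⊆ Δ.dom := by
      intro v hv
      rw [mem_ball, dist_eq_norm] at hv
      have h1 := (Complex.abs_im_le_norm (v - c)).trans_lt hv
      have h2 := (Complex.abs_re_le_norm (v - c)).trans_lt hv
      rw [sub_im, abs_lt] at h1
      have hcim : c.im = Y := rfl
      rcases Δ.mem_dom_or (z := v) (by linarith [h1.1]) with h3 | ⟨j, hj⟩
      · exact h3
      · exfalso
        have h4 := (Complex.abs_re_le_norm v).trans (hB j v hj)
        have h5 : |c.re| ≤ |v.re| + |v.re - c.re| := by
          have := abs_sub_abs_le_abs_sub c.re v.re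
          rw [abs_sub_comm] at this; linarith
        rw [sub_re] at h2
        have h6 : c.re = w.re := rfl
        rw [h6] at h5 h2
        have := (le_max_left (B + 2 * Y) K).trans_lt hw3
        linarith
    have hwb : w ∈ ball c Y := by rw [mem_ball, dist_eq_norm, hwc]; linarith
    have h1 := im_lower_ball (hk.mono hball) (fun v hv => hk0 v (hball hv)) hwb hq1.le (by
      rw [hwc, hqdef, div_mul_cancel₀ _ hYpos.ne']; linarith)
    refine le_trans ?_ h1
    have h2 : m / 2 ≤ (k c).im := hfar c (by change η < Y; linarith)
      (((le_max_right _ _).trans_lt hw3).trans_le hcn)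
    have : 0 ≤ (1 - q ^ 2) / 16 := by
      have := pow_le_one₀ (n := 2) hq0 hq1.le
      linarith
    gcongr
  set ε : ℝ := min (m / 2) ((1 - q ^ 2) / 16 * (m / 2)) with hε
  have hεpos : 0 < ε := by
    have : q ^ 2 < 1 := pow_lt_one₀ hq0 hq1 (by norm_num)
    exact lt_min (by linarith) (mul_pos (by linarith) (by linarith))
  obtain ⟨X, hX⟩ : ∃ X : ℝ, ∀ w ∈ Δ.dom, (k w).im < ε → m / 2 ≤ w.im ∧ ‖w‖ ≤ X := by
    refine ⟨max K (max (B + 2 * Y) K + Y), fun w hw hwε => ?_⟩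
    have h1 : m / 2 ≤ w.im := by
      have := hwε.trans_le (min_le_left _ _)
      rw [hkim] at this
      linarith [h.pos w hw]
    refine ⟨h1, ?_⟩
    by_contra! hcon
    by_cases h2 : η < w.im
    · exact absurd (hwε.trans_le (min_le_left _ _))
        (hfar w h2 ((le_max_left _ _).trans_lt hcon)).not_gt
    · have h3 := (le_max_right K (max (B + 2 * Y) K + Y)).trans_lt hcon
      have h4 := Complex.norm_le_abs_re_add_abs_im w
      have h5 : |w.im| ≤ Y := by rw [abs_of_nonneg (by linarith)]; linarith
      exact absurd (hwε.trans_le (min_le_right _ _)) (hband w h1 (by linarith) (by linarith)).not_gt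
  have hseq : ∀ n : ℕ, ∃ w ∈ Δ.dom, (k w).im < min ε (1 / (n + 1)) := by
    intro n
    have : m - min ε (1 / ((n : ℝ) + 1)) < m := by
      have : 0 < min ε (1 / ((n : ℝ) + 1)) := lt_min hεpos (by positivity)
      linarith
    obtain ⟨_, ⟨w, hw, rfl⟩, hlt⟩ := exists_lt_of_lt_csSup (s := A) ⟨_, z, hz, rfl⟩ this
    refine ⟨w, hw, ?_⟩
    change _ < w.im - (f w).im at hlt
    rw [hkim]; linarith
  choose u hu hku using hseq
  have hK' : IsCompact ({w : ℂ | m / 2 ≤ w.im} ∩ closedBall 0 X) :=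
    (isCompact_closedBall 0 X).inter_left (isClosed_le continuous_const Complex.continuous_im)
  obtain ⟨p, hp, σ, hσ, hlim⟩ := hK'.tendsto_subseq (x := u) fun n =>
    ⟨(hX _ (hu n) ((hku n).trans_le (min_le_left _ _))).1,
      mem_closedBall_zero_iff.2 (hX _ (hu n) ((hku n).trans_le (min_le_left _ _))).2⟩
  have hzero := SD.im_eq_zero_of_seq hk hk0 (fun j => by
      obtain ⟨y, hy⟩ := h.lim j
      refine ⟨y - (Δ.S j).y + m, ?_⟩
      simp only [hkim]
      exact (hy.sub (Δ.tendsto_J_im j)).add_const m)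
    (u := u ∘ σ) (fun n => hu _) (lt_of_lt_of_le (by linarith) hp.1) hlim (by
      refine squeeze_zero (fun n => hk0 _ (hu _)) (fun n => ?_)
        (tendsto_one_div_add_atTop_nhds_zero_nat.comp hσ.tendsto_atTop)
      exact (hku (σ n)).le.trans (min_le_right _ _))
  obtain ⟨w, hw1, hw2⟩ := exists_high η K
  have := hfar w hw1 hw2
  rw [hzero w (hηD hw1)] at this
  linarith

end Reg

lemma IsChart.exists_mem_cl_of_map {S : Slit} {f : ℂ → ℂ} {Ω : Set ℂ} {R : ℝ}
    (h : IsChart S f Ω R) {g : ℂ → ℝ} (hg : Continuous g) {w₁ w₂ : ℂ} (hw₁ : w₁ ∈ S.cl f)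
    (hw₂ : w₂ ∈ S.cl f) {x : ℝ} (h1 : g w₁ < x) (h2 : x < g w₂) : ∃ w ∈ S.cl f, g w = x := by
  have hfr : ∃ᶠ ζ in Lf, f (S.J ζ) ∈ {w : ℂ | g w = x} := by
    rw [Filter.Frequently, eventually_Lf]
    rintro ⟨r, hr, hcon⟩
    have hr' : 1 < min r R := lt_min hr h.hR
    have hA : IsPreconnected ((fun ζ => g (f (S.J ζ))) '' Ann 1 (min r R)) := by
      refine (isPreconnected_Ann zero_le_one).image _ ?_
      refine hg.comp_continuousOn (h.holo_comp.continuousOn.mono fun ζ hζ => ?_)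
      exact ⟨hζ.1, hζ.2.trans_le (min_le_right _ _)⟩
    obtain ⟨a, ha, ha'⟩ := ((mapClusterPt_iff_frequently.1 hw₁) _
      ((isOpen_lt hg continuous_const).mem_nhds h1)).and_eventually (Ann_mem_Lf hr') |>.exists
    obtain ⟨b, hb, hb'⟩ := ((mapClusterPt_iff_frequently.1 hw₂) _
      ((isOpen_lt continuous_const hg).mem_nhds h2)).and_eventually (Ann_mem_Lf hr') |>.exists
    obtain ⟨ζ, hζ, e⟩ := hA.ordConnected.out ⟨a, ha', rfl⟩ ⟨b, hb', rfl⟩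
      ⟨le_of_lt ha, le_of_lt hb⟩
    exact hcon ζ hζ.1 (hζ.2.trans_le (min_le_left _ _)) e
  obtain ⟨w, hw, hc⟩ := h.exists_mem_cl_of_frequently (isClosed_eq hg continuous_const) hfr
  exact ⟨w, hc, hw⟩

lemma Slit.im_of_mem_cl {S : Slit} {f : ℂ → ℂ} {y : ℝ}
    (hy : Tendsto (fun ζ => (f (S.J ζ)).im) Lf (𝓝 y)) {w : ℂ} (hw : w ∈ S.cl f) : w.im = y := by
  by_contra hne
  obtain ⟨U, V, hU, hV, hwU, hyV, hd⟩ := t2_separation hne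
  obtain ⟨ζ, h1, h2⟩ := ((mapClusterPt_iff_frequently.1 hw) _
    ((hU.preimage Complex.continuous_im).mem_nhds hwU)).and_eventually
    (hy.eventually (hV.mem_nhds hyV)) |>.exists
  exact hd.le_bot ⟨h1, h2⟩

/-- If the imaginary part has a limit along a slit then the cluster set is a horizontal slit. -/
lemma IsChart.exists_slit {S : Slit} {f : ℂ → ℂ} {Ω : Set ℂ} {R : ℝ} (h : IsChart S f Ω R) {y : ℝ}
    (hy : Tendsto (fun ζ => (f (S.J ζ)).im) Lf (𝓝 y)) (hpos : 0 < y) :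
    ∃ S' : Slit, S'.carrier = S.cl f ∧ S'.y = y := by
  have hK : IsCompact (Complex.re '' S.cl f) := h.isCompact_cl.image Complex.continuous_re
  have hne : (Complex.re '' S.cl f).Nonempty := h.nonempty_cl.image _
  obtain ⟨w₁, hw₁, e₁⟩ := hK.sInf_mem hne
  obtain ⟨w₂, hw₂, e₂⟩ := hK.sSup_mem hne
  have hle : ∀ w ∈ S.cl f, w₁.re ≤ w.re ∧ w.re ≤ w₂.re := fun w hw =>
    ⟨e₁ ▸ csInf_le hK.bddBelow ⟨w, hw, rfl⟩, e₂ ▸ le_csSup hK.bddAbove ⟨w, hw, rfl⟩⟩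
  have heq : ∀ w, w.im = y → ∀ w' ∈ S.cl f, w'.re = w.re → w ∈ S.cl f := by
    intro w hw w' hw' e
    have : w = w' := Complex.ext e.symm (by rw [hw, Slit.im_of_mem_cl hy hw'])
    rwa [this]
  have hlt : w₁.re < w₂.re := by
    by_contra! hcon
    have hsub : ∀ w ∈ S.cl f, w = w₁ := by
      intro w hw
      apply Complex.ext
      · linarith [(hle w hw).1, (hle w hw).2]
      · rw [Slit.im_of_mem_cl hy hw, Slit.im_of_mem_cl hy hw₁]
    have ht : Tendsto (f ∘ S.J) Lf (𝓝 w₁) := by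
      rw [_root_.tendsto_nhds]
      intro V hV hV1
      exact h.eventually_mem_of_cl_subset hV fun w hw => by rw [hsub w hw]; exact hV1
    obtain ⟨r, hr1, hr2⟩ := exists_between h.hR
    have hn : ‖(r : ℂ)‖ = r := by rw [Complex.norm_real, Real.norm_of_nonneg (by linarith)]
    have ha : (r : ℂ) ∈ Ann 1 R := ⟨by rw [hn]; exact hr1, by rw [hn]; exact hr2⟩
    have hb : -(r : ℂ) ∈ Ann 1 R :=
      ⟨by rw [norm_neg, hn]; exact hr1, by rw [norm_neg, hn]; exact hr2⟩
    have e : f (S.J r) = f (S.J (-r)) :=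
      (eq_const_of_tendsto h.holo_comp ht ha).trans (eq_const_of_tendsto h.holo_comp ht hb).symm
    have e2 := S.J_inj ha.1 hb.1.le (h.inj (h.J_mem _ ha) (h.J_mem _ hb) e)
    have e3 : (r : ℂ) = 0 := by linear_combination e2 / 2
    rw [e3, norm_zero] at hn
    linarith
  refine ⟨⟨y, w₁.re, w₂.re, hpos, hlt⟩, ?_, rfl⟩
  ext w
  constructor
  · rintro ⟨h1, h2, h3⟩
    change w.im = y at h1
    change w₁.re ≤ w.re at h2
    change w.re ≤ w₂.re at h3
    rcases h2.eq_or_lt with h2 | h2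
    · exact heq w h1 w₁ hw₁ h2
    rcases h3.eq_or_lt with h3 | h3
    · exact heq w h1 w₂ hw₂ h3.symm
    obtain ⟨w', hw', e⟩ := h.exists_mem_cl_of_map Complex.continuous_re hw₁ hw₂ h2 h3
    exact heq w h1 w' hw' e
  · intro hw
    exact ⟨Slit.im_of_mem_cl hy hw, hle w hw⟩

lemma Slit.convex_carrier (S : Slit) : Convex ℝ S.carrier := by
  have : S.carrier = Complex.im ⁻¹' {S.y} ∩ Complex.re ⁻¹' Icc S.xl S.xr := by
    ext z; rfl
  rw [this]
  exact ((convex_singleton S.y).linear_preimage Complex.imLm).inter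
    ((convex_Icc S.xl S.xr).linear_preimage Complex.reLm)

namespace Reg

variable {Δ : SD} {f : ℂ → ℂ} (h : Reg Δ f)

include h

lemma exists_slit (j : Fin Δ.N) : ∃ S' : Slit, S'.carrier = (Δ.S j).cl f ∧
    Tendsto (fun ζ => (f ((Δ.S j).J ζ)).im) Lf (𝓝 S'.y) := by
  obtain ⟨y, hy⟩ := h.lim j
  have hpos : 0 < y := by
    refine (Δ.S j).hy.trans_le (le_of_tendsto_of_tendsto (Δ.tendsto_J_im j) hy ?_)
    filter_upwards [Ann_mem_Lf Δ.hR] with ζ hζ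
    exact h.im_le (SD.J_mem_dom hζ)
  obtain ⟨S', h1, rfl⟩ := (h.isChart j).exists_slit hy hpos
  exact ⟨S', h1, hy⟩

lemma convex_cl (j : Fin Δ.N) : Convex ℝ ((Δ.S j).cl f) := by
  obtain ⟨S', h1, -⟩ := h.exists_slit j
  rw [← h1]; exact S'.convex_carrier

lemma cl_subset_UHP (j : Fin Δ.N) : (Δ.S j).cl f ⊆ UHP := by
  obtain ⟨S', h1, -⟩ := h.exists_slit j
  rw [← h1]; exact S'.carrier_subset_UHP

lemma disjoint_cl {i j : Fin Δ.N} (hij : i ≠ j) : Disjoint ((Δ.S i).cl f) ((Δ.S j).cl f) := by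
  rw [Set.disjoint_left]
  intro w hi hj
  obtain ⟨r, hr1, hr2⟩ := exists_between Δ.hR
  have hn := ((h.isChart j).isOpen_fill (h.convex_cl j) hr1 hr2).mem_nhds (Or.inr hj)
  obtain ⟨ζ, hζ, hA⟩ := ((mapClusterPt_iff_frequently.1 hi) _ hn).and_eventually
    (Ann_mem_Lf Δ.hR) |>.exists
  have hd := SD.J_mem_dom (j := i) hA
  rcases hζ with ⟨q, ⟨hq, hqr⟩, e⟩ | hζ
  · have e2 := h.inj hq hd e
    rw [e2] at hqr
    exact hij (Δ.disj i j _ (by rw [(Δ.S i).rho_J hA.1.le]; exact hA.2.le) (hqr.le.trans hr2.le))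
  · exact (h.isChart j).notMem_image_of_mem_cl hζ ⟨_, hd, rfl⟩

lemma slitCluster_subset_UHP : slitCluster Δ.dom f ⊆ UHP := by
  rw [slitCluster_eq_iUnion]
  exact iUnion_subset h.cl_subset_UHP

lemma notMem_slitCluster {z : ℂ} (hz : z ∈ Δ.dom) : f z ∉ slitCluster Δ.dom f := by
  rw [slitCluster_eq_iUnion]
  intro hc
  obtain ⟨j, hj⟩ := mem_iUnion.1 hc
  exact (h.isChart j).notMem_image_of_mem_cl hj ⟨z, hz, rfl⟩

lemma mapsTo_codom : MapsTo f Δ.dom (UHP \ slitCluster Δ.dom f) := fun z hz =>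
  ⟨h.pos z hz, h.notMem_slitCluster hz⟩

lemma isParallelSlitHalfPlane : IsParallelSlitHalfPlane (UHP \ slitCluster Δ.dom f) := by
  refine ⟨Δ.N, fun j => (Δ.S j).cl f, fun j => ?_, fun i j hij => h.disjoint_cl hij, ?_⟩
  · obtain ⟨S', h1, -⟩ := h.exists_slit j
    exact ⟨S'.y, S'.xl, S'.xr, S'.hy, S'.hx, h1.symm⟩
  · rw [slitCluster_eq_iUnion]

lemma isOpen_fill : IsOpen (f '' Δ.dom ∪ slitCluster Δ.dom f) := by
  obtain ⟨r, hr1, hr2⟩ := exists_between Δ.hR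
  rw [isOpen_iff_mem_nhds]
  rintro w (hw | hw)
  · exact mem_of_superset ((isOpen_image_of_injOn Δ.isOpen_dom h.holo h.inj Δ.isOpen_dom
      subset_rfl).mem_nhds hw) subset_union_left
  · rw [slitCluster_eq_iUnion] at hw ⊢
    obtain ⟨j, hj⟩ := mem_iUnion.1 hw
    refine mem_of_superset (((h.isChart j).isOpen_fill (h.convex_cl j) hr1 hr2).mem_nhds
      (Or.inr hj)) (union_subset_union (image_mono (sep_subset _ _)) ?_)
    exact subset_iUnion (fun j => (Δ.S j).cl f) j

lemma isPreconnected_fill : IsPreconnected (f '' Δ.dom ∪ slitCluster Δ.dom f) := by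
  refine (Δ.isPreconnected_dom.image f h.holo.continuousOn).subset_closure subset_union_left
    (union_subset subset_closure fun w hw => ?_)
  rw [slitCluster_eq_iUnion] at hw
  obtain ⟨j, hj⟩ := mem_iUnion.1 hw
  rw [mem_closure_iff_frequently]
  rw [frequently_iff]
  intro V hV
  obtain ⟨ζ, hζ, hA⟩ := ((mapClusterPt_iff_frequently.1 hj) _ hV).and_eventually
    (Ann_mem_Lf Δ.hR) |>.exists
  exact ⟨_, hζ, _, SD.J_mem_dom hA, rfl⟩

lemma fill_subset_UHP : f '' Δ.dom ∪ slitCluster Δ.dom f ⊆ UHP := by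
  refine union_subset ?_ h.slitCluster_subset_UHP
  rintro _ ⟨z, hz, rfl⟩
  exact h.pos z hz

end Reg

section Inverse

variable {f : ℂ → ℂ} {Ω : Set ℂ}

lemma continuousAt_invFunOn (hΩ : IsOpen Ω) (hf : DifferentiableOn ℂ f Ω) (hi : InjOn f Ω) {q : ℂ}
    (hq : q ∈ Ω) : ContinuousAt (Function.invFunOn f Ω) (f q) := by
  change map _ _ ≤ _
  rw [hi.leftInvOn_invFunOn hq, ← map_nhds_of_injOn hΩ hf hi hq, map_map]
  refine le_of_eq ?_
  conv_rhs => rw [← map_id (f := 𝓝 q)]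
  refine Filter.map_congr ?_
  filter_upwards [hΩ.mem_nhds hq] with z hz
  exact hi.leftInvOn_invFunOn hz

lemma eventually_deriv_ne_zero (hΩ : IsOpen Ω) (hf : DifferentiableOn ℂ f Ω) (hi : InjOn f Ω)
    {q : ℂ} (hq : q ∈ Ω) : ∀ᶠ z in 𝓝[≠] q, deriv f z ≠ 0 := by
  refine ((((hf.deriv hΩ).analyticAt (hΩ.mem_nhds hq))).eventually_eq_zero_or_eventually_ne_zero
    ).resolve_left fun hcon => ?_
  obtain ⟨ε, hε, hb⟩ := Metric.eventually_nhds_iff_ball.1 (hcon.and (hΩ.mem_nhds hq))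
  have hx : q + (ε / 2 : ℝ) ∈ ball q ε := by
    rw [mem_ball, dist_eq_norm, add_sub_cancel_left, Complex.norm_real,
      Real.norm_of_nonneg (by positivity)]
    linarith
  have := (convex_ball q ε).is_const_of_fderivWithin_eq_zero (𝕜 := ℂ) (f := f)
    (fun z hz => (hf.mono fun z hz => (hb z hz).2) z hz) (fun z hz => by
      rw [fderivWithin_of_isOpen isOpen_ball hz]
      ext; simp [(hb z hz).1]) (mem_ball_self hε) hx
  have h4 := hi hq (hb _ hx).2 this
  have : ((ε / 2 : ℝ) : ℂ) = 0 := by linear_combination -h4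
  rw [ofReal_eq_zero] at this
  linarith

lemma differentiableOn_invFunOn (hΩ : IsOpen Ω) (hf : DifferentiableOn ℂ f Ω) (hi : InjOn f Ω) :
    DifferentiableOn ℂ (Function.invFunOn f Ω) (f '' Ω) := by
  rintro _ ⟨q, hq, rfl⟩
  have hV := (eventually_nhdsWithin_iff.1 (eventually_deriv_ne_zero hΩ hf hi hq)).and
    (hΩ.mem_nhds hq)
  obtain ⟨ε, hε, hb⟩ := Metric.eventually_nhds_iff_ball.1 hV
  have hs : f '' ball q ε ∈ 𝓝 (f q) := by
    rw [← map_nhds_of_injOn hΩ hf hi hq]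
    exact image_mem_map (ball_mem_nhds q hε)
  refine ((Complex.differentiableOn_compl_singleton_and_continuousAt_iff hs).1
    ⟨?_, continuousAt_invFunOn hΩ hf hi hq⟩).differentiableAt hs |>.differentiableWithinAt
  rintro _ ⟨⟨z, hz, rfl⟩, hne⟩
  obtain ⟨hd, hzΩ⟩ := hb z hz
  have hzq : z ≠ q := fun e => hne (by rw [e]; rfl)
  have e := hi.leftInvOn_invFunOn hzΩ
  refine (HasDerivAt.of_local_left_inverse (f := f) (f' := deriv f z)
    (continuousAt_invFunOn hΩ hf hi hzΩ) ?_ (hd hzq) ?_).differentiableAt.differentiableWithinAt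
  · rw [e]
    exact (hf.differentiableAt (hΩ.mem_nhds hzΩ)).hasDerivAt
  · rw [← map_nhds_of_injOn hΩ hf hi hzΩ, eventually_map]
    filter_upwards [hΩ.mem_nhds hzΩ] with w hw
    rw [hi.leftInvOn_invFunOn hw]

end Inverse

lemma IsHHull.isOpen_compl {F : Set ℂ} (hF : IsHHull F) : IsOpen (UHP \ F) := by
  have : UHP \ F = UHP \ closure F := by
    ext z
    exact ⟨fun h => ⟨h.1, fun hc => h.2 (hF.2.1 ⟨hc, h.1⟩)⟩, fun h => ⟨h.1, fun hc =>
      h.2 (subset_closure hc)⟩⟩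
  rw [this]
  exact isOpen_UHP.sdiff isClosed_closure

/-- A normalized univalent map between parallel slit half-planes whose omitted set is a hull. -/
structure IsSlitMap (Δ Δ' : SD) (f : ℂ → ℂ) : Prop where
  holo : DifferentiableOn ℂ f Δ.dom
  inj : InjOn f Δ.dom
  mapsTo : MapsTo f Δ.dom Δ'.dom
  h1 : SatisfiesH1 Δ.dom f
  h3 : IsHHull (Δ'.dom \ f '' Δ.dom)

namespace IsSlitMap

variable {Δ Δ' : SD} {f : ℂ → ℂ} (h : IsSlitMap Δ Δ' f)

include h

lemma isChart (j : Fin Δ.N) : IsChart (Δ.S j) f Δ.dom Δ.R := SD.isChart h.holo h.inj h.h1 j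

lemma mem_of_mem_cl {j : Fin Δ.N} {w : ℂ} (hw : w ∈ (Δ.S j).cl f) : w ∈ UHP \ Δ'.dom := by
  have hn := (h.isChart j).notMem_image_of_mem_cl hw
  by_contra hcon
  obtain ⟨r, hr1, hr2⟩ := exists_between Δ.hR
  have e := (h.isChart j).wind_of_mem_cl hw hr1 hr2
  rw [wind_zero_of_simplyConnected (h.isChart j).holo_comp hr1 hr2 (U := UHP \ (Δ'.dom \ f '' Δ.dom))
    h.h3.2.2.2 h.h3.isOpen_compl] at e
  · exact Complex.two_pi_I_ne_zero e.symm
  · rintro ⟨h1, h2⟩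
    exact hcon ⟨h1, fun hd => h2 ⟨hd, hn⟩⟩
  · intro ζ hζ
    have hd := SD.J_mem_dom (j := j) (mem_Ann_of_sphere hr1 hr2 hζ)
    exact ⟨(h.mapsTo hd).1, fun hc => hc.2 ⟨_, hd, rfl⟩⟩

lemma reg : Reg Δ f where
  holo := h.holo
  inj := h.inj
  pos := fun z hz => (h.mapsTo hz).1
  h1 := h.h1
  lim := by
    intro j
    have hfin : (Complex.im '' (Δ.S j).cl f).Finite := by
      refine (Set.finite_range fun k => (Δ'.S k).y).subset ?_
      rintro _ ⟨w, hw, rfl⟩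
      have := h.mem_of_mem_cl hw
      rw [SD.UHP_diff_dom] at this
      obtain ⟨k, hk⟩ := mem_iUnion.1 this
      exact ⟨k, hk.1.symm⟩
    have key : ∀ w₁ ∈ (Δ.S j).cl f, ∀ w₂ ∈ (Δ.S j).cl f, ¬ w₁.im < w₂.im := by
      intro w₁ hw₁ w₂ hw₂ hlt
      refine (Ioo_infinite hlt) (hfin.subset fun x hx => ?_)
      obtain ⟨w, hw, e⟩ := (h.isChart j).exists_mem_cl_of_map Complex.continuous_im hw₁ hw₂ hx.1 hx.2
      exact ⟨w, hw, e⟩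
    obtain ⟨w₀, hw₀⟩ := (h.isChart j).nonempty_cl
    refine ⟨w₀.im, ?_⟩
    rw [_root_.tendsto_nhds]
    intro V hV hV0
    refine (h.isChart j).eventually_mem_of_cl_subset (hV.preimage Complex.continuous_im) fun w hw => ?_
    have : w.im = w₀.im := le_antisymm (not_lt.1 (key _ hw₀ _ hw)) (not_lt.1 (key _ hw _ hw₀))
    change w.im ∈ V
    rwa [this]

lemma slitCluster_subset : slitCluster Δ.dom f ⊆ UHP \ Δ'.dom := by
  rw [slitCluster_eq_iUnion]
  exact iUnion_subset fun j w hw => h.mem_of_mem_cl hw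

lemma isCompact_slitCluster : IsCompact (slitCluster Δ.dom f) := by
  rw [slitCluster_eq_iUnion]
  exact isCompact_iUnion fun j => (h.isChart j).isCompact_cl

lemma carrier_inter (k : Fin Δ'.N) : ((Δ'.S k).carrier ∩ slitCluster Δ.dom f).Nonempty := by
  by_contra hempty
  rw [not_nonempty_iff_eq_empty, ← disjoint_iff_inter_eq_empty] at hempty
  set F := Δ'.dom \ f '' Δ.dom with hF
  have hsub : (Δ'.S k).carrier ⊆ UHP \ F := fun z hz =>
    ⟨(Δ'.S k).carrier_subset_UHP hz, fun hc => (SD.disjoint_carrier k).le_bot ⟨hc.1, hz⟩⟩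
  obtain ⟨R₁, hR₁, hs₁⟩ := (Δ'.S k).exists_rho_subset h.h3.isOpen_compl hsub
  set R' := min R₁ Δ'.R
  have hR' : 1 < R' := lt_min hR₁ Δ'.hR
  set g := Function.invFunOn f Δ.dom
  have hgf : ∀ z ∈ Δ.dom, g (f z) = z := fun z hz => h.inj.leftInvOn_invFunOn hz
  have hJ : ∀ ζ ∈ Ann 1 R', (Δ'.S k).J ζ ∈ f '' Δ.dom := by
    intro ζ hζ
    have e := (Δ'.S k).rho_J hζ.1.le
    have h1 : (Δ'.S k).J ζ ∈ Δ'.dom := SD.J_mem_dom ⟨hζ.1, hζ.2.trans_le (min_le_right _ _)⟩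
    have h2 := hs₁ (show (Δ'.S k).rho _ ≤ R₁ by rw [e]; exact hζ.2.le.trans (min_le_left _ _))
    by_contra hcon
    exact h2.2 ⟨h1, hcon⟩
  have hch : IsChart (Δ'.S k) g (f '' Δ.dom) R' := by
    refine ⟨hR', isOpen_image_of_injOn Δ.isOpen_dom h.holo h.inj Δ.isOpen_dom subset_rfl,
      Δ.isPreconnected_dom.image f h.holo.continuousOn,
      differentiableOn_invFunOn Δ.isOpen_dom h.holo h.inj, ?_, hJ, ?_, ?_⟩
    · rintro _ ⟨z, hz, rfl⟩ _ ⟨w, hw, rfl⟩ e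
      rw [hgf z hz, hgf w hw] at e
      rw [e]
    · exact (SD.disjoint_carrier k).mono_left h.mapsTo.image_subset
    · intro K
      obtain ⟨q, hq, h1, h2⟩ := h.h1.far K
      exact ⟨f q, ⟨q, hq, rfl⟩, h2, by rw [hgf q hq]; exact h1⟩
  have himg : g '' (f '' Δ.dom) = Δ.dom := h.inj.leftInvOn_invFunOn.image_image
  have hgm : ∀ ζ ∈ Ann 1 R', g ((Δ'.S k).J ζ) ∈ Δ.dom := fun ζ hζ =>
    himg ▸ mem_image_of_mem g (hJ ζ hζ)
  have hfg : ∀ ζ ∈ Ann 1 R', f (g ((Δ'.S k).J ζ)) = (Δ'.S k).J ζ := fun ζ hζ =>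
    Function.invFunOn_eq (hJ ζ hζ)
  obtain ⟨p, hp⟩ := hch.nonempty_cl
  have hpd : p ∉ Δ.dom := himg ▸ hch.notMem_image_of_mem_cl hp
  obtain ⟨r, hr1, hr2⟩ := exists_between hR'
  have hpw := hch.wind_of_mem_cl hp hr1 hr2
  have hpos : 0 < p.im := by
    by_contra! hle
    rw [wind_zero_of_half_plane hch.holo_comp hr1 hr2 (-I)] at hpw
    · exact Complex.two_pi_I_ne_zero hpw.symm
    · intro ζ hζ
      have : 0 < (g ((Δ'.S k).J ζ)).im := (hgm ζ (mem_Ann_of_sphere hr1 hr2 hζ)).1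
      simp only [Function.comp, neg_mul, neg_re, I_mul_re, neg_neg, sub_im]
      linarith
  obtain ⟨j, hj⟩ := (Δ.mem_dom_or hpos).resolve_left hpd
  have hdis : Disjoint ((Δ.S j).cl f) (Δ'.S k).carrier := by
    refine (hempty.mono_right ?_).symm
    rw [slitCluster_eq_iUnion]
    exact subset_iUnion (fun j => (Δ.S j).cl f) j
  obtain ⟨V₁, V₂, hV₁, hV₂, hs1, hs2, hd⟩ :=
    SeparatedNhds.of_isCompact_isCompact (h.isChart j).isCompact_cl (Δ'.S k).isCompact_carrier hdis
  have hev : f ⁻¹' V₁ ∈ map (Δ.S j).J Lf := (h.isChart j).eventually_mem_of_cl_subset hV₁ hs1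
  rw [(Δ.S j).map_J_Lf Δ.hR (fun z h1 h2 => SD.mem_dom_of_rho h1 h2.le) (SD.disjoint_carrier j),
    mem_inf_principal, mem_nhdsSet_iff_forall] at hev
  have hev2 : ∀ᶠ ζ in Lf, (Δ'.S k).J ζ ∈ V₂ := by
    have := (Δ'.S k).map_J_Lf Δ'.hR (fun z h1 h2 => SD.mem_dom_of_rho h1 h2.le)
      (SD.disjoint_carrier k)
    have h2 : V₂ ∈ map (Δ'.S k).J Lf := by
      rw [this]
      exact mem_inf_of_left (hV₂.mem_nhdsSet.2 hs2)
    exact h2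
  obtain ⟨ζ, h1, h2, h3⟩ := ((mapClusterPt_iff_frequently.1 hp) _ (hev p hj)).and_eventually
    (hev2.and (Ann_mem_Lf hR')) |>.exists
  have h4 : f (g ((Δ'.S k).J ζ)) ∈ V₁ := h1 (hgm ζ h3)
  rw [hfg ζ h3] at h4
  exact hd.le_bot ⟨h4, h2⟩

lemma slitCluster_eq : slitCluster Δ.dom f = UHP \ Δ'.dom := by
  refine h.slitCluster_subset.antisymm ?_
  rw [SD.UHP_diff_dom]
  refine iUnion_subset fun k => ?_
  have hU := h.reg.isOpen_fill
  have hcon := (isPreconnected_iff_subset_of_disjoint.1 (Δ'.S k).convex_carrier.isPreconnected)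
    _ _ hU h.isCompact_slitCluster.isClosed.isOpen_compl (by
      intro z _
      by_cases hz : z ∈ slitCluster Δ.dom f
      · exact Or.inl (Or.inr hz)
      · exact Or.inr hz) (by
      rw [eq_empty_iff_forall_notMem]
      rintro z ⟨hz, h1 | h1, h2⟩
      · obtain ⟨w, hw, rfl⟩ := h1
        exact (SD.disjoint_carrier k).le_bot ⟨h.mapsTo hw, hz⟩
      · exact h2 h1)
  rcases hcon with h1 | h1
  · intro z hz
    rcases h1 hz with ⟨w, hw, rfl⟩ | h2
    · exact ((SD.disjoint_carrier k).le_bot ⟨h.mapsTo hw, hz⟩).elim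
    · exact h2
  · obtain ⟨z, hz, hz'⟩ := h.carrier_inter k
    exact (h1 hz hz').elim

end IsSlitMap

lemma Reg.map_slitFilter {Δ : SD} {f : ℂ → ℂ} (h : Reg Δ f) :
    map f (slitFilter Δ.dom) = slitFilter (UHP \ slitCluster Δ.dom f) := by
  have e : UHP \ (UHP \ slitCluster Δ.dom f) = ⋃ j, (Δ.S j).cl f := by
    rw [sdiff_sdiff_right_self, ← slitCluster_eq_iUnion]
    exact inter_eq_right.2 h.slitCluster_subset_UHP
  refine le_antisymm ?_ ?_
  · unfold slitFilter
    rw [e]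
    refine le_inf ?_ ?_
    · change Tendsto f (slitFilter Δ.dom) _
      rw [Δ.slitFilter_eq, tendsto_iSup]
      intro j
      rw [tendsto_map'_iff]
      refine (hasBasis_nhdsSet _).tendsto_right_iff.2 ?_
      rintro V ⟨hV, hs⟩
      exact (h.isChart j).eventually_mem_of_cl_subset hV ((subset_iUnion (fun j => (Δ.S j).cl f) j).trans hs)
    · rw [le_principal_iff]
      exact mem_inf_of_right h.mapsTo_codom
  · intro s hs
    rw [Δ.slitFilter_eq, map_iSup] at hs
    have hs' : ∀ j, ∀ᶠ ζ in Lf, f ((Δ.S j).J ζ) ∈ s := fun j => (mem_iSup.1 hs) j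
    unfold slitFilter
    rw [e, mem_inf_principal, mem_nhdsSet_iff_forall]
    intro w hw
    obtain ⟨j, hj⟩ := mem_iUnion.1 hw
    obtain ⟨r, hr, hrs⟩ := eventually_Lf.1 (hs' j)
    obtain ⟨r', hr1, hr2⟩ := exists_between (lt_min hr Δ.hR)
    filter_upwards [((h.isChart j).isOpen_fill (h.convex_cl j) hr1
      (hr2.trans_le (min_le_right _ _))).mem_nhds (Or.inr hj)] with v hv hvE
    rcases hv with ⟨q, ⟨hq, hqr⟩, rfl⟩ | hv
    · obtain ⟨ζ, hζ, rfl⟩ := (Δ.S j).exists_J' q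
      refine hrs ζ ?_ ?_
      · rw [hζ, Slit.one_lt_rho_iff]
        exact fun hc => (SD.disjoint_carrier j).le_bot ⟨hq, hc⟩
      · rw [hζ]; exact (hqr.trans hr2).trans_le (min_le_left _ _)
    · exfalso
      refine hvE.2 ?_
      rw [slitCluster_eq_iUnion]
      exact mem_iUnion.2 ⟨j, hv⟩

lemma IsSlitMap.map_slitFilter {Δ Δ' : SD} {f : ℂ → ℂ} (h : IsSlitMap Δ Δ' f) :
    map f (slitFilter Δ.dom) = slitFilter Δ'.dom := by
  rw [h.reg.map_slitFilter, h.slitCluster_eq, sdiff_sdiff_right_self]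
  congr 1
  exact inter_eq_right.2 fun z hz => hz.1

section Harnack

variable {D : Set ℂ}

/-- `‖h‖` grows at most by a constant factor from `x` to `y`, for all holomorphic functions on `D`
with non-negative imaginary part. -/
def HarnackBound (D : Set ℂ) (C : ℝ) (x y : ℂ) : Prop :=
  ∀ h : ℂ → ℂ, DifferentiableOn ℂ h D → (∀ z ∈ D, 0 ≤ (h z).im) → ‖h y‖ ≤ C * ‖h x‖

lemma harnackBound_of_ball {c z : ℂ} {ρ : ℝ} (hD : ball c ρ ⊆ D) (hz : ‖z - c‖ ≤ ρ / 3)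
    (hρ : 0 < ρ) : HarnackBound D 2 c z := by
  intro h hh h0
  have hzb : z ∈ ball c ρ := by rw [mem_ball, dist_eq_norm]; linarith
  have h1 := norm_sub_le_ball (hh.mono hD) (fun w hw => h0 w (hD hw)) hzb
  have h2 : ‖h z - h c‖ * (ρ * (2 / 3)) ≤ 2 * (ρ / 3) * ‖h c‖ :=
    calc ‖h z - h c‖ * (ρ * (2 / 3)) ≤ ‖h z - h c‖ * (ρ - ‖z - c‖) := by gcongr; linarith
      _ ≤ _ := h1
      _ ≤ _ := by
        have := (le_abs_self _).trans (Complex.abs_im_le_norm (h c))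
        have := h0 c (hD (mem_ball_self hρ))
        gcongr
  have h3 : ‖h z - h c‖ ≤ ‖h c‖ := by
    have : ‖h z - h c‖ * (ρ * (2 / 3)) ≤ ‖h c‖ * (ρ * (2 / 3)) := by linarith
    exact le_of_mul_le_mul_right this (by positivity)
  have := norm_le_norm_add_norm_sub' (h z) (h c)
  linarith

lemma exists_harnackBound (hD : IsOpen D) (hc : IsPreconnected D) {K : Set ℂ} (hK : IsCompact K)
    (hKD : K ⊆ D) {z₀ : ℂ} (hz₀ : z₀ ∈ D) :
    ∃ C : ℝ, 0 ≤ C ∧ ∀ z ∈ K, HarnackBound D C z₀ z := by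
  have hpt : ∀ z ∈ D, ∃ C : ℝ, 0 ≤ C ∧ HarnackBound D C z₀ z := by
    intro z hz
    refine hc.induction₂' (fun x y => ∃ C : ℝ, 0 ≤ C ∧ HarnackBound D C x y) ?_ ?_ hz₀ hz
    · intro x hx
      obtain ⟨ρ, hρ, hb⟩ := Metric.isOpen_iff.1 hD x hx
      filter_upwards [mem_nhdsWithin_of_mem_nhds (ball_mem_nhds x (show 0 < ρ / 6 by positivity))]
        with y hy
      rw [mem_ball, dist_eq_norm] at hy
      refine ⟨⟨2, by norm_num, harnackBound_of_ball hb (by linarith) hρ⟩, 2, by norm_num,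
        harnackBound_of_ball (ρ := ρ / 2) (fun w hw => hb ?_) (by rw [norm_sub_rev]; linarith)
          (by positivity)⟩
      rw [mem_ball, dist_eq_norm] at hw ⊢
      have := norm_sub_le_norm_sub_add_norm_sub w y x
      linarith
    · rintro x y z - - - ⟨C₁, h1, hC₁⟩ ⟨C₂, h2, hC₂⟩
      refine ⟨C₂ * C₁, by positivity, fun h hh h0 => (hC₂ h hh h0).trans ?_⟩
      rw [mul_assoc]
      have := hC₁ h hh h0
      gcongr
  refine hK.induction_on (p := fun S => ∃ C : ℝ, 0 ≤ C ∧ ∀ z ∈ S, HarnackBound D C z₀ z)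
    ⟨0, le_rfl, fun z hz => hz.elim⟩ (fun s t hst ⟨C, h, hC⟩ => ⟨C, h, fun z hz => hC z (hst hz)⟩)
    ?_ fun x hx => ?_
  · rintro s t ⟨C₁, h1, hC₁⟩ ⟨C₂, h2, hC₂⟩
    refine ⟨max C₁ C₂, h1.trans (le_max_left _ _), ?_⟩
    rintro z (hz | hz) h hh h0
    · exact (hC₁ z hz h hh h0).trans (by gcongr; exact le_max_left _ _)
    · exact (hC₂ z hz h hh h0).trans (by gcongr; exact le_max_right _ _)
  · obtain ⟨C, hC0, hC⟩ := hpt x (hKD hx)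
    obtain ⟨ρ, hρ, hb⟩ := Metric.isOpen_iff.1 hD x (hKD hx)
    refine ⟨ball x (ρ / 3), mem_nhdsWithin_of_mem_nhds (ball_mem_nhds x (by positivity)), 2 * C,
      by positivity, fun z hz h hh h0 => ?_⟩
    rw [mem_ball, dist_eq_norm] at hz
    have h1 := harnackBound_of_ball hb hz.le hρ h hh h0
    have h2 := hC h hh h0
    linarith

end Harnack

/-- Hurwitz' theorem: a non-constant locally uniform limit of injective holomorphic functions is
injective. -/
lemma injOn_of_tendstoLocallyUniformlyOn {ι : Type*} {l : Filter ι} [NeBot l] {D : Set ℂ}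
    {F : ι → ℂ → ℂ} {f : ℂ → ℂ} (hD : IsOpen D) (hc : IsPreconnected D)
    (hF : ∀ᶠ n in l, DifferentiableOn ℂ (F n) D) (hi : ∀ᶠ n in l, InjOn (F n) D)
    (hf : TendstoLocallyUniformlyOn F f l D) {p q : ℂ} (hp : p ∈ D) (hq : q ∈ D)
    (hpq : f p ≠ f q) : InjOn f D := by
  have hfd : DifferentiableOn ℂ f D := hf.differentiableOn hF hD
  intro a ha b hb hab
  by_contra hne
  have hiso : ∀ᶠ z in 𝓝[≠] b, f z ≠ f b := by
    have han := (hfd.analyticOnNhd hD)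
    refine ((han b hb).eventually_eq_or_eventually_ne analyticAt_const).resolve_left fun hcon => ?_
    have := han.eqOn_of_preconnected_of_eventuallyEq (fun _ _ => analyticAt_const) hc hb hcon
    exact hpq ((this hp).trans (this hq).symm)
  obtain ⟨ε, hε, hball⟩ := Metric.eventually_nhds_iff_ball.1
    ((eventually_nhdsWithin_iff.1 hiso).and (hD.mem_nhds hb))
  set r : ℝ := min (ε / 2) (‖a - b‖ / 2) with hr
  have hab' : 0 < ‖a - b‖ := norm_pos_iff.2 (sub_ne_zero.2 hne)
  have hr0 : 0 < r := lt_min (by linarith) (by linarith)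
  have hrε : r < ε := (min_le_left _ _).trans_lt (by linarith)
  have hra : r < ‖a - b‖ := (min_le_right _ _).trans_lt (by linarith)
  have hcl : closedBall b r ⊆ D := fun z hz => (hball z (closedBall_subset_ball hrε hz)).2
  have hsph : ∀ z ∈ sphere b r, f z - f b ≠ 0 := fun z hz => sub_ne_zero.2
    ((hball z (closedBall_subset_ball hrε (sphere_subset_closedBall hz))).1 fun e => by
      rw [e] at hz
      simp at hz
      linarith)
  obtain ⟨z₁, hz₁, hmin⟩ := (isCompact_sphere b r).exists_isMinOn
    (NormedSpace.sphere_nonempty.2 hr0.le) (f := fun z => ‖f z - f b‖)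
    ((hfd.continuousOn.mono (sphere_subset_closedBall.trans hcl)).sub continuousOn_const).norm
  set δ : ℝ := ‖f z₁ - f b‖
  have hδ : 0 < δ := norm_pos_iff.2 (hsph z₁ hz₁)
  have hunif := (tendstoLocallyUniformlyOn_iff_forall_isCompact hD).1 hf (closedBall b r) hcl
    (isCompact_closedBall b r)
  have hev := Metric.tendstoUniformlyOn_iff.1 hunif (δ / 4) (by linarith)
  have hevp : ∀ z ∈ D, ∀ᶠ n in l, dist (f z) (F n z) < δ / 4 := fun z hz => by
    have := ((hf.tendsto_at hz)).eventually (ball_mem_nhds (f z) (show 0 < δ / 4 by linarith))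
    filter_upwards [this] with n hn
    rw [dist_comm]; exact hn
  obtain ⟨n, hn1, hn2, hn3, hn4⟩ := (hev.and ((hevp a ha).and (hF.and hi))).exists
  have hnz : ∀ z ∈ closedBall b r, F n z - F n a ≠ 0 := by
    intro z hz e
    have := hn4 (hcl hz) ha (sub_eq_zero.1 e)
    rw [this, mem_closedBall, dist_eq_norm] at hz
    linarith
  have hd : DiffContOnCl ℂ (fun z => (F n z - F n a)⁻¹) (ball b r) := by
    have h1 : DifferentiableOn ℂ (fun z => (F n z - F n a)⁻¹) (closedBall b r) :=
      ((hn3.mono hcl).sub_const _).inv hnz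
    refine DifferentiableOn.diffContOnCl ?_
    rwa [closure_ball b hr0.ne']
  have hmax := Complex.norm_le_of_forall_mem_frontier_norm_le (C := (δ / 2)⁻¹) isBounded_ball hd
    (by
      intro z hz
      rw [frontier_ball b hr0.ne'] at hz
      rw [norm_inv]
      refine inv_anti₀ (by linarith) ?_
      have h1 := hn1 z (sphere_subset_closedBall hz)
      have h2 : δ ≤ ‖f z - f b‖ := hmin hz
      rw [dist_eq_norm] at h1 hn2
      rw [← hab] at h2
      have h3 : f z - f a = (f z - F n z) - (f a - F n a) + (F n z - F n a) := by ring
      have h4 := norm_add_le ((f z - F n z) - (f a - F n a)) (F n z - F n a)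
      have h5 := norm_sub_le (f z - F n z) (f a - F n a)
      rw [← h3] at h4
      linarith) (subset_closure (mem_ball_self hr0))
  rw [norm_inv] at hmax
  have hb2 := norm_pos_iff.2 (hnz b (mem_closedBall_self hr0.le))
  have h1 := (inv_le_inv₀ hb2 (by positivity)).1 hmax
  have h2 := hn1 b (mem_closedBall_self hr0.le)
  rw [dist_eq_norm] at h2 hn2
  have h3 : F n b - F n a = (f a - F n a) - (f b - F n b) := by rw [hab]; ring
  have h5 := norm_sub_le (f a - F n a) (f b - F n b)
  rw [← h3] at h5
  linarith

lemma mem_Sector_iff {θ : ℝ} (h0 : 0 < θ) (h1 : θ < Real.pi / 2) {z : ℂ} :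
    z ∈ Sector θ ↔ ‖z‖ * Real.sin θ < z.im := by
  have hs : 0 < Real.sin θ := Real.sin_pos_of_pos_of_lt_pi h0 (by linarith [Real.pi_pos])
  have him : z.im = ‖z‖ * Real.sin (arg z) := (norm_mul_sin_arg z).symm
  constructor
  · rintro ⟨h2, h3⟩
    have hz : z ≠ 0 := by rintro rfl; rw [arg_zero] at h2; linarith
    have hsin : Real.sin θ < Real.sin (arg z) := by
      rcases le_total (arg z) (Real.pi / 2) with h4 | h4
      · exact Real.sin_lt_sin_of_lt_of_le_pi_div_two (by linarith) h4 h2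
      · rw [← Real.sin_pi_sub (arg z)]
        exact Real.sin_lt_sin_of_lt_of_le_pi_div_two (by linarith) (by linarith) (by linarith)
    rw [him]
    exact mul_lt_mul_of_pos_left hsin (norm_pos_iff.2 hz)
  · intro h
    have hz : 0 < ‖z‖ := by
      rw [norm_pos_iff]; rintro rfl; simp at h
    rw [him] at h
    have hsin := lt_of_mul_lt_mul_left h hz.le
    have hargpos : 0 < arg z := by
      by_contra! hcon
      have := Real.sin_nonpos_of_nonpos_of_neg_pi_le hcon (neg_pi_lt_arg z).le
      linarith
    refine ⟨?_, ?_⟩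
    · by_contra! hcon
      have := Real.sin_le_sin_of_le_of_le_pi_div_two (by linarith) h1.le hcon
      linarith
    · by_contra! hcon
      have h5 := Real.sin_le_sin_of_le_of_le_pi_div_two (x := Real.pi - arg z)
        (by linarith [arg_le_pi z]) h1.le (by linarith)
      rw [Real.sin_pi_sub] at h5
      linarith

lemma tendsto_vertical {θ : ℝ} (h0 : 0 < θ) (h1 : θ < Real.pi / 2) :
    Tendsto (fun Y : ℝ => (Y : ℂ) * I) atTop (cobounded ℂ ⊓ 𝓟 (Sector θ)) := by
  have hn : ∀ᶠ Y : ℝ in atTop, ‖(Y : ℂ) * I‖ = Y := by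
    filter_upwards [eventually_gt_atTop 0] with Y hY
    rw [norm_mul, norm_I, mul_one, Complex.norm_real, Real.norm_of_nonneg hY.le]
  refine tendsto_inf.2 ⟨?_, ?_⟩
  · rw [← tendsto_norm_atTop_iff_cobounded]
    exact tendsto_id.congr' (hn.mono fun Y hY => hY.symm)
  · rw [tendsto_principal]
    filter_upwards [hn, eventually_gt_atTop 0] with Y hY hpos
    rw [mem_Sector_iff h0 h1, hY]
    have : Real.sin θ < 1 := by
      rw [← Real.sin_pi_div_two]
      exact Real.sin_lt_sin_of_lt_of_le_pi_div_two (by linarith) le_rfl h1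
    simp
    nlinarith

lemma SatisfiesH2.tendsto_vertical {f : ℂ → ℂ} {c : ℂ} (h : SatisfiesH2 f c) :
    Tendsto (fun Y : ℝ => ((Y : ℂ) * I) * (f (Y * I) - Y * I)) atTop (𝓝 (-c)) :=
  (h (Real.pi / 4) (by positivity) (by linarith [Real.pi_pos])).comp
    (_root_.tendsto_vertical (by positivity) (by linarith [Real.pi_pos]))

section Residue

variable {h : ℂ → ℂ} {c : ℂ} {H : ℝ}

lemma tendsto_zero_of_residue
    (hc : Tendsto (fun Y : ℝ => ((Y : ℂ) * I) * h (Y * I)) atTop (𝓝 (-c))) :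
    Tendsto (fun Y : ℝ => h (Y * I)) atTop (𝓝 0) := by
  have h1 : Tendsto (fun Y : ℝ => ((Y : ℂ) * I)⁻¹) atTop (𝓝 0) := by
    have h4 := Real.pi_pos
    exact (tendsto_inv₀_cobounded).comp ((_root_.tendsto_vertical (θ := Real.pi / 4) (by positivity)
      (by linarith)).mono_right inf_le_left)
  have h2 := h1.mul hc
  rw [zero_mul] at h2
  refine h2.congr' ?_
  filter_upwards [eventually_gt_atTop 0] with Y hY
  have : (Y : ℂ) * I ≠ 0 := mul_ne_zero (ofReal_ne_zero.2 hY.ne') I_ne_zero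
  exact inv_mul_cancel_left₀ this _

lemma tendsto_im_of_residue
    (hc : Tendsto (fun Y : ℝ => ((Y : ℂ) * I) * h (Y * I)) atTop (𝓝 (-c))) :
    Tendsto (fun Y : ℝ => Y * (h (Y * I)).im) atTop (𝓝 c.re) := by
  have := (Complex.continuous_re.tendsto _).comp hc.neg
  rw [neg_neg] at this
  refine this.congr fun Y => ?_
  simp

/-- Bound for a holomorphic function with non-negative imaginary part by its residue at infinity. -/
lemma norm_mul_le_of_residue (hh : DifferentiableOn ℂ h (HP H)) (h0 : ∀ z ∈ HP H, 0 ≤ (h z).im)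
    (hc : Tendsto (fun Y : ℝ => ((Y : ℂ) * I) * h (Y * I)) atTop (𝓝 (-c))) {z : ℂ}
    (hz : z ∈ HP H) : ‖h z‖ * (z.im - H) ≤ 2 * c.re := by
  change H < z.im at hz
  have him := tendsto_im_of_residue hc
  have hz0 := tendsto_zero_of_residue hc
  have him0 : Tendsto (fun Y : ℝ => (h (Y * I)).im) atTop (𝓝 0) := by
    exact (Complex.continuous_im.tendsto 0).comp hz0
  have hq : Tendsto (fun Y : ℝ => z.re ^ 2 / (2 * (Y - z.im))) atTop (𝓝 0) := by
    refine Tendsto.div_atTop tendsto_const_nhds ?_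
    exact (tendsto_atTop_add_const_right _ (-z.im) tendsto_id).const_mul_atTop (by norm_num)
  have hleft : Tendsto (fun Y : ℝ => ‖h z - h (Y * I)‖ *
      (z.im - H - z.re ^ 2 / (2 * (Y - z.im)))) atTop (𝓝 (‖h z - 0‖ * (z.im - H - 0))) :=
    (tendsto_const_nhds.sub hz0).norm.mul (tendsto_const_nhds.sub hq)
  have hright : Tendsto (fun Y : ℝ => 2 * (‖z‖ * (h (Y * I)).im + Y * (h (Y * I)).im)) atTop
      (𝓝 (2 * (‖z‖ * 0 + c.re))) := ((him0.const_mul _).add him).const_mul _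
  rw [sub_zero, sub_zero] at hleft
  rw [mul_zero, zero_add] at hright
  refine le_of_tendsto_of_tendsto hleft hright ?_
  filter_upwards [eventually_gt_atTop 0, eventually_gt_atTop z.im, eventually_gt_atTop H,
    hq.eventually (gt_mem_nhds (show 0 < z.im - H by linarith))] with Y h1 h2 h3 h4
  have hY : (((Y : ℂ) * I)).im = Y := by simp
  have hball : ball ((Y : ℂ) * I) (Y - H) ⊆ HP H := by
    intro w hw
    rw [mem_ball, dist_eq_norm] at hw
    have := (Complex.abs_im_le_norm (w - Y * I)).trans_lt hw
    rw [sub_im, hY, abs_lt] at this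
    change H < w.im
    linarith
  have hd : ‖z - Y * I‖ ≤ (Y - z.im) + z.re ^ 2 / (2 * (Y - z.im)) := by
    have h8 : 0 < Y - z.im := by linarith
    refine abs_le_of_sq_le_sq' ?_ (by positivity) |>.2
    rw [← Complex.normSq_eq_norm_sq, Complex.normSq_apply]
    have e : (z - Y * I).re = z.re ∧ (z - Y * I).im = z.im - Y := by simp
    rw [e.1, e.2]
    have h9 : (Y - z.im) * (z.re ^ 2 / (2 * (Y - z.im))) = z.re ^ 2 / 2 := by field_simp
    nlinarith [sq_nonneg (z.re ^ 2 / (2 * (Y - z.im)))]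
  have hzb : z ∈ ball ((Y : ℂ) * I) (Y - H) := by
    rw [mem_ball, dist_eq_norm]; linarith
  have h5 := norm_sub_le_ball (hh.mono hball) (fun w hw => h0 w (hball hw)) hzb
  have h6 := h0 ((Y : ℂ) * I) (by change H < _; rw [hY]; exact h3)
  have h7 : ‖z - Y * I‖ ≤ ‖z‖ + Y := by
    refine (norm_sub_le _ _).trans ?_
    rw [norm_mul, norm_I, mul_one, Complex.norm_real, Real.norm_of_nonneg h1.le]
  calc _ ≤ ‖h z - h (Y * I)‖ * (Y - H - ‖z - Y * I‖) :=
        mul_le_mul_of_nonneg_left (by linarith) (norm_nonneg _)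
    _ ≤ _ := h5
    _ ≤ 2 * (‖z‖ + Y) * (h (Y * I)).im := by gcongr
    _ = _ := by ring

lemma residue_re_nonneg (h0 : ∀ z ∈ HP H, 0 ≤ (h z).im)
    (hc : Tendsto (fun Y : ℝ => ((Y : ℂ) * I) * h (Y * I)) atTop (𝓝 (-c))) : 0 ≤ c.re := by
  refine ge_of_tendsto (tendsto_im_of_residue hc) ?_
  filter_upwards [eventually_gt_atTop 0, eventually_gt_atTop H] with Y h1 h2
  exact mul_nonneg h1.le (h0 _ (by change H < _; simpa using h2))

lemma norm_residue_le (hh : DifferentiableOn ℂ h (HP H)) (h0 : ∀ z ∈ HP H, 0 ≤ (h z).im)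
    (hc : Tendsto (fun Y : ℝ => ((Y : ℂ) * I) * h (Y * I)) atTop (𝓝 (-c))) :
    ‖c‖ ≤ 2 * c.re := by
  have h1 : Tendsto (fun Y : ℝ => ‖((Y : ℂ) * I) * h (Y * I)‖ - ‖h (Y * I)‖ * H) atTop
      (𝓝 (‖-c‖ - ‖(0 : ℂ)‖ * H)) :=
    hc.norm.sub ((tendsto_zero_of_residue hc).norm.mul_const H)
  rw [norm_neg, norm_zero, zero_mul, sub_zero] at h1
  refine le_of_tendsto h1 ?_
  filter_upwards [eventually_gt_atTop 0, eventually_gt_atTop H] with Y h2 h3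
  have := norm_mul_le_of_residue hh h0 hc (z := Y * I) (by change H < _; simpa using h3)
  rw [norm_mul, norm_mul, norm_I, mul_one, Complex.norm_real, Real.norm_of_nonneg h2.le]
  simp at this
  linarith

lemma tendsto_zero_of_tendsto_high {η : ℝ} (hh : DifferentiableOn ℂ h (HP H))
    (h0 : ∀ z ∈ HP H, 0 ≤ (h z).im) (hη : Tendsto h (cobounded ℂ ⊓ 𝓟 (HP η)) (𝓝 0)) :
    Tendsto h (cobounded ℂ ⊓ 𝓟 (HP (H + 1))) (𝓝 0) := by
  rw [Metric.tendsto_nhds]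
  intro ε hε
  set B : ℝ := |η| + |H| + 1 with hB
  have hB1 : η < B := by have := le_abs_self η; have := abs_nonneg H; linarith
  have hB2 : H < B := by have := le_abs_self H; have := abs_nonneg η; linarith
  set M : ℝ := 2 * (B - H) + 1 with hM
  obtain ⟨K, hK⟩ := eventually_cobounded_inf.1 (hη.eventually (ball_mem_nhds 0
    (show 0 < ε / M by have : 0 < M := by linarith
                       positivity)))
  rw [eventually_cobounded_inf]
  refine ⟨K + |H| + |B|, fun z hz hKz => ?_⟩
  change H + 1 < z.im at hz
  rw [dist_zero_right]
  have hMp : 1 ≤ M := by linarith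
  by_cases h1 : B < z.im
  · have := hK z (hB1.trans h1) (by have := abs_nonneg H; have := abs_nonneg B; linarith)
    rw [dist_zero_right] at this
    exact this.trans_le (div_le_self hε.le hMp)
  · push Not at h1
    set p : ℂ := ⟨z.re, B⟩ with hp
    have hzp : ‖z - p‖ = B - z.im := by
      have : z - p = ((z.im - B : ℝ) : ℂ) * I := by apply Complex.ext <;> simp [hp]
      rw [this, norm_mul, norm_I, mul_one, Complex.norm_real, Real.norm_eq_abs, abs_of_nonpos]
      · ring
      · linarith
    have hpn : K < ‖p‖ := by
      have e1 := Complex.norm_le_abs_re_add_abs_im z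
      have e2 := Complex.abs_re_le_norm p
      have e3 : |z.im| ≤ |H| + |B| := by
        rw [abs_le]
        exact ⟨by linarith [neg_abs_le H, abs_nonneg B], by linarith [le_abs_self B, abs_nonneg H]⟩
      have e4 : p.re = z.re := rfl
      rw [e4] at e2
      linarith
    have hball : ball p (B - H) ⊆ HP H := by
      intro w hw
      rw [mem_ball, dist_eq_norm] at hw
      have := (Complex.abs_im_le_norm (w - p)).trans_lt hw
      rw [sub_im, abs_lt] at this
      have e : p.im = B := rfl
      change H < w.im
      linarith
    have h2 := norm_sub_le_ball (hh.mono hball) (fun w hw => h0 w (hball hw)) (z := z) (by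
      rw [mem_ball, dist_eq_norm, hzp]; linarith)
    have h3 := hK p (show η < p.im from hB1) hpn
    rw [dist_zero_right, lt_div_iff₀ (by linarith)] at h3
    have h4 := (le_abs_self _).trans (Complex.abs_im_le_norm (h p))
    have h5 : ‖h z - h p‖ ≤ 2 * (B - H) * ‖h p‖ := by
      rw [hzp] at h2
      calc ‖h z - h p‖ = ‖h z - h p‖ * 1 := (mul_one _).symm
        _ ≤ ‖h z - h p‖ * (B - H - (B - z.im)) := by gcongr; linarith
        _ ≤ _ := h2
        _ ≤ 2 * (B - z.im) * ‖h p‖ := by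
          have : 0 ≤ B - z.im := by linarith
          gcongr
        _ ≤ _ := by gcongr; linarith
    have h6 := norm_le_norm_add_norm_sub' (h z) (h p)
    nlinarith

end Residue

namespace IsEvolutionFamily

variable {A : Set ℝ} {D : ℝ → Set ℂ} {φ : ℝ → ℝ → ℂ → ℂ} {lam : ℝ → ℂ}
  (hE : IsEvolutionFamily A D φ lam) {s t : ℝ}

include hE

lemma isSlitMap (hs : s ∈ A) (ht : t ∈ A) (hst : s ≤ t) {Δ Δ' : SD} (e : Δ.dom = D s)
    (e' : Δ'.dom = D t) : IsSlitMap Δ Δ' (φ t s) where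
  holo := e ▸ hE.holo s hs t ht hst
  inj := e ▸ hE.inj s hs t ht hst
  mapsTo := e ▸ e' ▸ hE.mapsTo s hs t ht hst
  h1 := e ▸ hE.h1 s hs t ht hst
  h3 := e ▸ e' ▸ hE.h3 s hs t ht hst

lemma reg (hs : s ∈ A) (ht : t ∈ A) (hst : s ≤ t) {Δ : SD} (e : Δ.dom = D s) :
    Reg Δ (φ t s) := by
  obtain ⟨Δ', e'⟩ := (hE.slit t ht).exists_SD
  exact (hE.isSlitMap hs ht hst e e').reg

lemma isOpen_dom (hs : s ∈ A) : IsOpen (D s) := by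
  obtain ⟨Δ, e⟩ := (hE.slit s hs).exists_SD
  exact e ▸ Δ.isOpen_dom

lemma isPreconnected_dom (hs : s ∈ A) : IsPreconnected (D s) := by
  obtain ⟨Δ, e⟩ := (hE.slit s hs).exists_SD
  exact e ▸ Δ.isPreconnected_dom

lemma im_le (hs : s ∈ A) (ht : t ∈ A) (hst : s ≤ t) {z : ℂ} (hz : z ∈ D s) :
    z.im ≤ (φ t s z).im := by
  obtain ⟨Δ, e⟩ := (hE.slit s hs).exists_SD
  exact (hE.reg hs ht hst e).im_le (e ▸ hz)

lemma residue (h0 : 0 ∈ A) (hs : s ∈ A) (ht : t ∈ A) (hs0 : 0 ≤ s) (hst : s ≤ t) :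
    SatisfiesH2 (φ t s) (lam t - lam s) := by
  obtain ⟨c, hc⟩ := hE.h2 s hs t ht hst
  suffices lam t = lam s + c by rwa [this, add_sub_cancel_left]
  have hpi := Real.pi_pos
  have h1 := (hE.lam_res s hs).tendsto_vertical
  have h2 := (hE.lam_res t ht).tendsto_vertical
  set w : ℝ → ℂ := fun Y => φ s 0 (Y * I) with hw
  have h3 : Tendsto (fun Y : ℝ => w Y - Y * I) atTop (𝓝 0) :=
    tendsto_zero_of_residue (h := fun z => φ s 0 z - z) h1
  have hsmall : ∀ᶠ Y : ℝ in atTop, ‖w Y - Y * I‖ < 1 := by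
    filter_upwards [h3.eventually (ball_mem_nhds 0 one_pos)] with Y hY
    exact mem_ball_zero_iff.1 hY
  have hw1 : Tendsto w atTop (cobounded ℂ ⊓ 𝓟 (Sector (Real.pi / 6))) := by
    refine tendsto_inf.2 ⟨?_, ?_⟩
    · rw [← tendsto_norm_atTop_iff_cobounded]
      refine tendsto_atTop_mono' _ ?_ (tendsto_atTop_add_const_right _ (-1) tendsto_id)
      filter_upwards [hsmall, eventually_gt_atTop 0] with Y hY hpos
      have h4 := norm_sub_norm_le (Y * I : ℂ) (w Y)
      rw [norm_sub_rev, norm_mul, norm_I, mul_one, Complex.norm_real,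
        Real.norm_of_nonneg hpos.le] at h4
      change Y + -1 ≤ ‖w Y‖
      linarith
    · rw [tendsto_principal]
      filter_upwards [hsmall, eventually_gt_atTop 3] with Y hY hpos
      rw [mem_Sector_iff (by positivity) (by linarith), Real.sin_pi_div_six]
      have h4 := norm_sub_norm_le (w Y) (Y * I : ℂ)
      rw [norm_mul, norm_I, mul_one, Complex.norm_real,
        Real.norm_of_nonneg (by linarith)] at h4
      have h5 := (Complex.abs_im_le_norm (w Y - Y * I)).trans_lt hY
      have e : (w Y - Y * I).im = (w Y).im - Y := by simp
      rw [e, abs_lt] at h5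
      linarith
  have h4 := (hc (Real.pi / 6) (by positivity) (by linarith)).comp hw1
  have hinv : Tendsto (fun Y => (w Y)⁻¹) atTop (𝓝 0) :=
    tendsto_inv₀_cobounded.comp (hw1.mono_right inf_le_left)
  have hw0 : ∀ᶠ Y in atTop, w Y ≠ 0 := by
    have := hw1.mono_right inf_le_left
    rw [← tendsto_norm_atTop_iff_cobounded] at this
    filter_upwards [this.eventually_gt_atTop 0] with Y hY
    exact norm_pos_iff.1 hY
  have h5 : Tendsto (fun Y : ℝ => 1 - (w Y - Y * I) * (w Y)⁻¹) atTop (𝓝 (1 - 0 * 0)) :=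
    tendsto_const_nhds.sub (h3.mul hinv)
  have h6 := h1.add (h5.mul h4)
  have h7 : -lam s + (1 - 0 * 0) * -c = -lam t := by
    refine tendsto_nhds_unique h6 (h2.congr' ?_)
    obtain ⟨η, hη0, hηD, -⟩ := hE.h1 0 h0 s hs hs0
    filter_upwards [hw0, eventually_gt_atTop η] with Y hY hYη
    have e := hE.ef2 0 h0 s hs t ht hs0 hst (Y * I) (hηD (by change η < _; simpa using hYη))
    rw [e]
    change _ = _ + (1 - (w Y - Y * I) * (w Y)⁻¹) * (w Y * (φ t s (w Y) - w Y))
    change _ * (φ t s (w Y) - _) = _ * (w Y - _) + _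
    field_simp
    ring
  linear_combination h7

variable (h0 : 0 ∈ A) (hI : ∀ t ∈ A, 0 ≤ t)

lemma sub_holo {H : ℝ} (hH : HP H ⊆ D s) (hs : s ∈ A) (ht : t ∈ A) (hst : s ≤ t) :
    DifferentiableOn ℂ (fun z => φ t s z - z) (HP H) :=
  ((hE.holo s hs t ht hst).mono hH).sub differentiableOn_id

lemma sub_im_nonneg (hs : s ∈ A) (ht : t ∈ A) (hst : s ≤ t) {z : ℂ} (hz : z ∈ D s) :
    0 ≤ (φ t s z - z).im := by
  rw [sub_im, sub_nonneg]
  exact hE.im_le hs ht hst hz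

include h0

lemma lam_zero : lam 0 = 0 := by
  have h1 := (hE.residue h0 h0 h0 le_rfl le_rfl).tendsto_vertical
  have h2 := (hE.lam_res 0 h0).tendsto_vertical
  have := tendsto_nhds_unique h1 h2
  simpa using this

include hI

lemma norm_sub_le {H : ℝ} (hs : s ∈ A) (ht : t ∈ A) (hst : s ≤ t) (hH : HP H ⊆ D s) {z : ℂ}
    (hz : z ∈ HP H) : ‖φ t s z - z‖ * (z.im - H) ≤ 2 * ((lam t).re - (lam s).re) := by
  have := norm_mul_le_of_residue (hE.sub_holo hH hs ht hst)
    (fun z hz => hE.sub_im_nonneg hs ht hst (hH hz))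
    (hE.residue h0 hs ht (hI s hs) hst).tendsto_vertical hz
  rwa [sub_re] at this

lemma re_mono (hs : s ∈ A) (ht : t ∈ A) (hst : s ≤ t) : (lam s).re ≤ (lam t).re := by
  obtain ⟨η, -, hη, -⟩ := hE.h1 s hs t ht hst
  have := residue_re_nonneg (H := η) (fun z hz => hE.sub_im_nonneg hs ht hst (hη hz))
    (hE.residue h0 hs ht (hI s hs) hst).tendsto_vertical
  rw [sub_re] at this
  linarith

lemma norm_lam_sub_le (hs : s ∈ A) (ht : t ∈ A) (hst : s ≤ t) :
    ‖lam t - lam s‖ ≤ 2 * ((lam t).re - (lam s).re) := by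
  obtain ⟨η, -, hη, -⟩ := hE.h1 s hs t ht hst
  have := norm_residue_le (hE.sub_holo hη hs ht hst)
    (fun z hz => hE.sub_im_nonneg hs ht hst (hη hz))
    (hE.residue h0 hs ht (hI s hs) hst).tendsto_vertical
  rwa [sub_re] at this

/-- A common upper bound for the heights of all slits. -/
lemma exists_HP_subset (hb : BddAbove ((fun t => (lam t).re) '' A)) :
    ∃ H : ℝ, 0 ≤ H ∧ ∀ t ∈ A, HP H ⊆ D t := by
  obtain ⟨Δ, e⟩ := (hE.slit 0 h0).exists_SD
  obtain ⟨r, hr1, hr2⟩ := exists_between Δ.hR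
  obtain ⟨M, hM⟩ := hb
  obtain ⟨η, hη0, hηD, -⟩ := hE.h1 0 h0 0 h0 le_rfl
  rw [← e] at hηD
  set K : Set ℂ := ⋃ j, (Δ.S j).J '' sphere 0 r with hK
  have hKc : IsCompact K := isCompact_iUnion fun j =>
    (isCompact_sphere 0 r).image_of_continuousOn ((Δ.S j).continuousOn_J.mono fun ζ hζ => by
      rintro rfl
      simp at hζ
      linarith)
  have hKD : K ⊆ Δ.dom := by
    refine iUnion_subset fun j => ?_
    rintro _ ⟨ζ, hζ, rfl⟩
    exact SD.J_mem_dom (mem_Ann_of_sphere hr1 hr2 hζ)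
  set z₀ : ℂ := ((η + 1 : ℝ) : ℂ) * I with hz₀
  have hz₀' : z₀ ∈ HP η := by
    change η < _
    simp [hz₀]
  obtain ⟨C, hC0, hC⟩ := exists_harnackBound Δ.isOpen_dom Δ.isPreconnected_dom hKc hKD
    (hηD hz₀')
  obtain ⟨B, hB⟩ := hKc.isBounded.subset_closedBall 0
  refine ⟨max 0 (B + C * (2 * (M - (lam 0).re))), le_max_left _ _, fun t ht z hz => ?_⟩
  have hmap := hE.reg h0 ht (hI t ht) e
  obtain ⟨Δ', e'⟩ := (hE.slit t ht).exists_SD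
  have hz1 : max 0 (B + C * (2 * (M - (lam 0).re))) < z.im := hz
  rw [← e']
  by_contra hcon
  have hzc : z ∈ slitCluster Δ.dom (φ t 0) := by
    rw [(hE.isSlitMap h0 ht (hI t ht) e e').slitCluster_eq]
    exact ⟨(le_max_left _ _).trans_lt hz1, hcon⟩
  rw [slitCluster_eq_iUnion] at hzc
  obtain ⟨j, hj⟩ := mem_iUnion.1 hzc
  have hbd : ∀ w ∈ K, ‖φ t 0 w‖ ≤ B + C * (2 * (M - (lam 0).re)) := by
    intro w hw
    have h1 := hC w hw (fun z => φ t 0 z - z)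
      ((e ▸ hE.holo 0 h0 t ht (hI t ht)).sub differentiableOn_id)
      (fun z hz => hE.sub_im_nonneg h0 ht (hI t ht) (e ▸ hz))
    have h2 := hE.norm_sub_le h0 hI h0 ht (hI t ht) (e ▸ hηD) hz₀'
    have h3 : z₀.im - η = 1 := by simp [hz₀]
    rw [h3, mul_one] at h2
    have h4 : (lam t).re ≤ M := hM ⟨t, ht, rfl⟩
    have h5 : ‖w‖ ≤ B := mem_closedBall_zero_iff.1 (hB hw)
    have h6 := norm_le_norm_add_norm_sub' (φ t 0 w) w
    have h7 : C * ‖φ t 0 z₀ - z₀‖ ≤ C * (2 * (M - (lam 0).re)) := by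
      gcongr
      linarith
    linarith
  obtain ⟨ζ, hζ, hA⟩ := ((mapClusterPt_iff_frequently.1 hj) _
    ((isOpen_lt continuous_const Complex.continuous_im).mem_nhds
      ((le_max_right _ _).trans_lt hz1))).and_eventually (Ann_mem_Lf hr1) |>.exists
  obtain ⟨ξ, hξ, hle⟩ := (hmap.isChart j).exists_norm_le
    (SD.J_mem_dom ⟨hA.1, hA.2.trans hr2⟩) hr1 hr2 (by rw [(Δ.S j).rho_J hA.1.le]; exact hA.2)
  have h1 := hbd _ (mem_iUnion.2 ⟨j, ξ, mem_sphere_zero_iff_norm.2 hξ, rfl⟩)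
  have h2 : B + C * (2 * (M - (lam 0).re)) < (φ t 0 ((Δ.S j).J ζ)).im := hζ
  have h3 := (le_abs_self _).trans (Complex.abs_im_le_norm (φ t 0 ((Δ.S j).J ζ)))
  linarith

end IsEvolutionFamily

lemma SatisfiesH2.unique {f g : ℂ → ℂ} {c c' : ℂ} {η : ℝ} (hf : SatisfiesH2 f c)
    (hg : SatisfiesH2 g c') (h : EqOn f g (HP η)) : c = c' := by
  have := tendsto_nhds_unique hf.tendsto_vertical (hg.tendsto_vertical.congr' (by
    filter_upwards [eventually_gt_atTop η] with Y hY
    rw [h (by change η < _; simpa using hY)]))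
  exact neg_injective this

lemma slitCluster_congr {D : Set ℂ} {f g : ℂ → ℂ} (h : EqOn f g D) :
    slitCluster D f = slitCluster D g := by
  have : f =ᶠ[slitFilter D] g := mem_inf_of_right h
  ext w
  change MapClusterPt w _ _ ↔ MapClusterPt w _ _
  rw [MapClusterPt, MapClusterPt, Filter.map_congr this]

namespace IsEvolutionFamily

variable {T : ℝ} {D : ℝ → Set ℂ} {φ : ℝ → ℝ → ℂ → ℂ} {lam : ℝ → ℂ}

lemma bddAbove_re (hE : IsEvolutionFamily (Icc 0 T) D φ lam) :
    BddAbove ((fun t => (lam t).re) '' Icc 0 T) :=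
  isCompact_Icc.bddAbove_image (Complex.continuous_re.comp_continuousOn hE.ef3)

lemma tendsto_left (hE : IsEvolutionFamily (Icc 0 T) D φ lam) {H : ℝ}
    (hH : ∀ t ∈ Icc 0 T, HP H ⊆ D t) {s : ℝ} (hs0 : 0 ≤ s) (hs : s < T) {z : ℂ} (hz : z ∈ HP H) :
    Tendsto (fun t => φ t s z) (𝓝[<] T) (𝓝 (φ T s z)) := by
  have hT : T ∈ Icc 0 T := ⟨hs0.trans hs.le, le_rfl⟩
  have hz' : 0 < z.im - H := sub_pos.2 hz
  have hc : Tendsto lam (𝓝[<] T) (𝓝 (lam T)) := by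
    refine (hE.ef3 T hT).mono_left ?_
    rw [← nhdsWithin_Ioo_eq_nhdsLT (hs0.trans_lt hs)]
    exact nhdsWithin_mono _ fun t ht => ⟨ht.1.le, ht.2.le⟩
  have hlim : Tendsto (fun t => 2 * ((lam T).re - (lam t).re) / (z.im - H)) (𝓝[<] T) (𝓝 0) := by
    have := ((tendsto_const_nhds (x := (lam T).re)).sub
      ((Complex.continuous_re.tendsto _).comp hc)).const_mul 2 |>.div_const (z.im - H)
    simpa using this
  rw [tendsto_iff_norm_sub_tendsto_zero]
  refine squeeze_zero' (Eventually.of_forall fun _ => norm_nonneg _) ?_ hlim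
  rw [← nhdsWithin_Ioo_eq_nhdsLT hs]
  filter_upwards [self_mem_nhdsWithin] with t ht
  have hs' : s ∈ Icc 0 T := ⟨hs0, hs.le⟩
  have ht' : t ∈ Icc 0 T := ⟨hs0.trans ht.1.le, ht.2.le⟩
  rw [hE.ef2 s hs' t ht' T hT ht.1.le ht.2.le z (hH s hs' hz), norm_sub_rev, le_div_iff₀ hz']
  have him := hE.im_le hs' ht' ht.1.le (hH s hs' hz)
  have hw : φ t s z ∈ HP H := lt_of_lt_of_le hz him
  refine le_trans ?_ (hE.norm_sub_le ⟨le_rfl, hT.1⟩ (fun t ht => ht.1) ht' hT ht.2.le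
    (hH t ht') hw)
  gcongr

lemma unique_extension (hT : 0 < T) {D₁ D₂ : ℝ → Set ℂ} {φ₁ φ₂ : ℝ → ℝ → ℂ → ℂ} {lam₁ lam₂ : ℝ → ℂ}
    (hE₁ : IsEvolutionFamily (Icc 0 T) D₁ φ₁ lam₁) (hE₂ : IsEvolutionFamily (Icc 0 T) D₂ φ₂ lam₂)
    (hD : ∀ t ∈ Ico 0 T, D₁ t = D₂ t)
    (hφ : ∀ s ∈ Ico 0 T, ∀ t ∈ Ico 0 T, s ≤ t → EqOn (φ₁ t s) (φ₂ t s) (D₁ s)) :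
    D₁ T = D₂ T ∧ ∀ s ∈ Icc 0 T, ∀ t ∈ Icc 0 T, s ≤ t → EqOn (φ₁ t s) (φ₂ t s) (D₁ s) := by
  have h0 : (0 : ℝ) ∈ Icc 0 T := ⟨le_rfl, hT.le⟩
  have hTT : T ∈ Icc 0 T := ⟨hT.le, le_rfl⟩
  obtain ⟨H₁, -, hH₁⟩ := hE₁.exists_HP_subset h0 (fun t ht => ht.1) hE₁.bddAbove_re
  obtain ⟨H₂, -, hH₂⟩ := hE₂.exists_HP_subset h0 (fun t ht => ht.1) hE₂.bddAbove_re
  have hH₁' : ∀ t ∈ Icc 0 T, HP (max H₁ H₂) ⊆ D₁ t := fun t ht z hz =>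
    hH₁ t ht (show H₁ < z.im from (le_max_left _ _).trans_lt hz)
  have hH₂' : ∀ t ∈ Icc 0 T, HP (max H₁ H₂) ⊆ D₂ t := fun t ht z hz =>
    hH₂ t ht (show H₂ < z.im from (le_max_right _ _).trans_lt hz)
  have hlast : ∀ s, 0 ≤ s → s < T → EqOn (φ₁ T s) (φ₂ T s) (D₁ s) := by
    intro s hs0 hs
    have hs' : s ∈ Icc 0 T := ⟨hs0, hs.le⟩
    have hHP : EqOn (φ₁ T s) (φ₂ T s) (HP (max H₁ H₂)) := by
      intro z hz
      refine tendsto_nhds_unique (hE₁.tendsto_left hH₁' hs0 hs hz)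
        ((hE₂.tendsto_left hH₂' hs0 hs hz).congr' ?_)
      rw [← nhdsWithin_Ioo_eq_nhdsLT hs]
      filter_upwards [self_mem_nhdsWithin] with t ht
      exact (hφ s ⟨hs0, hs⟩ t ⟨hs0.trans ht.1.le, ht.2⟩ ht.1.le (hH₁' s hs' hz)).symm
    obtain ⟨z, hz, -⟩ := exists_high (max H₁ H₂) 0
    have ho := hE₁.isOpen_dom hs'
    refine ((hE₁.holo s hs' T hTT hs.le).analyticOnNhd ho).eqOn_of_preconnected_of_eventuallyEq
      (DifferentiableOn.analyticOnNhd ?_ ho) (hE₁.isPreconnected_dom hs') (hH₁' s hs' hz) ?_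
    · rw [hD s ⟨hs0, hs⟩]
      exact hE₂.holo s hs' T hTT hs.le
    · filter_upwards [(isOpen_lt continuous_const Complex.continuous_im).mem_nhds hz] with w hw
      exact hHP hw
  have hDT : D₁ T = D₂ T := by
    obtain ⟨Δ, e⟩ := (hE₁.slit 0 h0).exists_SD
    obtain ⟨Δ₁, e₁⟩ := (hE₁.slit T hTT).exists_SD
    obtain ⟨Δ₂, e₂⟩ := (hE₂.slit T hTT).exists_SD
    have h1 := (hE₁.isSlitMap h0 hTT hT.le e e₁).slitCluster_eq
    have h2 := (hE₂.isSlitMap h0 hTT hT.le (e.trans (hD 0 ⟨le_rfl, hT⟩)) e₂).slitCluster_eq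
    rw [slitCluster_congr (e ▸ hlast 0 le_rfl hT), h2] at h1
    rw [← e₁, ← e₂]
    have h3 : ∀ Δ : SD, Δ.dom = UHP \ (UHP \ Δ.dom) := fun Δ => by
      rw [sdiff_sdiff_right_self]
      exact (inter_eq_right.2 fun z hz => hz.1).symm
    rw [h3 Δ₁, h3 Δ₂, h1]
  refine ⟨hDT, fun s hs t ht hst => ?_⟩
  rcases ht.2.eq_or_lt with rfl | ht'
  · rcases hst.eq_or_lt with rfl | hst'
    · intro z hz
      rw [hE₁.ef1 s hs hz, hE₂.ef1 s hs (hDT ▸ hz)]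
    · exact hlast s hs.1 hst'
  · exact hφ s ⟨hs.1, hst.trans_lt ht'⟩ t ⟨ht.1, ht'⟩ hst

lemma bddAbove_of_extension (hT : 0 < T) {D' : ℝ → Set ℂ} {φ' : ℝ → ℝ → ℂ → ℂ} {lam' : ℝ → ℂ}
    (hE : IsEvolutionFamily (Ico 0 T) D φ lam) (hE' : IsEvolutionFamily (Icc 0 T) D' φ' lam')
    (hφ : ∀ t ∈ Ico 0 T, EqOn (φ' t 0) (φ t 0) (D 0)) :
    BddAbove ((fun t => (lam t).re) '' Ico 0 T) := by
  refine hE'.bddAbove_re.mono ?_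
  rintro _ ⟨t, ht, rfl⟩
  obtain ⟨η, -, hη, -⟩ := hE.h1 0 ⟨le_rfl, hT⟩ t ht ht.1
  refine ⟨t, ⟨ht.1, ht.2.le⟩, ?_⟩
  change (lam' t).re = (lam t).re
  rw [(hE'.lam_res t ⟨ht.1, ht.2.le⟩).unique (hE.lam_res t ht) ((hφ t ht).mono hη)]

end IsEvolutionFamily

/-- Harnack's inequality up to the slits, for functions whose imaginary part is asymptotically
constant along each slit. -/
lemma SD.exists_harnackBound (Δ : SD) {K : Set ℂ} (hK : IsCompact K) (hKU : K ⊆ UHP) {z₀ : ℂ}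
    (hz₀ : z₀ ∈ Δ.dom) : ∃ C, 0 ≤ C ∧ ∀ h : ℂ → ℂ, DifferentiableOn ℂ h Δ.dom →
      (∀ z ∈ Δ.dom, 0 ≤ (h z).im) →
      (∀ j, ∃ y, Tendsto (fun ζ => (h ((Δ.S j).J ζ)).im) Lf (𝓝 y)) →
      ∀ z ∈ K ∩ Δ.dom, ‖h z‖ ≤ C * ‖h z₀‖ := by
  obtain ⟨r, hr1, hr2⟩ := exists_between Δ.hR
  have hr3 : 1 < (1 + r) / 2 := by linarith
  set K₁ : Set ℂ := (K ∩ ⋂ j, {z | r ≤ (Δ.S j).rho z}) ∪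
    ⋃ j, {z | (Δ.S j).rho z ≤ r} ∩ {z | (1 + r) / 2 ≤ (Δ.S j).rho z} with hK₁
  have hK₁c : IsCompact K₁ := by
    refine (hK.inter_right (isClosed_iInter fun j => isClosed_le continuous_const
      (Δ.S j).continuous_rho)).union (isCompact_iUnion fun j =>
      ((Δ.S j).isCompact_rho_le r).inter_right (isClosed_le continuous_const
        (Δ.S j).continuous_rho))
  have hK₁D : K₁ ⊆ Δ.dom := by
    rintro z (⟨hz, hz'⟩ | hz)
    · refine ⟨hKU hz, fun hc => ?_⟩
      obtain ⟨j, hj⟩ := mem_iUnion.1 hc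
      exact (Δ.S j).one_lt_rho_iff z |>.1 (hr1.trans_le (mem_iInter.1 hz' j)) hj
    · obtain ⟨j, hj1, hj2⟩ := mem_iUnion.1 hz
      exact SD.mem_dom_of_rho (j := j) (hr3.trans_le hj2) (le_trans hj1 hr2.le)
  obtain ⟨C₁, hC₁, hC⟩ := _root_.exists_harnackBound Δ.isOpen_dom Δ.isPreconnected_dom hK₁c hK₁D hz₀
  obtain ⟨C₂, hC₂, hC'⟩ := norm_le_of_im_limit hr1
  refine ⟨C₂ * C₁, by positivity, fun h hh h0 hl z hz => ?_⟩
  have hfin : ∀ ε > 0, ‖h z‖ ≤ C₂ * (C₁ * ‖h z₀‖ + ε) := by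
    intro ε hε
    have hM : 0 < C₁ * ‖h z₀‖ + ε := by positivity
    by_cases hzr : ∀ j, r ≤ (Δ.S j).rho z
    · have h1 := hC z (Or.inl ⟨hz.1, mem_iInter.2 hzr⟩) h hh h0
      nlinarith
    · push Not at hzr
      obtain ⟨j, hj⟩ := hzr
      obtain ⟨y, hy⟩ := hl j
      obtain ⟨ζ, hζ, rfl⟩ := (Δ.S j).exists_J' z
      have hζ1 : 1 < ‖ζ‖ := by
        rw [hζ, (Δ.S j).one_lt_rho_iff]
        exact fun hc => hz.2.2 (mem_iUnion.2 ⟨j, hc⟩)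
      refine hC' (h ∘ (Δ.S j).J) Δ.R y _ hr2 ?_ hy hM ?_ ζ hζ1 (hζ.trans_lt hj).le
      · exact (Δ.S j).differentiableOn_comp_J Δ.isOpen_dom hh fun ξ hξ => SD.J_mem_dom hξ
      · intro ξ h1 h2
        refine (hC _ (Or.inr (mem_iUnion.2 ⟨j, ?_, ?_⟩)) h hh h0).trans (by linarith)
        · change (Δ.S j).rho _ ≤ r
          rwa [(Δ.S j).rho_J (hr3.le.trans h1)]
        · change _ ≤ (Δ.S j).rho _
          rwa [(Δ.S j).rho_J (hr3.le.trans h1)]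
  refine le_of_forall_pos_le_add fun ε hε => ?_
  have hC₂' : 0 < C₂ := by linarith
  have := hfin (ε / C₂) (by positivity)
  rw [mul_add, mul_div_cancel₀ _ hC₂'.ne'] at this
  linarith

lemma exists_tendsto_of_norm_sub_le {a : ℝ → ℂ} {Λ : ℝ → ℝ} {s T : ℝ} (hs : s < T)
    (ha : ∀ t ∈ Ico s T, ∀ u ∈ Ico s T, t ≤ u → ‖a u - a t‖ ≤ Λ t)
    (hΛ : Tendsto Λ (𝓝[<] T) (𝓝 0)) :
    ∃ b, Tendsto a (𝓝[<] T) (𝓝 b) ∧ ∀ t ∈ Ico s T, ‖b - a t‖ ≤ Λ t := by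
  have hI : Ioo s T ∈ 𝓝[<] T := Ioo_mem_nhdsLT hs
  have hc : Cauchy (map a (𝓝[<] T)) := by
    rw [Metric.cauchy_iff]
    refine ⟨inferInstance, fun ε hε => ?_⟩
    obtain ⟨t, ht, htI⟩ := ((hΛ.eventually_lt_const (half_pos hε)).and hI).exists
    have htI' : t ∈ Ico s T := ⟨htI.1.le, htI.2⟩
    refine ⟨a '' Ico t T, image_mem_map (mem_of_superset (Ioo_mem_nhdsLT htI.2)
      Ioo_subset_Ico_self), ?_⟩
    rintro _ ⟨u, hu, rfl⟩ _ ⟨v, hv, rfl⟩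
    have h1 := ha t htI' u ⟨htI'.1.trans hu.1, hu.2⟩ hu.1
    have h2 := ha t htI' v ⟨htI'.1.trans hv.1, hv.2⟩ hv.1
    have h3 := dist_triangle_right (a u) (a v) (a t)
    rw [dist_eq_norm (a u) (a t), dist_eq_norm (a v) (a t)] at h3
    linarith
  obtain ⟨b, hb⟩ := cauchy_map_iff_exists_tendsto.1 hc
  refine ⟨b, hb, fun t ht => le_of_tendsto (hb.sub_const (a t)).norm ?_⟩
  filter_upwards [Ioo_mem_nhdsLT ht.2] with u hu
  exact ha t ht u ⟨ht.1.trans hu.1.le, hu.2⟩ hu.1.le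

/-- Limits of increasing families of maps, with control up to the slits. -/
lemma SD.exists_limit (Δ : SD) {g : ℝ → ℂ → ℂ} {s T H : ℝ} {Λ : ℝ → ℝ} (hs : s < T)
    (hH : HP H ⊆ Δ.dom) (hg : ∀ t ∈ Ico s T, Reg Δ (g t))
    (hmono : ∀ t ∈ Ico s T, ∀ u ∈ Ico s T, t ≤ u → ∀ z ∈ Δ.dom, (g t z).im ≤ (g u z).im)
    (hle : ∀ t ∈ Ico s T, ∀ u ∈ Ico s T, t ≤ u → ∀ z ∈ HP H, ‖g u z - g t z‖ * (z.im - H) ≤ Λ t)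
    (hΛ : Tendsto Λ (𝓝[<] T) (𝓝 0)) :
    ∃ f, Reg Δ f ∧ (∀ z ∈ Δ.dom, Tendsto (fun t => g t z) (𝓝[<] T) (𝓝 (f z))) ∧
      (∀ t ∈ Ico s T, ∀ z ∈ HP H, ‖f z - g t z‖ * (z.im - H) ≤ Λ t) ∧
      (∀ K, IsCompact K → K ⊆ UHP →
        ∃ C, ∀ t ∈ Ico s T, ∀ z ∈ K ∩ Δ.dom, ‖f z - g t z‖ ≤ C * Λ t) := by
  have hIoo : ∀ᶠ t in 𝓝[<] T, t ∈ Ico s T := by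
    filter_upwards [Ioo_mem_nhdsLT hs] with t ht
    exact ⟨ht.1.le, ht.2⟩
  obtain ⟨z₀, hz₀, hz₀'⟩ : ∃ z₀ : ℂ, z₀ ∈ HP H ∧ z₀.im - H = 1 :=
    ⟨((H + 1 : ℝ) : ℂ) * I, by change H < _; simp, by simp⟩
  have hK : ∀ K, IsCompact K → K ⊆ UHP → ∃ C, 0 ≤ C ∧ ∀ t ∈ Ico s T, ∀ u ∈ Ico s T, t ≤ u →
      ∀ z ∈ K ∩ Δ.dom, ‖g u z - g t z‖ ≤ C * Λ t := by
    intro K hKc hKU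
    obtain ⟨C, hC0, hC⟩ := Δ.exists_harnackBound hKc hKU (hH hz₀)
    refine ⟨C, hC0, fun t ht u hu htu z hz => (hC (fun z => g u z - g t z)
      ((hg u hu).holo.sub (hg t ht).holo) ?_ ?_ z hz).trans ?_⟩
    · intro z hz
      rw [sub_im, sub_nonneg]
      exact hmono t ht u hu htu z hz
    · intro j
      obtain ⟨y, hy⟩ := (hg u hu).lim j
      obtain ⟨y', hy'⟩ := (hg t ht).lim j
      exact ⟨y - y', by simpa using hy.sub hy'⟩
    · have := hle t ht u hu htu z₀ hz₀
      rw [hz₀', mul_one] at this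
      gcongr
  have hex : ∀ z ∈ Δ.dom, ∃ b, Tendsto (fun t => g t z) (𝓝[<] T) (𝓝 b) := by
    intro z hz
    obtain ⟨C, -, hC⟩ := hK {z} isCompact_singleton (singleton_subset_iff.2 hz.1)
    obtain ⟨b, hb, -⟩ := exists_tendsto_of_norm_sub_le (a := fun t => g t z) (Λ := fun t => C * Λ t)
      hs (fun t ht u hu htu => hC t ht u hu htu z ⟨rfl, hz⟩) (by simpa using hΛ.const_mul C)
    exact ⟨b, hb⟩
  choose! f hf using hex
  have hfK : ∀ K, IsCompact K → K ⊆ UHP →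
      ∃ C, ∀ t ∈ Ico s T, ∀ z ∈ K ∩ Δ.dom, ‖f z - g t z‖ ≤ C * Λ t := by
    intro K hKc hKU
    obtain ⟨C, -, hC⟩ := hK K hKc hKU
    refine ⟨C, fun t ht z hz => le_of_tendsto ((hf z hz.2).sub_const (g t z)).norm ?_⟩
    filter_upwards [Ioo_mem_nhdsLT ht.2] with u hu
    exact hC t ht u ⟨ht.1.trans hu.1.le, hu.2⟩ hu.1.le z hz
  have hfH : ∀ t ∈ Ico s T, ∀ z ∈ HP H, ‖f z - g t z‖ * (z.im - H) ≤ Λ t := by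
    intro t ht z hz
    refine le_of_tendsto (((hf z (hH hz)).sub_const (g t z)).norm.mul_const _) ?_
    filter_upwards [Ioo_mem_nhdsLT ht.2] with u hu
    exact hle t ht u ⟨ht.1.trans hu.1.le, hu.2⟩ hu.1.le z hz
  have hloc : TendstoLocallyUniformlyOn g f (𝓝[<] T) Δ.dom := by
    rw [tendstoLocallyUniformlyOn_iff_forall_isCompact Δ.isOpen_dom]
    intro K hKD hKc
    obtain ⟨C, hC⟩ := hfK K hKc (hKD.trans fun z hz => hz.1)
    rw [Metric.tendstoUniformlyOn_iff]
    intro ε hε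
    have : Tendsto (fun t => C * Λ t) (𝓝[<] T) (𝓝 0) := by simpa using hΛ.const_mul C
    filter_upwards [this.eventually_lt_const hε, hIoo] with t ht htI z hz
    rw [dist_eq_norm]
    exact (hC t htI z ⟨hz, hKD hz⟩).trans_lt ht
  have hfd : DifferentiableOn ℂ f Δ.dom := hloc.differentiableOn
    (hIoo.mono fun t ht => (hg t ht).holo) Δ.isOpen_dom
  have him : ∀ z ∈ Δ.dom, z.im ≤ (f z).im := fun z hz =>
    ge_of_tendsto ((Complex.continuous_im.tendsto _).comp (hf z hz))
      (hIoo.mono fun t ht => (hg t ht).im_le hz)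
  have h1 : SatisfiesH1 Δ.dom f := by
    have hU : HP (H + 1) ⊆ HP H := fun z (hz : H + 1 < z.im) => by
      change H < z.im
      linarith
    refine ⟨max 0 (H + 1), le_max_left _ _, fun z hz => hH (hU (show H + 1 < z.im from (le_max_right _ _).trans_lt hz)), ?_⟩
    have key : Tendsto (fun z => f z - z) (cobounded ℂ ⊓ 𝓟 (HP (H + 1))) (𝓝 0) := by
      rw [Metric.tendsto_nhds]
      intro ε hε
      obtain ⟨t, ht, htI⟩ := ((hΛ.eventually_lt_const (half_pos hε)).and hIoo).exists
      obtain ⟨η, hη0, hηD, hη⟩ := (hg t htI).h1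
      have h2 := tendsto_zero_of_tendsto_high (((hg t htI).holo.mono hH).sub differentiableOn_id)
        (fun z hz => by
          change 0 ≤ (g t z - z).im
          rw [sub_im, sub_nonneg]
          exact (hg t htI).im_le (hH hz)) hη
      filter_upwards [h2.eventually (ball_mem_nhds 0 (half_pos hε)),
        mem_inf_of_right (mem_principal_self (HP (H + 1)))] with z hz (hzH : H + 1 < z.im)
      have h3 := hfH t htI z (hU hzH)
      have h4 : ‖f z - g t z‖ ≤ ‖f z - g t z‖ * (z.im - H) :=
        le_mul_of_one_le_right (norm_nonneg _) (by linarith)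
      rw [dist_zero_right] at hz ⊢
      have h5 := norm_add_le (f z - g t z) (g t z - z)
      rw [sub_add_sub_cancel] at h5
      change ‖g t z - z‖ < _ at hz
      linarith
    exact key.mono_left (inf_le_inf_left _ (principal_mono.2 fun z hz =>
      show H + 1 < z.im from lt_of_le_of_lt (le_max_right _ _) hz))
  refine ⟨f, ⟨hfd, ?_, fun z hz => hz.1.trans_le (him z hz), h1, ?_⟩, hf, hfH, hfK⟩
  · obtain ⟨η, hη0, hηD, hη⟩ := h1.exists_bound
    obtain ⟨K, hK1⟩ := hη 1 one_pos
    obtain ⟨p, hp, hpK⟩ := exists_high η K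
    have hq : p + (2 : ℝ) * I ∈ HP η := by
      change η < _
      simp
      linarith
    obtain ⟨q, hq, hqK⟩ := exists_high η (max K (‖p‖ + 2))
    refine injOn_of_tendstoLocallyUniformlyOn Δ.isOpen_dom Δ.isPreconnected_dom
      (hIoo.mono fun t ht => (hg t ht).holo) (hIoo.mono fun t ht => (hg t ht).inj) hloc
      (hηD hp) (hηD hq) fun heq => ?_
    have e1 := hK1 p hp hpK
    have e2 := hK1 q hq ((le_max_left _ _).trans_lt hqK)
    have e3 := (le_max_right _ _).trans_lt hqK
    have e4 := norm_le_norm_add_norm_sub' q p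
    have e5 : q - p = (f p - p) - (f q - q) := by rw [heq]; ring
    have e6 := norm_sub_le (f p - p) (f q - q)
    rw [← e5] at e6
    linarith
  · intro j
    rw [← cauchy_map_iff_exists_tendsto, Metric.cauchy_iff]
    refine ⟨inferInstance, fun ε hε => ?_⟩
    obtain ⟨r, hr1, hr2⟩ := exists_between Δ.hR
    have hKU : {z | (Δ.S j).rho z ≤ r} ⊆ UHP := by
      intro z hz
      by_cases hc : z ∈ (Δ.S j).carrier
      · exact (Δ.S j).carrier_subset_UHP hc
      · exact (SD.mem_dom_of_rho (((Δ.S j).one_lt_rho_iff z).2 hc) (le_trans hz hr2.le)).1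
    obtain ⟨C, hC⟩ := hfK _ ((Δ.S j).isCompact_rho_le r) hKU
    have h2 : Tendsto (fun t => C * Λ t) (𝓝[<] T) (𝓝 0) := by simpa using hΛ.const_mul C
    obtain ⟨t, ht, htI⟩ := ((h2.eventually_lt_const (by positivity : 0 < ε / 4)).and hIoo).exists
    obtain ⟨y, hy⟩ := (hg t htI).lim j
    refine ⟨(fun ζ => (f ((Δ.S j).J ζ)).im) '' {ζ | |(f ((Δ.S j).J ζ)).im - y| < ε / 2},
      image_mem_map ?_, ?_⟩
    · filter_upwards [hy.eventually (ball_mem_nhds y (by positivity : 0 < ε / 4)),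
        Ann_mem_Lf hr1] with ζ hζ hζr
      have h3 := hC t htI ((Δ.S j).J ζ) ⟨by
        change (Δ.S j).rho _ ≤ r
        rw [(Δ.S j).rho_J hζr.1.le]
        exact hζr.2.le, SD.J_mem_dom ⟨hζr.1, hζr.2.trans hr2⟩⟩
      have h4 := (Complex.abs_im_le_norm _).trans h3
      rw [sub_im] at h4
      rw [Real.dist_eq] at hζ
      change |(f _).im - y| < _
      have h5 := abs_sub_le (f ((Δ.S j).J ζ)).im (g t ((Δ.S j).J ζ)).im y
      linarith
    · rintro _ ⟨ζ, hζ, rfl⟩ _ ⟨ξ, hξ, rfl⟩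
      have h5 := dist_triangle_right (f ((Δ.S j).J ζ)).im (f ((Δ.S j).J ξ)).im y
      rw [Real.dist_eq _ y, Real.dist_eq _ y] at h5
      change |(f _).im - y| < _ at hζ hξ
      change dist (f _).im (f _).im < ε
      linarith

/-- A path connected space which is homotopy dominated by a simply connected space is simply
connected. -/
lemma simplyConnectedSpace_of_dominated {X Y : Type*} [TopologicalSpace X] [TopologicalSpace Y]
    [PathConnectedSpace X] [SimplyConnectedSpace Y] (a : C(X, Y)) (b : C(Y, X))
    (h : (ContinuousMap.id X).Homotopic (b.comp a)) : SimplyConnectedSpace X := by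
  obtain ⟨F⟩ := h
  rw [simply_connected_iff_paths_homotopic']
  refine ⟨inferInstance, fun {x y} p q => ?_⟩
  have hpq : ((p.map (b.comp a).continuous)).Homotopic (q.map (b.comp a).continuous) :=
    (SimplyConnectedSpace.paths_homotopic (p.map a.continuous) (q.map a.continuous)).map b
  have hp := Path.Homotopic.map_trans_evalAt F p
  have hq := Path.Homotopic.map_trans_evalAt F q
  rw [← Path.Homotopic.Quotient.eq] at hpq hp hq ⊢
  simp only [Path.Homotopic.Quotient.mk_trans] at hp hq
  rw [hpq, ← hq] at hp
  have h2 := congrArg (fun u => u.trans (Path.Homotopic.Quotient.mk (F.evalAt y)).symm) hp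
  simpa using h2

lemma isSimplyConnected_of_dominated {U V : Set ℂ} (hUo : IsOpen U) (hU : IsConnected U)
    (hV : IsSimplyConnected V) {a b : ℂ → ℂ} (ha : ContinuousOn a U) (hb : ContinuousOn b V)
    (haU : MapsTo a U V) (hbV : MapsTo b V U) (h : ∀ w ∈ U, segment ℝ w (b (a w)) ⊆ U) :
    IsSimplyConnected U := by
  have : PathConnectedSpace U :=
    isPathConnected_iff_pathConnectedSpace.1 (hUo.isConnected_iff_isPathConnected.1 hU)
  have : SimplyConnectedSpace V := hV
  set A : C(U, V) := ⟨haU.restrict a U V, ha.mapsToRestrict haU⟩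
  set B : C(V, U) := ⟨hbV.restrict b V U, hb.mapsToRestrict hbV⟩
  have hF : ∀ p : unitInterval × U, AffineMap.lineMap (k := ℝ) (p.2 : ℂ) (b (a p.2)) (p.1 : ℝ) ∈ U :=
    fun p => h p.2 p.2.2 (by
      rw [segment_eq_image_lineMap]
      exact ⟨_, p.1.2, rfl⟩)
  have hc : Continuous fun w : U => b (a w) :=
    continuous_subtype_val.comp (B.comp A).continuous
  refine simplyConnectedSpace_of_dominated A B ⟨⟨⟨fun p => ⟨_, hF p⟩, ?_⟩, ?_, ?_⟩⟩
  · refine Continuous.subtype_mk ?_ _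
    simp only [AffineMap.lineMap_apply, vsub_eq_sub, vadd_eq_add]
    have h1 : Continuous fun p : unitInterval × U => (p.1 : ℝ) :=
      continuous_subtype_val.comp continuous_fst
    have h2 : Continuous fun p : unitInterval × U => (p.2 : ℂ) :=
      continuous_subtype_val.comp continuous_snd
    exact (h1.smul ((hc.comp continuous_snd).sub h2)).add h2
  · intro w
    exact Subtype.ext (by simp)
  · intro w
    exact Subtype.ext (by simp [A, B])

/-- The point `w` lies on the image of the `r`-neighbourhood of the `j`-th slit under `f`. -/
def SD.Near (Δ : SD) (j : Fin Δ.N) (f : ℂ → ℂ) (r : ℝ) (w : ℂ) : Prop :=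
  w ∈ (Δ.S j).cl f ∨ ∃ z ∈ Δ.dom, (Δ.S j).rho z ≤ r ∧ f z = w

namespace Reg

variable {Δ : SD} {f g : ℂ → ℂ} {j : Fin Δ.N}

lemma mem_fill_of_near {r : ℝ} {w : ℂ} (hw : Δ.Near j f r w) :
    w ∈ f '' Δ.dom ∪ slitCluster Δ.dom f := by
  rcases hw with hw | ⟨z, hz, -, rfl⟩
  · rw [slitCluster_eq_iUnion]
    exact Or.inr (mem_iUnion.2 ⟨j, hw⟩)
  · exact Or.inl ⟨z, hz, rfl⟩

lemma exists_near_of_mem {w : ℂ} (hw : w ∈ slitCluster Δ.dom f) (r : ℝ) :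
    ∃ j, Δ.Near j f r w := by
  rw [slitCluster_eq_iUnion] at hw
  obtain ⟨j, hj⟩ := mem_iUnion.1 hw
  exact ⟨j, Or.inl hj⟩

lemma wind_of_near (hf : Reg Δ f) {r r' : ℝ} (hr : r < r') (h1 : 1 < r') (h2 : r' < Δ.R) {w : ℂ}
    (hw : Δ.Near j f r w) : wind (f ∘ (Δ.S j).J) r' w = 2 * Real.pi * I := by
  rcases hw with hw | ⟨z, hz, hzr, rfl⟩
  · exact (hf.isChart j).wind_of_mem_cl hw h1 h2
  · exact ((hf.isChart j).index hz h1 h2).2 (hzr.trans_lt hr)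

/-- Points close to the image of a neighbourhood of a slit under `f` are in the image of a slightly
larger neighbourhood under any map close to `f`. -/
lemma near_of_close (hf : Reg Δ f) (hg : Reg Δ g) {r r' d ε : ℝ} (hr : r < r') (h1 : 1 < r')
    (h2 : r' < Δ.R) {p w : ℂ} (hp : Δ.Near j f r p)
    (hd : ∀ ζ, ‖ζ‖ = r' → d ≤ ‖f ((Δ.S j).J ζ) - p‖)
    (hε : ∀ ζ, ‖ζ‖ = r' → ‖g ((Δ.S j).J ζ) - f ((Δ.S j).J ζ)‖ ≤ ε) (hw : ‖w - p‖ + ε < d) :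
    Δ.Near j g r' w := by
  have hwind : wind (g ∘ (Δ.S j).J) r' w = 2 * Real.pi * I := by
    rw [← hf.wind_of_near hr h1 h2 hp]
    refine wind_eq_of_leash (hf.isChart j).holo_comp (hg.isChart j).holo_comp h1 h2 fun ζ hζ => ?_
    rw [mem_sphere_zero_iff_norm] at hζ
    have e1 := hd ζ hζ
    have e2 := hε ζ hζ
    have e3 : (g ∘ (Δ.S j).J) ζ - w - ((f ∘ (Δ.S j).J) ζ - p) =
        (g ((Δ.S j).J ζ) - f ((Δ.S j).J ζ)) - (w - p) := by
      simp only [Function.comp_apply]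
      ring
    have e4 := norm_sub_le (g ((Δ.S j).J ζ) - f ((Δ.S j).J ζ)) (w - p)
    rw [e3]
    change _ < ‖f ((Δ.S j).J ζ) - p‖
    linarith
  by_contra hcon
  have hcl : w ∉ (Δ.S j).cl g := fun h => hcon (Or.inl h)
  have hne : wind (g ∘ (Δ.S j).J) r' w ≠ 0 := by
    rw [hwind]
    exact mul_ne_zero (mul_ne_zero two_ne_zero (ofReal_ne_zero.2 Real.pi_ne_zero)) I_ne_zero
  by_cases hwg : w ∈ g '' Δ.dom
  · obtain ⟨q, hq, rfl⟩ := hwg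
    rcases lt_or_ge r' ((Δ.S j).rho q) with h3 | h3
    · exact hne (((hg.isChart j).index hq h1 h2).1 h3)
    · exact hcon (Or.inr ⟨q, hq, h3, rfl⟩)
  · exact hne ((hg.isChart j).wind_eq_zero_of_convex (hg.convex_cl j) hcl hwg h1 h2)

lemma exists_separation (hf : Reg Δ f) (j : Fin Δ.N) {r r' : ℝ} (hr : r < r') (h1 : 1 < r')
    (h2 : r' < Δ.R) :
    ∃ d > 0, ∀ p, Δ.Near j f r p → ∀ ζ, ‖ζ‖ = r' → d ≤ ‖f ((Δ.S j).J ζ) - p‖ := by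
  have hK : IsCompact ((f ∘ (Δ.S j).J) '' sphere 0 r') :=
    (isCompact_sphere 0 r').image_of_continuousOn ((hf.isChart j).holo_comp.continuousOn.mono
      fun ζ hζ => mem_Ann_of_sphere h1 h2 hζ)
  have hO : IsOpen (f '' (Δ.dom ∩ {z | r < (Δ.S j).rho z})) :=
    isOpen_image_of_injOn Δ.isOpen_dom hf.holo hf.inj
      (Δ.isOpen_dom.inter (isOpen_lt continuous_const (Δ.S j).continuous_rho)) inter_subset_left
  obtain ⟨d, hd, hsub⟩ := hK.exists_thickening_subset_open hO (by
    rintro _ ⟨ζ, hζ, rfl⟩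
    refine ⟨_, ⟨SD.J_mem_dom (mem_Ann_of_sphere h1 h2 hζ), ?_⟩, rfl⟩
    rw [mem_sphere_zero_iff_norm] at hζ
    change r < (Δ.S j).rho _
    rwa [(Δ.S j).rho_J (by rw [hζ]; exact h1.le), hζ])
  refine ⟨d, hd, fun p hp ζ hζ => ?_⟩
  by_contra! hlt
  obtain ⟨q, ⟨hq, hqr⟩, rfl⟩ := hsub (mem_thickening_iff.2
    ⟨_, ⟨ζ, mem_sphere_zero_iff_norm.2 hζ, rfl⟩, by rwa [dist_comm, dist_eq_norm]⟩)
  rcases hp with hp | ⟨z, hz, hzr, he⟩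
  · exact (hf.isChart j).notMem_image_of_mem_cl hp ⟨q, hq, rfl⟩
  · rw [hf.inj hz hq he] at hzr
    exact absurd hqr (not_lt.2 hzr)

/-- Continuous interpolation between the identity near the slits and `g ∘ f⁻¹` away from them. -/
def patch (Δ : SD) (χ : ℂ → ℝ) (f g : ℂ → ℂ) (w : ℂ) : ℂ :=
  open scoped Classical in
  if w ∈ f '' Δ.dom then
    w + χ (Function.invFunOn f Δ.dom w) * (g (Function.invFunOn f Δ.dom w) - w)
  else w

lemma patch_apply (hf : Reg Δ f) (χ : ℂ → ℝ) {z : ℂ} (hz : z ∈ Δ.dom) :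
    patch Δ χ f g (f z) = f z + χ z * (g z - f z) := by
  rw [patch, if_pos ⟨z, hz, rfl⟩, hf.inj.leftInvOn_invFunOn hz]

lemma patch_of_notMem (χ : ℂ → ℝ) {w : ℂ} (hw : w ∉ f '' Δ.dom) : patch Δ χ f g w = w :=
  if_neg hw

lemma continuousOn_patch (hf : Reg Δ f) (hg : Reg Δ g) {χ : ℂ → ℝ} (hχ : Continuous χ) {r : ℝ}
    (h1 : 1 < r) (h2 : r < Δ.R) (hχ0 : ∀ j z, (Δ.S j).rho z ≤ r → χ z = 0) :
    ContinuousOn (patch Δ χ f g) (f '' Δ.dom ∪ slitCluster Δ.dom f) := by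
  rintro w (hw | hw)
  · refine ContinuousAt.continuousWithinAt ?_
    have hO : IsOpen (f '' Δ.dom) :=
      isOpen_image_of_injOn Δ.isOpen_dom hf.holo hf.inj Δ.isOpen_dom subset_rfl
    have hi := (differentiableOn_invFunOn Δ.isOpen_dom hf.holo hf.inj).continuousOn
    have hm : MapsTo (Function.invFunOn f Δ.dom) (f '' Δ.dom) Δ.dom :=
      fun w hw => Function.invFunOn_mem hw
    have hc : ContinuousOn (fun w => w + χ (Function.invFunOn f Δ.dom w) *
        (g (Function.invFunOn f Δ.dom w) - w)) (f '' Δ.dom) :=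
      continuousOn_id.add ((continuous_ofReal.comp_continuousOn (hχ.comp_continuousOn hi)).mul
        ((hg.holo.continuousOn.comp hi hm).sub continuousOn_id))
    refine (hc.continuousAt (hO.mem_nhds hw)).congr ?_
    filter_upwards [hO.mem_nhds hw] with v hv
    exact (if_pos hv).symm
  · refine ContinuousAt.continuousWithinAt ?_
    rw [slitCluster_eq_iUnion] at hw
    obtain ⟨j, hj⟩ := mem_iUnion.1 hw
    refine continuousAt_id.congr ?_
    filter_upwards [((hf.isChart j).isOpen_fill (hf.convex_cl j) h1 h2).mem_nhds (Or.inr hj)]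
      with v hv
    rcases hv with ⟨z, ⟨hz, hzr⟩, rfl⟩ | hv
    · rw [hf.patch_apply χ hz, hχ0 j z (le_of_lt hzr)]
      simp
    · exact (patch_of_notMem χ ((hf.isChart j).notMem_image_of_mem_cl hv)).symm

lemma norm_patch_sub_le (hf : Reg Δ f) {χ : ℂ → ℝ} (hχ : ∀ z, χ z ∈ Icc (0 : ℝ) 1) {r ε : ℝ}
    (hε0 : 0 ≤ ε) (hε : ∀ z ∈ Δ.dom, (Δ.S j).rho z ≤ r → ‖g z - f z‖ ≤ ε) {w : ℂ}
    (hw : Δ.Near j f r w) : ‖patch Δ χ f g w - w‖ ≤ ε := by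
  rcases hw with hw | ⟨z, hz, hzr, rfl⟩
  · rw [patch_of_notMem χ ((hf.isChart j).notMem_image_of_mem_cl hw), sub_self, norm_zero]
    exact hε0
  · rw [hf.patch_apply χ hz, add_sub_cancel_left, norm_mul, Complex.norm_real,
      Real.norm_of_nonneg (hχ z).1]
    exact (mul_le_of_le_one_left (norm_nonneg _) (hχ z).2).trans (hε z hz hzr)

lemma mapsTo_patch (hf : Reg Δ f) (hg : Reg Δ g) {χ : ℂ → ℝ} (hχ : ∀ z, χ z ∈ Icc (0 : ℝ) 1)
    {r r' d ε : ℝ} (hr : r < r') (h1 : 1 < r') (h2 : r' < Δ.R)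
    (hχ1 : ∀ z, (∀ j, r ≤ (Δ.S j).rho z) → χ z = 1)
    (hd : ∀ j p, Δ.Near j f r p → ∀ ζ, ‖ζ‖ = r' → d ≤ ‖f ((Δ.S j).J ζ) - p‖)
    (hε0 : 0 ≤ ε) (hε : ∀ j, ∀ z ∈ Δ.dom, (Δ.S j).rho z ≤ r' → ‖g z - f z‖ ≤ ε)
    (hdε : 2 * ε < d) :
    MapsTo (patch Δ χ f g) (f '' Δ.dom ∪ slitCluster Δ.dom f)
      (g '' Δ.dom ∪ slitCluster Δ.dom g) ∧
    ∀ j w, Δ.Near j f r w → Δ.Near j g r' (patch Δ χ f g w) := by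
  have hnear : ∀ j w, Δ.Near j f r w → Δ.Near j g r' (patch Δ χ f g w) := by
    intro j w hw
    have h3 := hf.norm_patch_sub_le hχ hε0 (fun z hz hzr => hε j z hz (hzr.trans hr.le)) hw
    refine hf.near_of_close hg (ε := ε) hr h1 h2 hw (hd j w hw) (fun ζ hζ => ?_) (by linarith)
    have hζ1 : 1 < ‖ζ‖ := by rwa [hζ]
    exact hε j _ (SD.J_mem_dom ⟨hζ1, by rwa [hζ]⟩) (by rw [(Δ.S j).rho_J hζ1.le, hζ])
  refine ⟨?_, hnear⟩
  have hmem : ∀ w, (∃ j, Δ.Near j f r w) →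
      patch Δ χ f g w ∈ g '' Δ.dom ∪ slitCluster Δ.dom g :=
    fun w ⟨j, hj⟩ => mem_fill_of_near (hnear j w hj)
  rintro w (⟨z, hz, rfl⟩ | hw)
  · by_cases hzr : ∀ j, r ≤ (Δ.S j).rho z
    · rw [hf.patch_apply χ hz, hχ1 z hzr, ofReal_one, one_mul, add_sub_cancel]
      exact Or.inl ⟨z, hz, rfl⟩
    · push Not at hzr
      obtain ⟨j, hj⟩ := hzr
      exact hmem _ ⟨j, Or.inr ⟨z, hz, hj.le, rfl⟩⟩
  · exact hmem _ (exists_near_of_mem hw r)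

/-- Simple connectedness of the filled image is inherited by limits. -/
lemma isSimplyConnected_fill (hf : Reg Δ f) {r : ℝ} (hr1 : 1 < r) (hr2 : r < Δ.R)
    (h : ∀ ε > 0, ∃ g, Reg Δ g ∧ IsSimplyConnected (g '' Δ.dom ∪ slitCluster Δ.dom g) ∧
      ∀ j, ∀ z ∈ Δ.dom, (Δ.S j).rho z ≤ r → ‖g z - f z‖ ≤ ε) :
    IsSimplyConnected (f '' Δ.dom ∪ slitCluster Δ.dom f) := by
  obtain ⟨r₂, hr₂, hr₂'⟩ := exists_between hr1
  obtain ⟨r₁, hr₁, hr₁'⟩ := exists_between hr₂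
  choose d' hd'0 hd' using fun j => hf.exists_separation j hr₂' hr1 hr2
  obtain ⟨d, hd0, hd⟩ : ∃ d > 0, ∀ j, d ≤ d' j := by
    rcases isEmpty_or_nonempty (Fin Δ.N) with he | he
    · exact ⟨1, one_pos, fun j => he.elim j⟩
    · obtain ⟨i, hi⟩ := Finite.exists_min d'
      exact ⟨d' i, hd'0 i, hi⟩
  obtain ⟨g, hg, hgsc, hfg⟩ := h (d / 8) (by positivity)
  have hε0 : 0 ≤ d / 8 := by positivity
  have hgf : ∀ j, ∀ z ∈ Δ.dom, (Δ.S j).rho z ≤ r → ‖f z - g z‖ ≤ d / 8 := fun j z hz hzr => by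
    rw [norm_sub_rev]
    exact hfg j z hz hzr
  have hsepf : ∀ j p, Δ.Near j f r₂ p → ∀ ζ, ‖ζ‖ = r → d ≤ ‖f ((Δ.S j).J ζ) - p‖ :=
    fun j p hp ζ hζ => (hd j).trans (hd' j p hp ζ hζ)
  have hJ : ∀ j ζ, 1 < ‖ζ‖ → ‖ζ‖ ≤ r →
      (Δ.S j).J ζ ∈ Δ.dom ∧ (Δ.S j).rho ((Δ.S j).J ζ) = ‖ζ‖ := fun j ζ hζ hζr =>
    ⟨SD.J_mem_dom ⟨hζ, hζr.trans_lt hr2⟩, (Δ.S j).rho_J hζ.le⟩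
  have hsepg' : ∀ j, ∀ z ∈ Δ.dom, (Δ.S j).rho z ≤ r₂ → ∀ ζ, ‖ζ‖ = r →
      d * (3 / 4) ≤ ‖g ((Δ.S j).J ζ) - g z‖ := by
    intro j z hz hzr ζ hζ
    obtain ⟨hζ1, hζ2⟩ := hJ j ζ (by rwa [hζ]) hζ.le
    have e1 := hsepf j _ (Or.inr ⟨z, hz, hzr, rfl⟩) ζ hζ
    have e2 := hfg j z hz (hzr.trans hr₂'.le)
    have e3 := hgf j _ hζ1 (hζ2.trans hζ).le
    have e4 := norm_add₃_le (a := f ((Δ.S j).J ζ) - g ((Δ.S j).J ζ))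
      (b := g ((Δ.S j).J ζ) - g z) (c := g z - f z)
    rw [sub_add_sub_cancel, sub_add_sub_cancel] at e4
    linarith
  have hsepg : ∀ j p, Δ.Near j g r₂ p → ∀ ζ, ‖ζ‖ = r → d * (3 / 4) ≤ ‖g ((Δ.S j).J ζ) - p‖ := by
    rintro j p (hp | ⟨z, hz, hzr, rfl⟩) ζ hζ
    · by_contra! hlt
      have hO : IsOpen {w | ‖g ((Δ.S j).J ζ) - w‖ < d * (3 / 4)} :=
        isOpen_lt (by fun_prop) continuous_const
      obtain ⟨ξ, hξ, hA⟩ := ((mapClusterPt_iff_frequently.1 hp) _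
        (hO.mem_nhds hlt)).and_eventually (Ann_mem_Lf hr₂) |>.exists
      obtain ⟨h3, h4⟩ := hJ j ξ hA.1 (hA.2.trans hr₂').le
      exact absurd hξ (not_lt.2 (hsepg' j _ h3 (h4.trans_le hA.2.le) ζ hζ))
    · exact hsepg' j z hz hzr ζ hζ
  obtain ⟨χ, hχ0, hχ1, hχ⟩ := exists_continuous_zero_one_of_isClosed
    (s := ⋃ j, {z | (Δ.S j).rho z ≤ r₁}) (t := ⋂ j, {z | r₂ ≤ (Δ.S j).rho z})
    (isClosed_iUnion_of_finite fun j => isClosed_le (Δ.S j).continuous_rho continuous_const)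
    (isClosed_iInter fun j => isClosed_le continuous_const (Δ.S j).continuous_rho) (by
      rw [Set.disjoint_left]
      intro z hz hz'
      obtain ⟨j, hj⟩ := mem_iUnion.1 hz
      have h3 : r₂ ≤ (Δ.S j).rho z := mem_iInter.1 hz' j
      have h4 : (Δ.S j).rho z ≤ r₁ := hj
      linarith)
  have hχ0' : ∀ j z, (Δ.S j).rho z ≤ r₁ → χ z = 0 :=
    fun j z hz => hχ0 (mem_iUnion.2 ⟨j, hz⟩)
  have hχ1' : ∀ z, (∀ j, r₂ ≤ (Δ.S j).rho z) → χ z = 1 := fun z hz => hχ1 (mem_iInter.2 hz)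
  have hr₁R : r₁ < Δ.R := hr₁'.trans (hr₂'.trans hr2)
  obtain ⟨ha, hna⟩ := hf.mapsTo_patch hg hχ hr₂' hr1 hr2 hχ1' hsepf hε0 hfg (by linarith)
  obtain ⟨hb, -⟩ := hg.mapsTo_patch hf hχ hr₂' hr1 hr2 hχ1' hsepg hε0 hgf (by linarith)
  have hconn : IsConnected (f '' Δ.dom ∪ slitCluster Δ.dom f) := by
    obtain ⟨η, -, hη, -⟩ := hf.h1
    obtain ⟨z, hz, -⟩ := exists_high η 0
    exact ⟨⟨f z, Or.inl ⟨z, hη hz, rfl⟩⟩, hf.isPreconnected_fill⟩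
  have hnear : ∀ j w, Δ.Near j f r₂ w →
      segment ℝ w (patch Δ χ g f (patch Δ χ f g w)) ⊆ f '' Δ.dom ∪ slitCluster Δ.dom f := by
    intro j w hw v hv
    have e1 := hf.norm_patch_sub_le hχ hε0 (fun z hz hzr => hfg j z hz (hzr.trans hr₂'.le)) hw
    have e2 := hg.norm_patch_sub_le hχ hε0 (hgf j) (hna j w hw)
    have e3 := norm_sub_le_of_mem_segment hv
    have e4 := norm_add_le (patch Δ χ g f (patch Δ χ f g w) - patch Δ χ f g w)
      (patch Δ χ f g w - w)
    rw [sub_add_sub_cancel] at e4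
    refine mem_fill_of_near (hf.near_of_close hf hr₂' hr1 hr2 hw (hsepf j w hw)
      (ε := 0) (fun ζ _ => by simp) ?_)
    linarith
  refine isSimplyConnected_of_dominated hf.isOpen_fill hconn hgsc
    (hf.continuousOn_patch hg χ.continuous hr₁ hr₁R hχ0')
    (hg.continuousOn_patch hf χ.continuous hr₁ hr₁R hχ0') ha hb ?_
  rintro w (⟨z, hz, rfl⟩ | hw)
  · by_cases hzr : ∀ j, r₂ ≤ (Δ.S j).rho z
    · rw [hf.patch_apply χ hz, hχ1' z hzr, ofReal_one, one_mul, add_sub_cancel,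
        hg.patch_apply χ hz, hχ1' z hzr, ofReal_one, one_mul, add_sub_cancel, segment_same]
      exact singleton_subset_iff.2 (Or.inl ⟨z, hz, rfl⟩)
    · push Not at hzr
      obtain ⟨j, hj⟩ := hzr
      exact hnear j _ (Or.inr ⟨z, hz, hj.le, rfl⟩)
  · obtain ⟨j, hj⟩ := exists_near_of_mem hw r₂
    exact hnear j w hj

end Reg

lemma isHHull_empty : IsHHull ∅ := by
  have hne : UHP.Nonempty := ⟨I, by change 0 < I.im; simp⟩
  refine ⟨empty_subset _, by simp, ?_, ?_⟩
  · rw [sdiff_empty]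
    exact ⟨hne, convex_UHP.isPreconnected⟩
  · rw [sdiff_empty]
    have := convex_UHP.contractibleSpace hne
    infer_instance

lemma Reg.isHHull {Δ : SD} {f : ℂ → ℂ} (hf : Reg Δ f)
    (h : IsSimplyConnected (f '' Δ.dom ∪ slitCluster Δ.dom f)) :
    IsHHull ((UHP \ slitCluster Δ.dom f) \ f '' Δ.dom) := by
  have e : UHP \ ((UHP \ slitCluster Δ.dom f) \ f '' Δ.dom) =
      f '' Δ.dom ∪ slitCluster Δ.dom f := by
    ext w
    constructor
    · rintro ⟨h1, h2⟩
      by_contra hcon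
      rw [mem_union, not_or] at hcon
      exact h2 ⟨⟨h1, hcon.2⟩, hcon.1⟩
    · intro hw
      refine ⟨hf.fill_subset_UHP hw, fun hc => ?_⟩
      exact hw.elim hc.2 hc.1.2
  refine ⟨fun w hw => hw.1.1, ?_, ?_, ?_⟩
  · rintro w ⟨hw, hwU⟩
    by_contra hcon
    have hmem : w ∈ f '' Δ.dom ∪ slitCluster Δ.dom f := e ▸ ⟨hwU, hcon⟩
    obtain ⟨v, hv1, hv2⟩ := mem_closure_iff.1 hw _ hf.isOpen_fill hmem
    rw [← e] at hv1
    exact hv1.2 hv2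
  · rw [e]
    obtain ⟨η, -, hη, -⟩ := hf.h1
    obtain ⟨z, hz, -⟩ := exists_high η 0
    exact ⟨⟨f z, Or.inl ⟨z, hη hz, rfl⟩⟩, hf.isPreconnected_fill⟩
  · rw [e]
    exact h

lemma IsSlitMap.isSimplyConnected_fill {Δ Δ' : SD} {f : ℂ → ℂ} (h : IsSlitMap Δ Δ' f) :
    IsSimplyConnected (f '' Δ.dom ∪ slitCluster Δ.dom f) := by
  have e : UHP \ (Δ'.dom \ f '' Δ.dom) = f '' Δ.dom ∪ slitCluster Δ.dom f := by
    rw [h.slitCluster_eq]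
    ext w
    constructor
    · rintro ⟨h1, h2⟩
      by_contra hcon
      rw [mem_union, not_or] at hcon
      exact h2 ⟨by_contra fun hw => hcon.2 ⟨h1, hw⟩, hcon.1⟩
    · rintro (hw | hw)
      · obtain ⟨z, hz, rfl⟩ := hw
        exact ⟨(h.mapsTo hz).1, fun hc => hc.2 ⟨z, hz, rfl⟩⟩
      · exact ⟨hw.1, fun hc => hw.2 hc.1⟩
  rw [← e]
  exact h.h3.2.2.2

lemma slitCluster_eq_of_comp {Δ Δ' : SD} {f g k : ℂ → ℂ} (h : IsSlitMap Δ Δ' g)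
    (hk : ∀ z ∈ Δ.dom, k z = f (g z)) : slitCluster Δ.dom k = slitCluster Δ'.dom f := by
  have e : EqOn k (f ∘ g) Δ.dom := hk
  rw [slitCluster_congr e]
  ext w
  change ClusterPt w (map (f ∘ g) _) ↔ ClusterPt w (map f _)
  rw [← Filter.map_map, h.map_slitFilter]

lemma satisfiesH2_of_tendsto {f : ℂ → ℂ} {g : ℝ → ℂ → ℂ} {c : ℝ → ℂ} {b : ℂ} {Λ : ℝ → ℝ}
    {l : Filter ℝ} [l.NeBot] {H : ℝ} (hg : ∀ᶠ t in l, SatisfiesH2 (g t) (c t))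
    (hc : Tendsto c l (𝓝 b)) (hΛ : Tendsto Λ l (𝓝 0))
    (hle : ∀ᶠ t in l, ∀ z ∈ HP H, ‖f z - g t z‖ * (z.im - H) ≤ Λ t) : SatisfiesH2 f b := by
  intro θ h0 h1
  have hs : 0 < Real.sin θ := Real.sin_pos_of_pos_of_lt_pi h0 (by linarith [Real.pi_pos])
  rw [Metric.tendsto_nhds]
  intro ε hε
  obtain ⟨t, ⟨⟨ht1, ht2⟩, ht3⟩, ht4⟩ := (((hg.and (hc.eventually (ball_mem_nhds b
    (by positivity : 0 < ε / 3)))).and (hΛ.eventually_lt_const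
    (by positivity : 0 < Real.sin θ / 2 * (ε / 3)))).and hle).exists
  filter_upwards [(ht1 θ h0 h1).eventually (ball_mem_nhds _ (by positivity : 0 < ε / 3)),
    mem_inf_of_right (mem_principal_self (Sector θ)),
    mem_inf_of_left (tendsto_norm_cobounded_atTop.eventually_gt_atTop
      ((2 * |H| + 1) / Real.sin θ))] with z hz1 hz2 hz3
  rw [mem_Sector_iff h0 h1] at hz2
  rw [div_lt_iff₀ hs] at hz3
  have hH := le_abs_self H
  have hH0 := abs_nonneg H
  have e1 := ht4 z (show H < z.im by linarith)
  have e2 : Real.sin θ / 2 * (‖z‖ * ‖f z - g t z‖) < Real.sin θ / 2 * (ε / 3) := by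
    refine lt_of_le_of_lt ?_ (e1.trans_lt ht3)
    have : ‖z‖ * Real.sin θ / 2 ≤ z.im - H := by linarith
    calc _ = ‖f z - g t z‖ * (‖z‖ * Real.sin θ / 2) := by ring
      _ ≤ _ := by gcongr
  have e3 : ‖z‖ * ‖f z - g t z‖ < ε / 3 := lt_of_mul_lt_mul_left e2 (by positivity)
  rw [← norm_mul] at e3
  rw [dist_eq_norm] at hz1 ⊢
  change dist (c t) b < _ at ht2
  rw [dist_eq_norm, norm_sub_rev] at ht2
  have e4 := norm_add₃_le (a := z * (f z - g t z)) (b := z * (g t z - z) - -c t) (c := b - c t)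
  have e5 : z * (f z - g t z) + (z * (g t z - z) - -c t) + (b - c t) = z * (f z - z) - -b := by
    ring
  rw [e5] at e4
  linarith

namespace IsEvolutionFamily

variable {T : ℝ} {D : ℝ → Set ℂ} {φ : ℝ → ℝ → ℂ → ℂ} {lam : ℝ → ℂ}

lemma extend (hT : 0 < T) (hE : IsEvolutionFamily (Ico 0 T) D φ lam) {D' : Set ℂ}
    {f : ℝ → ℂ → ℂ} {b : ℂ} (hslit : IsParallelSlitHalfPlane D')
    (hmaps : ∀ s ∈ Ico 0 T, MapsTo (f s) (D s) D')
    (hholo : ∀ s ∈ Ico 0 T, DifferentiableOn ℂ (f s) (D s))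
    (hinj : ∀ s ∈ Ico 0 T, InjOn (f s) (D s)) (h1 : ∀ s ∈ Ico 0 T, SatisfiesH1 (D s) (f s))
    (h2 : ∀ s ∈ Ico 0 T, SatisfiesH2 (f s) (b - lam s))
    (h3 : ∀ s ∈ Ico 0 T, IsHHull (D' \ f s '' D s))
    (hcomp : ∀ s ∈ Ico 0 T, ∀ t ∈ Ico 0 T, s ≤ t → ∀ z ∈ D s, f s z = f t (φ t s z))
    (hb : Tendsto lam (𝓝[<] T) (𝓝 b)) :
    ∃ (D₁ : ℝ → Set ℂ) (φ₁ : ℝ → ℝ → ℂ → ℂ) (lam₁ : ℝ → ℂ),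
      IsEvolutionFamily (Icc 0 T) D₁ φ₁ lam₁ ∧ (∀ t ∈ Ico 0 T, D₁ t = D t) ∧
      ∀ s ∈ Ico 0 T, ∀ t ∈ Ico 0 T, s ≤ t → EqOn (φ₁ t s) (φ t s) (D s) := by
  have h00 : (0 : ℝ) ∈ Ico 0 T := ⟨le_rfl, hT⟩
  set D₁ : ℝ → Set ℂ := Function.update D T D' with hD₁
  set φ₁ : ℝ → ℝ → ℂ → ℂ := Function.update φ T (Function.update f T id) with hφ₁
  set lam₁ : ℝ → ℂ := Function.update lam T b with hlam₁
  have eD : ∀ t ∈ Ico 0 T, D₁ t = D t := fun t ht => Function.update_of_ne ht.2.ne _ _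
  have eDT : D₁ T = D' := Function.update_self _ _ _
  have eφ : ∀ t ∈ Ico 0 T, ∀ s, φ₁ t s = φ t s := fun t ht s => by
    rw [hφ₁, Function.update_of_ne ht.2.ne]
  have eφT : ∀ s ∈ Ico 0 T, φ₁ T s = f s := fun s hs => by
    rw [hφ₁, Function.update_self, Function.update_of_ne hs.2.ne]
  have eφTT : φ₁ T T = id := by
    rw [hφ₁, Function.update_self, Function.update_self]
  have eL : ∀ t ∈ Ico 0 T, lam₁ t = lam t := fun t ht => Function.update_of_ne ht.2.ne _ _
  have hcase : ∀ t ∈ Icc 0 T, t ∈ Ico 0 T ∨ t = T := fun t ht =>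
    ht.2.lt_or_eq.imp (fun h => ⟨ht.1, h⟩) id
  have hpair : ∀ P : ℝ → ℝ → Prop, (∀ s ∈ Ico 0 T, ∀ t ∈ Ico 0 T, s ≤ t → P s t) →
      (∀ s ∈ Ico 0 T, P s T) → P T T → ∀ s ∈ Icc 0 T, ∀ t ∈ Icc 0 T, s ≤ t → P s t := by
    intro P a1 a2 a3 s hs t ht hst
    rcases hcase t ht with ht' | rfl
    · exact a1 s ⟨hs.1, hst.trans_lt ht'.2⟩ t ht' hst
    · rcases hcase s hs with hs' | rfl
      · exact a2 s hs'
      · exact a3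
  have hself : IsHHull (D' \ (id : ℂ → ℂ) '' D') := by
    rw [image_id, sdiff_self]
    exact isHHull_empty
  have hid2 : SatisfiesH2 id 0 := fun θ _ _ => by
    simpa using tendsto_const_nhds
  have hid1 : SatisfiesH1 D' id := by
    obtain ⟨Δ, rfl⟩ := hslit.exists_SD
    obtain ⟨B, hB⟩ := Δ.exists_slit_bound
    refine ⟨max 0 B, le_max_left _ _, fun z hz => ?_, by simpa using tendsto_const_nhds⟩
    change max 0 B < z.im at hz
    refine (Δ.mem_dom_or ((le_max_left _ _).trans_lt hz)).resolve_right ?_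
    rintro ⟨j, hj⟩
    have h1 := hB j z hj
    have h2 := (le_abs_self _).trans (Complex.abs_im_le_norm z)
    have h3 := le_max_right 0 B
    linarith
  refine ⟨D₁, φ₁, lam₁, ⟨?_, ?_, ?_, ?_, ?_, ?_, ?_, ?_, ?_, ?_, ?_⟩, eD, fun s _ t ht _ => ?_⟩
  · intro t ht
    rcases hcase t ht with ht' | rfl
    · rw [eD t ht']
      exact hE.slit t ht'
    · rwa [eDT]
  · refine hpair _ (fun s hs t ht hst => ?_) (fun s hs => ?_) ?_
    · rw [eφ t ht, eD s hs, eD t ht]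
      exact hE.mapsTo s hs t ht hst
    · rw [eφT s hs, eD s hs, eDT]
      exact hmaps s hs
    · rw [eφTT]
      exact mapsTo_id _
  · refine hpair _ (fun s hs t ht hst => ?_) (fun s hs => ?_) ?_
    · rw [eφ t ht, eD s hs]
      exact hE.holo s hs t ht hst
    · rw [eφT s hs, eD s hs]
      exact hholo s hs
    · rw [eφTT]
      exact differentiableOn_id
  · refine hpair _ (fun s hs t ht hst => ?_) (fun s hs => ?_) ?_
    · rw [eφ t ht, eD s hs]
      exact hE.inj s hs t ht hst
    · rw [eφT s hs, eD s hs]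
      exact hinj s hs
    · rw [eφTT]
      exact injOn_id _
  · refine hpair _ (fun s hs t ht hst => ?_) (fun s hs => ?_) ?_
    · rw [eφ t ht, eD s hs]
      exact hE.h1 s hs t ht hst
    · rw [eφT s hs, eD s hs]
      exact h1 s hs
    · rw [eφTT, eDT]
      exact hid1
  · refine hpair _ (fun s hs t ht hst => ?_) (fun s hs => ?_) ?_
    · rw [eφ t ht]
      exact hE.h2 s hs t ht hst
    · rw [eφT s hs]
      exact ⟨_, h2 s hs⟩
    · rw [eφTT]
      exact ⟨_, hid2⟩
  · refine hpair _ (fun s hs t ht hst => ?_) (fun s hs => ?_) ?_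
    · rw [eφ t ht, eD s hs, eD t ht]
      exact hE.h3 s hs t ht hst
    · rw [eφT s hs, eD s hs, eDT]
      exact h3 s hs
    · rw [eφTT, eDT]
      exact hself
  · intro t ht
    rcases hcase t ht with ht' | rfl
    · rw [eφ t ht', eD t ht']
      exact hE.ef1 t ht'
    · rw [eφTT]
      exact eqOn_refl _ _
  · intro s hs t ht u hu hst htu z hz
    rcases hcase u hu with hu' | rfl
    · have ht' : t ∈ Ico 0 T := ⟨ht.1, htu.trans_lt hu'.2⟩
      have hs' : s ∈ Ico 0 T := ⟨hs.1, hst.trans_lt ht'.2⟩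
      rw [eD s hs'] at hz
      rw [eφ u hu', eφ u hu', eφ t ht']
      exact hE.ef2 s hs' t ht' u hu' hst htu z hz
    · rcases hcase t ht with ht' | rfl
      · have hs' : s ∈ Ico 0 u := ⟨hs.1, hst.trans_lt ht'.2⟩
        rw [eD s hs'] at hz
        rw [eφT s hs', eφT t ht', eφ t ht']
        exact hcomp s hs' t ht' hst z hz
      · rw [eφTT]
        rfl
  · intro t ht
    rcases hcase t ht with ht' | rfl
    · rw [eφ t ht', eL t ht']
      exact hE.lam_res t ht'
    · rw [eφT 0 h00, hlam₁, Function.update_self]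
      have := h2 0 h00
      rwa [hE.lam_zero h00, sub_zero] at this
  · rw [hlam₁, continuousOn_update_iff, Icc_sdiff_right]
    refine ⟨hE.ef3, fun _ => ?_⟩
    rwa [nhdsWithin_Ico_eq_nhdsLT hT]
  · rw [eφ t ht]
    exact eqOn_refl _ _

/-- A family with bounded residues extends to the right end point. -/
lemma exists_extension (hT : 0 < T) (hE : IsEvolutionFamily (Ico 0 T) D φ lam)
    (hb : BddAbove ((fun t => (lam t).re) '' Ico 0 T)) :
    ∃ (D₁ : ℝ → Set ℂ) (φ₁ : ℝ → ℝ → ℂ → ℂ) (lam₁ : ℝ → ℂ),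
      IsEvolutionFamily (Icc 0 T) D₁ φ₁ lam₁ ∧ (∀ t ∈ Ico 0 T, D₁ t = D t) ∧
      ∀ s ∈ Ico 0 T, ∀ t ∈ Ico 0 T, s ≤ t → EqOn (φ₁ t s) (φ t s) (D s) := by
  have h00 : (0 : ℝ) ∈ Ico 0 T := ⟨le_rfl, hT⟩
  have hpos : ∀ t ∈ Ico 0 T, (0 : ℝ) ≤ t := fun t ht => ht.1
  obtain ⟨H, hH0, hH⟩ := hE.exists_HP_subset h00 hpos hb
  set M := sSup ((fun t => (lam t).re) '' Ico 0 T) with hM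
  have hleM : ∀ t ∈ Ico 0 T, (lam t).re ≤ M := fun t ht => le_csSup hb ⟨t, ht, rfl⟩
  set Λ : ℝ → ℝ := fun t => 2 * (M - (lam t).re) with hΛdef
  have hΛ : Tendsto Λ (𝓝[<] T) (𝓝 0) := by
    rw [Metric.tendsto_nhds]
    intro ε hε
    obtain ⟨_, ⟨t₀, ht₀, rfl⟩, hlt⟩ := exists_lt_of_lt_csSup
      (Set.Nonempty.image (fun t => (lam t).re) ⟨0, h00⟩) (show M - ε / 2 < M by linarith)
    filter_upwards [Ioo_mem_nhdsLT ht₀.2] with t ht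
    have ht' : t ∈ Ico 0 T := ⟨ht₀.1.trans ht.1.le, ht.2⟩
    have e1 := hE.re_mono h00 hpos ht₀ ht' ht.1.le
    have e2 := hleM t ht'
    change M - ε / 2 < (lam t₀).re at hlt
    rw [Real.dist_0_eq_abs, abs_lt]
    constructor <;> simp only [hΛdef] <;> linarith
  obtain ⟨b, hb', -⟩ := exists_tendsto_of_norm_sub_le (a := lam) hT (fun t ht u hu htu =>
    (hE.norm_lam_sub_le h00 hpos ht hu htu).trans (by
      have := hleM u hu
      change _ ≤ 2 * (M - (lam t).re)
      linarith)) hΛ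
  have : Nonempty SD := ⟨(hE.slit 0 h00).exists_SD.choose⟩
  choose! Δ hΔ using fun t ht => (hE.slit t ht).exists_SD
  have hlim : ∀ s ∈ Ico 0 T, ∃ f, Reg (Δ s) f ∧
      (∀ z ∈ (Δ s).dom, Tendsto (fun t => φ t s z) (𝓝[<] T) (𝓝 (f z))) ∧
      (∀ t ∈ Ico s T, ∀ z ∈ HP H, ‖f z - φ t s z‖ * (z.im - H) ≤ Λ t) ∧
      (∀ K, IsCompact K → K ⊆ UHP →
        ∃ C, ∀ t ∈ Ico s T, ∀ z ∈ K ∩ (Δ s).dom, ‖f z - φ t s z‖ ≤ C * Λ t) := by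
    intro s hs
    have hI : ∀ t ∈ Ico s T, t ∈ Ico 0 T := fun t ht => ⟨hs.1.trans ht.1, ht.2⟩
    refine (Δ s).exists_limit (g := fun t => φ t s) hs.2 (hΔ s hs ▸ hH s hs)
      (fun t ht => hE.reg hs (hI t ht) ht.1 (hΔ s hs)) ?_ ?_ hΛ
    · intro t ht u hu htu z hz
      rw [hΔ s hs] at hz
      rw [hE.ef2 s hs t (hI t ht) u (hI u hu) ht.1 htu z hz]
      exact hE.im_le (hI t ht) (hI u hu) htu (hE.mapsTo s hs t (hI t ht) ht.1 hz)
    · intro t ht u hu htu z hz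
      have hzD := hH s hs hz
      change ‖φ u s z - φ t s z‖ * _ ≤ _
      rw [hE.ef2 s hs t (hI t ht) u (hI u hu) ht.1 htu z hzD]
      have him := hE.im_le hs (hI t ht) ht.1 hzD
      have e1 := hE.norm_sub_le h00 hpos (hI t ht) (hI u hu) htu (hH t (hI t ht))
        (z := φ t s z) (lt_of_lt_of_le hz him)
      have e2 := hleM u (hI u hu)
      refine le_trans ?_ (e1.trans (by change _ ≤ 2 * (M - (lam t).re); linarith))
      gcongr
  choose! f hreg hflim hfH hfK using hlim
  have hcomp : ∀ s ∈ Ico 0 T, ∀ t ∈ Ico 0 T, s ≤ t → ∀ z ∈ D s, f s z = f t (φ t s z) := by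
    intro s hs t ht hst z hz
    refine tendsto_nhds_unique (hflim s hs z (hΔ s hs ▸ hz)) ((hflim t ht (φ t s z)
      (hΔ t ht ▸ hE.mapsTo s hs t ht hst hz)).congr' ?_)
    filter_upwards [Ioo_mem_nhdsLT ht.2] with u hu
    exact (hE.ef2 s hs t ht u ⟨ht.1.trans hu.1.le, hu.2⟩ hst hu.1.le z hz).symm
  have hcl : ∀ s ∈ Ico 0 T, slitCluster (Δ 0).dom (f 0) = slitCluster (Δ s).dom (f s) :=
    fun s hs => slitCluster_eq_of_comp (hE.isSlitMap h00 hs hs.1 (hΔ 0 h00) (hΔ s hs))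
      (hΔ 0 h00 ▸ hcomp 0 h00 s hs hs.1)
  have hIoo : ∀ s ∈ Ico 0 T, ∀ᶠ t in 𝓝[<] T, t ∈ Ico s T := fun s hs => by
    filter_upwards [Ioo_mem_nhdsLT hs.2] with t ht
    exact ⟨ht.1.le, ht.2⟩
  refine hE.extend hT (D' := UHP \ slitCluster (Δ 0).dom (f 0)) (f := f) (b := b)
    (hreg 0 h00).isParallelSlitHalfPlane ?_ (fun s hs => hΔ s hs ▸ (hreg s hs).holo)
    (fun s hs => hΔ s hs ▸ (hreg s hs).inj) (fun s hs => hΔ s hs ▸ (hreg s hs).h1) ?_ ?_ hcomp hb'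
  · intro s hs
    rw [hcl s hs, ← hΔ s hs]
    exact (hreg s hs).mapsTo_codom
  · intro s hs
    refine satisfiesH2_of_tendsto (g := fun t => φ t s) (c := fun t => lam t - lam s) ?_
      (hb'.sub_const _) hΛ ((hIoo s hs).mono fun t ht => hfH s hs t ht)
    filter_upwards [hIoo s hs] with t ht
    exact hE.residue h00 hs ⟨hs.1.trans ht.1, ht.2⟩ hs.1 ht.1
  · intro s hs
    rw [hcl s hs, ← hΔ s hs]
    obtain ⟨r, hr1, hr2⟩ := exists_between (Δ s).hR
    refine (hreg s hs).isHHull ((hreg s hs).isSimplyConnected_fill hr1 hr2 fun ε hε => ?_)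
    have hK : IsCompact (⋃ j, {z | ((Δ s).S j).rho z ≤ r}) :=
      isCompact_iUnion fun j => ((Δ s).S j).isCompact_rho_le r
    have hKU : (⋃ j, {z | ((Δ s).S j).rho z ≤ r}) ⊆ UHP := by
      refine iUnion_subset fun j z hz => ?_
      exact (Δ s).sub j z (le_trans hz hr2.le)
    obtain ⟨C, hC⟩ := hfK s hs _ hK hKU
    have h2 : Tendsto (fun t => C * Λ t) (𝓝[<] T) (𝓝 0) := by simpa using hΛ.const_mul C
    obtain ⟨t, ht1, ht2⟩ := ((h2.eventually_le_const hε).and (hIoo s hs)).exists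
    have ht : t ∈ Ico 0 T := ⟨hs.1.trans ht2.1, ht2.2⟩
    refine ⟨φ t s, hE.reg hs ht ht2.1 (hΔ s hs),
      (hE.isSlitMap hs ht ht2.1 (hΔ s hs) (hΔ t ht)).isSimplyConnected_fill, fun j z hz hzr => ?_⟩
    rw [norm_sub_rev]
    exact (hC t ht2 z ⟨mem_iUnion.2 ⟨j, hzr⟩, hz⟩).trans ht1

end IsEvolutionFamily

/-- an evolution family on `[0,T)` extends (uniquely) to an
evolution family on `[0,T]` iff `sup λ < ∞`. -/
theorem statement4 {T : ℝ} (hT : 0 < T)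
    {D : ℝ → Set ℂ} {φ : ℝ → ℝ → ℂ → ℂ} {lam : ℝ → ℂ}
    (hEF : IsEvolutionFamily (Set.Ico 0 T) D φ lam) :
    ((∃ (D' : ℝ → Set ℂ) (φ' : ℝ → ℝ → ℂ → ℂ) (lam' : ℝ → ℂ),
        IsEvolutionFamily (Set.Icc 0 T) D' φ' lam' ∧
        (∀ t ∈ Set.Ico 0 T, D' t = D t) ∧
        (∀ s ∈ Set.Ico 0 T, ∀ t ∈ Set.Ico 0 T, s ≤ t →
          Set.EqOn (φ' t s) (φ t s) (D s))) ↔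
      BddAbove ((fun t => (lam t).re) '' Set.Ico 0 T)) ∧
    (∀ (D₁ D₂ : ℝ → Set ℂ) (φ₁ φ₂ : ℝ → ℝ → ℂ → ℂ) (lam₁ lam₂ : ℝ → ℂ),
      IsEvolutionFamily (Set.Icc 0 T) D₁ φ₁ lam₁ →
      IsEvolutionFamily (Set.Icc 0 T) D₂ φ₂ lam₂ →
      (∀ t ∈ Set.Ico 0 T, D₁ t = D t) →
      (∀ s ∈ Set.Ico 0 T, ∀ t ∈ Set.Ico 0 T, s ≤ t →
        Set.EqOn (φ₁ t s) (φ t s) (D s)) →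
      (∀ t ∈ Set.Ico 0 T, D₂ t = D t) →
      (∀ s ∈ Set.Ico 0 T, ∀ t ∈ Set.Ico 0 T, s ≤ t →
        Set.EqOn (φ₂ t s) (φ t s) (D s)) →
      D₁ T = D₂ T ∧
      ∀ s ∈ Set.Icc 0 T, ∀ t ∈ Set.Icc 0 T, s ≤ t →
        Set.EqOn (φ₁ t s) (φ₂ t s) (D₁ s)) := by
  refine ⟨⟨fun ⟨D', φ', lam', hE', _, hφ⟩ => hEF.bddAbove_of_extension hT hE'
    fun t ht => hφ 0 ⟨le_rfl, hT⟩ t ht ht.1, fun hb => hEF.exists_extension hT hb⟩, ?_⟩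
  intro D₁ D₂ φ₁ φ₂ lam₁ lam₂ hE₁ hE₂ hD₁ hφ₁ hD₂ hφ₂
  refine IsEvolutionFamily.unique_extension hT hE₁ hE₂
    (fun t ht => (hD₁ t ht).trans (hD₂ t ht).symm) fun s hs t ht hst => ?_
  rw [hD₁ s hs]
  exact (hφ₁ s hs t ht hst).trans (hφ₂ s hs t ht hst).symm
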